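/- Let u₀ ∈ L∞(ℝ) with 0 ≤ u₀ ≤ 1 a.e. satisfy: (i) there exists û ∈ L∞(ℝ) with 0 ≤ û ≤ 1 a.e., ∂_x û ∈ L¹(ℝ) ∩ L∞(ℝ), and u₀ - û ∈ L¹(ℝ); (ii) ∂_x φ_i(u₀) ∈ L∞(Ω_i); (iii) lim_{x↗0} u₀(x) = 1 or lim_{x↘0} u₀(x) = 0. For ε ∈ (0,1) let u^ε be the corresponding bounded flux solution of (P^ε). Then for every T > 0 there is a constant C depending only on u₀, g_i, φ_i and T (not on ε) such that √ε · ‖∂_x φ_i(u^ε)‖_{L²(Ω_i×(0,T))} ≤ C for i = 1,2; in particular ε ‖∂_x φ_i(u^ε)‖_{L²(Ω_i×(0,T))} → 0 as ε → 0. -/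

import Mathlib

open MeasureTheory Set Filter

noncomputable section

/-- `w` is the weak derivative of `v` on `ℝ`. -/
def IsWeakDeriv (v w : ℝ → ℝ) : Prop :=
  ∀ θ : ℝ → ℝ, ContDiff ℝ (⊤ : ℕ∞) θ → HasCompactSupport θ →
    ∫ x : ℝ, v x * deriv θ x = - ∫ x : ℝ, w x * θ x

/-- `w` is the weak derivative of `v` on the open set `Ω ⊆ ℝ`. -/
def IsWeakDerivOn (Ω : Set ℝ) (v w : ℝ → ℝ) : Prop :=
  ∀ θ : ℝ → ℝ, ContDiff ℝ (⊤ : ℕ∞) θ → HasCompactSupport θ → (∀ x ∉ Ω, θ x = 0) →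
    ∫ x in Ω, v x * deriv θ x = - ∫ x in Ω, w x * θ x

/-- Smooth test functions, compactly supported in `ℝ × [0,∞)` (extended to `ℝ²`). -/
def Test (ψ : ℝ → ℝ → ℝ) : Prop :=
  ContDiff ℝ (⊤ : ℕ∞) (fun p : ℝ × ℝ => ψ p.1 p.2) ∧
  HasCompactSupport (fun p : ℝ × ℝ => ψ p.1 p.2)

/-- `w` is the weak `x`-derivative of `v` on `Ω × (0,∞)`. -/
def IsWeakXDeriv (Ω : Set ℝ) (v w : ℝ → ℝ → ℝ) : Prop :=
  ∀ θ : ℝ → ℝ → ℝ, Test θ → (∀ x t, x ∉ Ω → θ x t = 0) →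
    (∫ t in Set.Ioi (0:ℝ), ∫ x in Ω, v x t * deriv (fun y => θ y t) x)
      = - ∫ t in Set.Ioi (0:ℝ), ∫ x in Ω, w x t * θ x t

/-- Bounded flux solution to the approximate problem `(P^ε)` (Definition 2.1), with
explicit weak space derivatives `w₁ = ∂ₓφ₁(u)` on `Ω₁ = (-∞,0)` and
`w₂ = ∂ₓφ₂(u)` on `Ω₂ = (0,∞)`. -/
def IsBFS (ε : ℝ) (f₁ f₂ φ₁ φ₂ : ℝ → ℝ) (u₀ : ℝ → ℝ)
    (u w₁ w₂ : ℝ → ℝ → ℝ) : Prop :=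
  -- (1) `u ∈ L∞`, `0 ≤ u ≤ 1`
  AEMeasurable (fun p : ℝ × ℝ => u p.1 p.2) ∧
  (∀ᵐ p : ℝ × ℝ, 0 < p.2 → u p.1 p.2 ∈ Set.Icc (0:ℝ) 1) ∧
  -- (2) weak derivatives `∂ₓφᵢ(u) ∈ L∞(Ωᵢ×(0,∞)) ∩ L²loc((0,∞);L²(Ωᵢ))`
  IsWeakXDeriv (Set.Iio 0) (fun x t => φ₁ (u x t)) w₁ ∧
  IsWeakXDeriv (Set.Ioi 0) (fun x t => φ₂ (u x t)) w₂ ∧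
  AEMeasurable (fun p : ℝ × ℝ => w₁ p.1 p.2) ∧
  AEMeasurable (fun p : ℝ × ℝ => w₂ p.1 p.2) ∧
  (∃ M : ℝ, ∀ᵐ p : ℝ × ℝ, 0 < p.2 →
      (p.1 < 0 → |w₁ p.1 p.2| ≤ M) ∧ (0 < p.1 → |w₂ p.1 p.2| ≤ M)) ∧
  (∀ T : ℝ, 0 < T →
    MeasureTheory.IntegrableOn (fun p : ℝ × ℝ => (w₁ p.1 p.2) ^ 2)
      (Set.Iio 0 ×ˢ Set.Ioc 0 T) ∧
    MeasureTheory.IntegrableOn (fun p : ℝ × ℝ => (w₂ p.1 p.2) ^ 2)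
      (Set.Ioi 0 ×ˢ Set.Ioc 0 T)) ∧
  -- (3) one-sided traces at the interface connect the capillary pressures
  (∀ᵐ t : ℝ, 0 < t → ∃ a b : ℝ,
    Filter.Tendsto (fun x => u x t) (nhdsWithin 0 (Set.Iio 0)) (nhds a) ∧
    Filter.Tendsto (fun x => u x t) (nhdsWithin 0 (Set.Ioi 0)) (nhds b) ∧
    a * (1 - b) = 0) ∧
  -- (4) weak formulation
  (∀ ψ : ℝ → ℝ → ℝ, Test ψ →
    (∫ t in Set.Ioi (0:ℝ), ∫ x : ℝ, u x t * deriv (fun s => ψ x s) t)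
    + (∫ x : ℝ, u₀ x * ψ x 0)
    + (∫ t in Set.Ioi (0:ℝ),
        (∫ x in Set.Iio (0:ℝ), (f₁ (u x t) - ε * w₁ x t) * deriv (fun y => ψ y t) x)
      + (∫ x in Set.Ioi (0:ℝ), (f₂ (u x t) - ε * w₂ x t) * deriv (fun y => ψ y t) x)) = 0)

lemma intervalIntegrable_of_bdd {f : ℝ → ℝ} (hf : Measurable f) {M : ℝ}
    (hM : ∀ x, |f x| ≤ M) (a b : ℝ) : IntervalIntegrable f volume a b := by
  rw [intervalIntegrable_iff]
  refine Measure.integrableOn_of_bounded (M := M) ?_ hf.aestronglyMeasurable ?_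
  · simp [uIoc]
  · exact Eventually.of_forall fun x => by simpa using hM x

lemma locallyIntegrable_of_bdd {f : ℝ → ℝ} (hf : Measurable f) {M : ℝ}
    (hM : ∀ x, |f x| ≤ M) : LocallyIntegrable f := by
  intro x
  refine ⟨Icc (x - 1) (x + 1), Icc_mem_nhds (by linarith) (by linarith), ?_⟩
  refine Measure.integrableOn_of_bounded (M := M) ?_ hf.aestronglyMeasurable ?_
  · simp
  · exact Eventually.of_forall fun x => by simpa using hM x

lemma lipschitzWith_prim {f : ℝ → ℝ} (hf : Measurable f) {M : ℝ}
    (hM : ∀ x, |f x| ≤ M) (a : ℝ) :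
    LipschitzWith M.toNNReal (fun x => ∫ y in a..x, f y) := by
  refine LipschitzWith.of_dist_le_mul fun x y => ?_
  have h0 : 0 ≤ M := (abs_nonneg _).trans (hM 0)
  rw [Real.dist_eq, Real.dist_eq, Real.coe_toNNReal _ h0,
    intervalIntegral.integral_interval_sub_left (intervalIntegrable_of_bdd hf hM _ _)
      (intervalIntegrable_of_bdd hf hM _ _)]
  have := intervalIntegral.norm_integral_le_of_norm_le_const (a := y) (b := x) (f := f) (C := M)
    (fun z _ => by simpa using hM z)
  simpa using this

lemma ae_hasDerivAt_prim {f : ℝ → ℝ} (hf : Measurable f) {M : ℝ}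
    (hM : ∀ x, |f x| ≤ M) (a : ℝ) :
    ∀ᵐ x, HasDerivAt (fun x => ∫ y in a..x, f y) (f x) x := by
  filter_upwards [LocallyIntegrable.ae_hasDerivAt_integral (locallyIntegrable_of_bdd hf hM)]
    with x hx using hx a

lemma integral_ibp {F f G g : ℝ → ℝ} {K L : NNReal} (hF : LipschitzWith K F)
    (hF' : ∀ᵐ x, HasDerivAt F (f x) x) (hG : LipschitzWith L G)
    (hG' : ∀ᵐ x, HasDerivAt G (g x) x) (a b : ℝ) :
    ∫ x in a..b, (f x * G x + F x * g x) = F b * G b - F a * G a := by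
  rw [← (hF.lipschitzOnWith (s := uIcc a b)).absolutelyContinuousOnInterval.integral_deriv_mul_eq_sub
    (hG.lipschitzOnWith (s := uIcc a b)).absolutelyContinuousOnInterval]
  apply intervalIntegral.integral_congr_ae
  filter_upwards [hF', hG'] with x h1 h2 _
  rw [h1.deriv, h2.deriv]

lemma contDiff_compactSupport_lipschitz {ξ : ℝ → ℝ} (h : ContDiff ℝ (⊤ : ℕ∞) ξ)
    (hc : HasCompactSupport ξ) : ∃ K, LipschitzWith K ξ :=
  ContDiff.lipschitzWith_of_hasCompactSupport hc h (by simp)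

/-- Integration by parts on the line against a test function. -/
lemma integral_prim_mul_deriv {W ξ : ℝ → ℝ} (hW : Measurable W) {M : ℝ}
    (hM : ∀ x, |W x| ≤ M) (h : ContDiff ℝ (⊤ : ℕ∞) ξ) (hc : HasCompactSupport ξ) :
    ∫ x, (∫ y in (0:ℝ)..x, W y) * deriv ξ x = - ∫ x, W x * ξ x := by
  obtain ⟨K, hK⟩ := contDiff_compactSupport_lipschitz h hc
  obtain ⟨R, hR⟩ := hc.isCompact.isBounded.subset_ball 0
  have hd : ∀ x, x ∉ Ioc (-R) R → ξ x = 0 ∧ deriv ξ x = 0 := by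
    intro x hx
    have : x ∉ tsupport ξ := fun hx' => hx (by
      have := hR hx'; rw [Real.ball_eq_Ioo] at this; simp at this; exact ⟨this.1, this.2.le⟩)
    exact ⟨image_eq_zero_of_notMem_tsupport this,
      image_eq_zero_of_notMem_tsupport (fun h' => this (tsupport_deriv_subset h'))⟩
  have hdiff : ∀ x, HasDerivAt ξ (deriv ξ x) x := fun x =>
    ((h.differentiable (by simp)) x).hasDerivAt
  by_cases hR0 : R ≤ 0
  · have : ∀ x, ξ x = 0 ∧ deriv ξ x = 0 := fun x => hd x (by simp; intro h; linarith)
    simp [this]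
  push Not at hR0
  have key := integral_ibp (lipschitzWith_prim hW hM 0) (ae_hasDerivAt_prim hW hM 0) hK
    (Eventually.of_forall hdiff) (-R) R
  have e1 : ξ R = 0 := by
    have : R ∉ tsupport ξ := fun hx' => by
      have := hR hx'; rw [Real.ball_eq_Ioo] at this; simp at this
    exact image_eq_zero_of_notMem_tsupport this
  have e2 : ξ (-R) = 0 := (hd _ (by simp)).1
  rw [e1, e2, intervalIntegral.integral_of_le (by linarith)] at key
  have s1 : ∫ x, (∫ y in (0:ℝ)..x, W y) * deriv ξ x
      = ∫ x in Ioc (-R) R, (∫ y in (0:ℝ)..x, W y) * deriv ξ x := by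
    rw [setIntegral_eq_integral_of_forall_compl_eq_zero]
    intro x hx; simp [hd x hx]
  have s2 : ∫ x, W x * ξ x = ∫ x in Ioc (-R) R, W x * ξ x := by
    rw [setIntegral_eq_integral_of_forall_compl_eq_zero]
    intro x hx; simp [hd x hx]
  have i1 : IntegrableOn (fun x => W x * ξ x) (Ioc (-R) R) := by
    have := (intervalIntegrable_of_bdd hW hM (-R) R).mul_continuousOn
      (h.continuous.continuousOn)
    rwa [intervalIntegrable_iff_integrableOn_Ioc_of_le (by linarith)] at this
  have i2 : IntegrableOn (fun x => (∫ y in (0:ℝ)..x, W y) * deriv ξ x) (Ioc (-R) R) := by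
    refine (Continuous.integrableOn_Icc ?_).mono_set Ioc_subset_Icc_self
    exact (lipschitzWith_prim hW hM 0).continuous.mul (h.continuous_deriv (by simp))
  rw [integral_add i1 i2] at key
  rw [s1, s2]; linarith

lemma ae_const_of_weak {Ω : Set ℝ} (hΩ : IsOpen Ω) (hoc : OrdConnected Ω) {e : ℝ → ℝ}
    (he : LocallyIntegrable e)
    (h : ∀ ξ : ℝ → ℝ, ContDiff ℝ (⊤ : ℕ∞) ξ → HasCompactSupport ξ → tsupport ξ ⊆ Ω →
      ∫ x, e x * deriv ξ x = 0) : ∃ c, ∀ᵐ x, x ∈ Ω → e x = c := by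
  rcases Ω.eq_empty_or_nonempty with rfl | ⟨x0, hx0⟩
  · exact ⟨0, by simp⟩
  obtain ⟨r, hr, hrΩ⟩ := Metric.isOpen_iff.1 hΩ x0 hx0
  let B : ContDiffBump x0 := ⟨r / 4, r / 2, by positivity, by linarith⟩
  let b : ℝ → ℝ := B.normed volume
  have hbs : ContDiff ℝ (⊤ : ℕ∞) b := B.contDiff_normed
  have hbc : HasCompactSupport b := B.hasCompactSupport_normed
  have hb1 : ∫ x, b x = 1 := B.integral_normed
  have hbt : tsupport b ⊆ Ω := by
    rw [show tsupport b = _ from B.tsupport_normed_eq]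
    exact (Metric.closedBall_subset_ball (by show r / 2 < r; linarith)).trans hrΩ
  have hib : ∀ ψ : ℝ → ℝ, Continuous ψ → HasCompactSupport ψ →
      Integrable (fun x => ψ x * e x) := fun ψ h1 h2 => by
    simpa using he.integrable_smul_left_of_hasCompactSupport h1 h2
  refine ⟨∫ x, b x * e x, ?_⟩
  set c := ∫ x, b x * e x with hc
  have key := hΩ.ae_eq_zero_of_integral_contDiff_smul_eq_zero (μ := volume)
    (f := fun x => e x - c) ((he.sub (locallyIntegrable_const c)).locallyIntegrableOn _) ?_
  · filter_upwards [key] with x hx hxΩ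
    have := hx hxΩ; linarith
  intro ψ hψ hψc hψt
  let k : ℝ := ∫ x, ψ x
  let ρ : ℝ → ℝ := fun x => ψ x - k * b x
  have hρs : ContDiff ℝ (⊤ : ℕ∞) ρ := hψ.sub (contDiff_const.mul hbs)
  have hK : IsCompact (tsupport ψ ∪ tsupport b) := hψc.isCompact.union hbc.isCompact
  have hKne : (tsupport ψ ∪ tsupport b).Nonempty := by
    refine ⟨x0, Or.inr ?_⟩
    rw [show tsupport b = _ from B.tsupport_normed_eq]
    exact Metric.mem_closedBall_self (by show 0 ≤ r / 2; positivity)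
  set m := sInf (tsupport ψ ∪ tsupport b)
  set m' := sSup (tsupport ψ ∪ tsupport b)
  have hmK := hK.sInf_mem hKne
  have hm'K := hK.sSup_mem hKne
  have hKΩ : tsupport ψ ∪ tsupport b ⊆ Ω := union_subset hψt hbt
  have hsub : Icc m m' ⊆ Ω := hoc.out (hKΩ hmK) (hKΩ hm'K)
  have hle : m ≤ m' := csInf_le hK.bddBelow hm'K
  have hρ0 : ∀ x, x ∉ Icc m m' → ρ x = 0 := by
    intro x hx
    have h1 : x ∉ tsupport ψ ∪ tsupport b := fun h' =>
      hx ⟨csInf_le hK.bddBelow h', le_csSup hK.bddAbove h'⟩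
    simp only [mem_union, not_or] at h1
    simp [ρ, image_eq_zero_of_notMem_tsupport h1.1, image_eq_zero_of_notMem_tsupport h1.2]
  have hψi : Integrable ψ := hψ.continuous.integrable_of_hasCompactSupport hψc
  have hbi : Integrable b := hbs.continuous.integrable_of_hasCompactSupport hbc
  have hρint : ∫ x, ρ x = 0 := by
    simp only [ρ]
    rw [integral_sub hψi (hbi.const_mul k), integral_const_mul, hb1]; simp [k]
  let θ : ℝ → ℝ := fun x => ∫ y in (m - 1)..x, ρ y
  have hθd : ∀ x, HasDerivAt θ (ρ x) x := fun x =>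
    intervalIntegral.integral_hasDerivAt_right (hρs.continuous.intervalIntegrable _ _)
      (hρs.continuous.stronglyMeasurableAtFilter _ _) hρs.continuous.continuousAt
  have hθ' : deriv θ = ρ := funext fun x => (hθd x).deriv
  have hθs : ContDiff ℝ (⊤ : ℕ∞) θ := by
    rw [contDiff_infty_iff_deriv]
    exact ⟨fun x => (hθd x).differentiableAt, hθ' ▸ hρs⟩
  have hθ0 : ∀ x, x ∉ Icc m m' → θ x = 0 := by
    intro x hx
    simp only [mem_Icc, not_and_or, not_le] at hx
    rcases hx with hx | hx
    · simp only [θ]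
      apply intervalIntegral.integral_zero_ae
      refine Eventually.of_forall fun y hy => hρ0 y ?_
      simp only [uIoc, mem_Ioc, mem_Icc, not_and_or, not_le] at hy ⊢
      left; exact hy.2.trans_lt (by simp [hx])
    · simp only [θ]
      rw [intervalIntegral.integral_of_le (by linarith),
        setIntegral_eq_integral_of_forall_compl_eq_zero, hρint]
      intro y hy
      apply hρ0
      simp only [mem_Ioc, mem_Icc, not_and_or, not_le, not_lt] at hy ⊢
      rcases hy with hy | hy
      · left; linarith
      · right; linarith
  have hθt : tsupport θ ⊆ Icc m m' :=
    closure_minimal (fun x hx => by by_contra h'; exact hx (hθ0 x h')) isClosed_Icc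
  have hθc : HasCompactSupport θ := isCompact_Icc.of_isClosed_subset (isClosed_tsupport θ) hθt
  have := h θ hθs hθc (hθt.trans hsub)
  rw [hθ'] at this
  have e1 : ∫ x, e x * ρ x = (∫ x, ψ x * e x) - k * c := by
    rw [hc, ← integral_const_mul, ← integral_sub (hib ψ hψ.continuous hψc)
      ((hib b hbs.continuous hbc).const_mul k)]
    congr 1; ext x; simp only [ρ]; ring
  have e2 : ∫ x, ψ x • (e x - c) = (∫ x, ψ x * e x) - k * c := by
    simp only [k, smul_eq_mul, mul_sub]
    rw [integral_sub (hib ψ hψ.continuous hψc) (hψi.mul_const c), integral_mul_const]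
  rw [e2, ← e1, this]

lemma weak_deriv_ae_eq_prim {Ω : Set ℝ} (hΩ : IsOpen Ω) (hoc : OrdConnected Ω) {V W : ℝ → ℝ}
    (hV : LocallyIntegrable V) (hW : Measurable W) {M : ℝ} (hM : ∀ x, |W x| ≤ M)
    (h : ∀ ξ : ℝ → ℝ, ContDiff ℝ (⊤ : ℕ∞) ξ → HasCompactSupport ξ → tsupport ξ ⊆ Ω →
      ∫ x, V x * deriv ξ x = - ∫ x, W x * ξ x) :
    ∃ c, ∀ᵐ x, x ∈ Ω → V x = c + ∫ y in (0:ℝ)..x, W y := by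
  have hWc := (lipschitzWith_prim hW hM 0).continuous
  obtain ⟨c, hc⟩ := ae_const_of_weak hΩ hoc (hV.sub hWc.locallyIntegrable) (by
    intro ξ h1 h2 h3
    have hd : Continuous (deriv ξ) := h1.continuous_deriv (by simp)
    have i1 : Integrable (fun x => V x * deriv ξ x) := by
      simpa [mul_comm] using hV.integrable_smul_left_of_hasCompactSupport hd h2.deriv
    have i2 : Integrable (fun x => (∫ y in (0:ℝ)..x, W y) * deriv ξ x) :=
      (hWc.mul hd).integrable_of_hasCompactSupport h2.deriv.mul_left
    simp only [Pi.sub_apply, sub_mul]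
    rw [integral_sub i1 i2, h ξ h1 h2 h3, integral_prim_mul_deriv hW hM h1 h2]; simp)
  refine ⟨c, ?_⟩
  filter_upwards [hc] with x hx hxΩ
  have := hx hxΩ
  simp only [Pi.sub_apply] at this
  linarith

lemma measurable_intervalIntegral_param {α : Type*} [MeasurableSpace α] {f : α → ℝ → ℝ}
    (hf : Measurable (Function.uncurry f)) {l r : α → ℝ} (hl : Measurable l)
    (hr : Measurable r) : Measurable (fun a => ∫ y in (l a)..(r a), f a y) := by
  have aux : ∀ l r : α → ℝ, Measurable l → Measurable r →
      Measurable (fun a => ∫ y in Ioc (l a) (r a), f a y) := by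
    intro l r hl hr
    have hs : MeasurableSet {p : α × ℝ | p.2 ∈ Ioc (l p.1) (r p.1)} :=
      (measurableSet_lt (hl.comp measurable_fst) measurable_snd).inter
        (measurableSet_le measurable_snd (hr.comp measurable_fst))
    have h := (hf.indicator hs).stronglyMeasurable.integral_prod_right' (ν := volume)
    convert h.measurable using 2 with a
    rw [← integral_indicator measurableSet_Ioc]
    rfl
  simp only [intervalIntegral]
  exact (aux l r hl hr).sub (aux r l hr hl)

lemma measurable_integral_param {α : Type*} [MeasurableSpace α] {f : α → ℝ → ℝ}
    (hf : Measurable (Function.uncurry f)) : Measurable (fun a => ∫ y, f a y) :=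
  hf.stronglyMeasurable.integral_prod_right.measurable

lemma abs_intervalIntegral_le {f : ℝ → ℝ} {M : ℝ} (hM : ∀ x, |f x| ≤ M) (a b : ℝ) :
    |∫ y in a..b, f y| ≤ M * |b - a| :=
  intervalIntegral.norm_integral_le_of_norm_le_const (f := f) (fun z _ => hM z)

lemma integrable_prod_of_bdd {f : ℝ × ℝ → ℝ} (hf : Measurable f) {s t : Set ℝ}
    (hs : volume s ≠ ⊤) (ht : volume t ≠ ⊤) {M : ℝ} (hsm : MeasurableSet s)
    (htm : MeasurableSet t)
    (hM : ∀ p ∈ s ×ˢ t, |f p| ≤ M) :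
    Integrable f ((volume.restrict s).prod (volume.restrict t)) := by
  rw [Measure.prod_restrict]
  refine Measure.integrableOn_of_bounded (M := M) ?_ hf.aestronglyMeasurable ?_
  · rw [Measure.prod_prod]; exact ENNReal.mul_ne_top hs ht
  · exact (ae_restrict_mem (hsm.prod htm)).mono fun p hp => by simpa using hM p hp

/-- Fubini for bounded functions on a product of intervals. -/
lemma intervalIntegral_swap {f : ℝ → ℝ → ℝ} (hf : Measurable (Function.uncurry f)) {M : ℝ}
    {a b c d : ℝ} (hM : ∀ x ∈ uIcc a b, ∀ y ∈ uIcc c d, |f x y| ≤ M) :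
    ∫ x in a..b, ∫ y in c..d, f x y = ∫ y in c..d, ∫ x in a..b, f x y := by
  apply intervalIntegral_intervalIntegral_swap
  rw [IntegrableOn, Measure.volume_eq_prod, ← Measure.prod_restrict]
  exact integrable_prod_of_bdd hf (by simp [uIoc]) (by simp [uIoc]) measurableSet_uIoc
    measurableSet_uIoc fun p hp => hM _ (uIoc_subset_uIcc hp.1) _ (uIoc_subset_uIcc hp.2)

lemma integrable_prod_weight {V : ℝ → ℝ → ℝ} (hV : Measurable (Function.uncurry V)) {M : ℝ}
    (hM : ∀ x t, |V x t| ≤ M) {ρ : ℝ → ℝ} (hρ : Integrable ρ) (a b : ℝ) :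
    Integrable (fun p : ℝ × ℝ => V p.1 p.2 * ρ p.1)
      (volume.prod (volume.restrict (uIoc a b))) := by
  have h1 : Integrable (fun _ : ℝ => (1:ℝ)) (volume.restrict (uIoc a b)) :=
    integrable_const_iff.2 (Or.inr ⟨by simp [uIoc]⟩)
  have h2 := (hρ.mul_prod h1)
  have h3 := h2.bdd_mul (c := M) (f := fun p : ℝ × ℝ => V p.1 p.2) hV.aestronglyMeasurable
    (Eventually.of_forall fun p => hM p.1 p.2)
  simpa using h3

lemma intervalIntegral_integral_swap_weight {V : ℝ → ℝ → ℝ}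
    (hV : Measurable (Function.uncurry V)) {M : ℝ}
    (hM : ∀ x t, |V x t| ≤ M) {ρ : ℝ → ℝ} (hρ : Integrable ρ) (a b : ℝ) :
    ∫ t in a..b, ∫ x, V x t * ρ x = ∫ x, (∫ t in a..b, V x t) * ρ x := by
  rw [intervalIntegral_integral_swap (f := fun t x => V x t * ρ x)]
  · congr 1; ext x; rw [intervalIntegral.integral_mul_const]
  · exact (integrable_prod_weight hV hM hρ a b).swap

/-- If `∂ₓ V = W` weakly in `x`, for almost every time, then `V` is an indefinite integral
of `W` in `x` up to a function of time. -/
lemma weak_xderiv_ae_eq_prim {Ω : Set ℝ} (hΩ : IsOpen Ω) (hoc : OrdConnected Ω)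
    (hne : Ω.Nonempty) {V W : ℝ → ℝ → ℝ} (hV : Measurable (Function.uncurry V))
    (hW : Measurable (Function.uncurry W)) {K M : ℝ} (hK : ∀ x t, |V x t| ≤ K)
    (hM : ∀ x t, |W x t| ≤ M)
    (h : ∀ ξ : ℝ → ℝ, ContDiff ℝ (⊤ : ℕ∞) ξ → HasCompactSupport ξ → tsupport ξ ⊆ Ω →
      ∀ᵐ t, ∫ x, V x t * deriv ξ x = - ∫ x, W x t * ξ x) :
    ∃ c : ℝ → ℝ, Measurable c ∧
      ∀ᵐ p : ℝ × ℝ, p.1 ∈ Ω → V p.1 p.2 = c p.2 + ∫ y in (0:ℝ)..p.1, W y p.2 := by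
  have hWs : Measurable (Function.uncurry fun t y => W y t) := hW.comp measurable_swap
  have hVs : Measurable (Function.uncurry fun t y => V y t) := hV.comp measurable_swap
  let D : ℝ → ℝ → ℝ := fun x t => V x t - ∫ y in (0:ℝ)..x, W y t
  have hDm : Measurable (Function.uncurry D) :=
    hV.sub (measurable_intervalIntegral_param (α := ℝ × ℝ) (f := fun p y => W y p.2)
      (hW.comp (measurable_snd.prodMk (measurable_snd.comp measurable_fst)))
      measurable_const measurable_fst)
  have hDb : ∀ x t, |D x t| ≤ K + M * |x| := fun x t => by
    have := abs_intervalIntegral_le (fun y => hM y t) 0 x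
    rw [sub_zero] at this
    exact (abs_sub _ _).trans (add_le_add (hK x t) this)
  obtain ⟨x0, hx0⟩ := hne
  obtain ⟨r, hr, hrΩ⟩ := Metric.isOpen_iff.1 hΩ x0 hx0
  have hJ : Ioo (x0 - r) (x0 + r) ⊆ Ω := by rwa [← Real.ball_eq_Ioo]
  let α := x0 - r / 2
  let β := x0 + r / 2
  have hαβ : α < β := by simp only [α, β]; linarith
  have hJ' : uIoc α β ⊆ Ω := by
    rw [uIoc_of_le hαβ.le]
    refine Subset.trans (fun x hx => ?_) hJ
    simp only [mem_Ioc, mem_Ioo, α, β] at hx ⊢; constructor <;> linarith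
  let c : ℝ → ℝ := fun t => (β - α)⁻¹ * ∫ x in α..β, D x t
  have hcm : Measurable c := Measurable.const_mul
    (measurable_intervalIntegral_param (f := fun t x => D x t) (hDm.comp measurable_swap)
      measurable_const measurable_const) _
  have hbox : ∀ x ∈ uIcc α β, |x| ≤ |α| + |β| := by
    intro x hx
    rw [uIcc_of_le hαβ.le] at hx
    rcases abs_cases x with h1 | h1 <;> rcases abs_cases α with h2 | h2 <;>
      rcases abs_cases β with h3 | h3 <;> linarith [hx.1, hx.2]
  have hM0 : 0 ≤ M := (abs_nonneg _).trans (hM 0 0)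
  have hDb' : ∀ x ∈ uIcc α β, ∀ t, |D x t| ≤ K + M * (|α| + |β|) := fun x hx t =>
    (hDb x t).trans (by have := hbox x hx; gcongr)
  have hDint : ∀ x a b, IntervalIntegrable (D x) volume a b := fun x a b =>
    intervalIntegrable_of_bdd (hDm.of_uncurry_left) (hDb x) a b
  have hcb : ∀ t, |c t| ≤ (β - α)⁻¹ * ((K + M * (|α| + |β|)) * |β - α|) := by
    intro t
    simp only [c]
    rw [abs_mul, abs_of_nonneg (inv_nonneg.2 (sub_nonneg.2 hαβ.le))]
    refine mul_le_mul_of_nonneg_left ?_ (inv_nonneg.2 (sub_nonneg.2 hαβ.le))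
    exact intervalIntegral.norm_integral_le_of_norm_le_const (f := fun x => D x t)
      (fun x hx => hDb' x (uIoc_subset_uIcc hx) t)
  have hcint : ∀ a b, IntervalIntegrable c volume a b := fun a b =>
    intervalIntegrable_of_bdd hcm hcb a b
  have main : ∀ a : ℝ, ∀ᵐ x, x ∈ Ω → ∫ t in (0:ℝ)..a, D x t = ∫ t in (0:ℝ)..a, c t := by
    intro a
    have hVa : Measurable fun x => ∫ t in (0:ℝ)..a, V x t :=
      measurable_intervalIntegral_param hV measurable_const measurable_const
    have hWa : Measurable fun x => ∫ t in (0:ℝ)..a, W x t :=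
      measurable_intervalIntegral_param hW measurable_const measurable_const
    obtain ⟨ca, hca⟩ := weak_deriv_ae_eq_prim hΩ hoc
      (V := fun x => ∫ t in (0:ℝ)..a, V x t) (W := fun x => ∫ t in (0:ℝ)..a, W x t)
      (locallyIntegrable_of_bdd hVa fun x => abs_intervalIntegral_le (hK x) 0 a)
      hWa (fun x => abs_intervalIntegral_le (hM x) 0 a) (by
        intro ξ h1 h2 h3
        have hd : Continuous (deriv ξ) := h1.continuous_deriv (by simp)
        rw [← intervalIntegral_integral_swap_weight hV hK
            (hd.integrable_of_hasCompactSupport h2.deriv),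
          ← intervalIntegral_integral_swap_weight hW hM
            (h1.continuous.integrable_of_hasCompactSupport h2),
          ← intervalIntegral.integral_neg]
        apply intervalIntegral.integral_congr_ae
        filter_upwards [h ξ h1 h2 h3] with t ht _ using ht)
    have hDa : ∀ᵐ x, x ∈ Ω → ∫ t in (0:ℝ)..a, D x t = ca := by
      filter_upwards [hca] with x hx hxΩ
      have e : ∫ t in (0:ℝ)..a, D x t = (∫ t in (0:ℝ)..a, V x t)
          - ∫ t in (0:ℝ)..a, ∫ y in (0:ℝ)..x, W y t :=
        intervalIntegral.integral_sub (intervalIntegrable_of_bdd hV.of_uncurry_left (hK x) _ _)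
          (intervalIntegrable_of_bdd
            (measurable_intervalIntegral_param hWs measurable_const measurable_const)
            (fun t => abs_intervalIntegral_le (fun y => hM y t) 0 x) _ _)
      rw [e, intervalIntegral_swap (f := fun t y => W y t) hWs (M := M) (fun t _ y _ => hM y t),
        hx hxΩ]
      ring
    have hcc : ∫ t in (0:ℝ)..a, c t = ca := by
      simp only [c]
      rw [intervalIntegral.integral_const_mul,
        intervalIntegral_swap (f := fun t x => D x t) (hDm.comp measurable_swap)
          (M := K + M * (|α| + |β|)) (fun t _ x hx => hDb' x hx t)]
      have : ∫ x in α..β, ∫ t in (0:ℝ)..a, D x t = ∫ x in α..β, ca := by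
        apply intervalIntegral.integral_congr_ae
        filter_upwards [hDa] with x hx hxJ using hx (hJ' hxJ)
      rw [this]
      simp only [intervalIntegral.integral_const, smul_eq_mul]
      field_simp [(sub_pos.2 hαβ).ne']
    filter_upwards [hDa] with x hx hxΩ
    rw [hx hxΩ, hcc]
  refine ⟨c, hcm, ?_⟩
  have hae : ∀ᵐ x, ∀ᵐ t, x ∈ Ω → D x t = c t := by
    have : ∀ᵐ x, ∀ a : ℚ, x ∈ Ω → ∫ t in (0:ℝ)..a, D x t = ∫ t in (0:ℝ)..a, c t :=
      ae_all_iff.2 fun a => main a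
    filter_upwards [this] with x hx
    by_cases hxΩ : x ∈ Ω
    swap
    · exact Eventually.of_forall fun t h' => absurd h' hxΩ
    have hm : Measurable fun t => D x t - c t := hDm.of_uncurry_left.sub hcm
    have hb : ∀ t, |D x t - c t| ≤ _ := fun t =>
      (abs_sub _ _).trans (add_le_add (hDb x t) (hcb t))
    have hz : (fun a : ℝ => ∫ t in (0:ℝ)..a, (D x t - c t)) = fun _ => 0 := by
      refine (lipschitzWith_prim hm hb 0).continuous.ext_on (Rat.denseRange_cast (𝕜 := ℝ))
        continuous_const ?_
      rintro _ ⟨q, rfl⟩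
      simp only
      rw [intervalIntegral.integral_sub (hDint x _ _) (hcint _ _), hx q hxΩ, sub_self]
    filter_upwards [ae_hasDerivAt_prim hm hb 0] with t ht _
    rw [hz] at ht
    have := ht.unique (hasDerivAt_const t (0:ℝ))
    linarith
  have hmeas : MeasurableSet {p : ℝ × ℝ | p.1 ∈ Ω → D p.1 p.2 = c p.2} := by
    have : {p : ℝ × ℝ | p.1 ∈ Ω → D p.1 p.2 = c p.2}
        = {p : ℝ × ℝ | p.1 ∈ Ω}ᶜ ∪ {p : ℝ × ℝ | D p.1 p.2 = c p.2} := by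
      ext p; simp [imp_iff_not_or]
    rw [this]
    exact (measurable_fst hΩ.measurableSet).compl.union
      (measurableSet_eq_fun hDm (hcm.comp measurable_snd))
  have := (Measure.ae_prod_mem_iff_ae_ae_mem hmeas).2 hae
  filter_upwards [this] with p hp hpΩ
  have := hp hpΩ
  simp only [D] at this
  linarith

lemma ae_ae_swap {P : ℝ × ℝ → Prop} (h : ∀ᵐ p : ℝ × ℝ, P p) : ∀ᵐ t : ℝ, ∀ᵐ x : ℝ, P (x, t) := by
  have h1 : ∀ᵐ p : ℝ × ℝ, P p.swap := by
    have := (Measure.measurePreserving_swap (μ := (volume : Measure ℝ))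
      (ν := (volume : Measure ℝ))).quasiMeasurePreserving.ae h
    exact this
  exact Measure.ae_ae_of_ae_prod h1

lemma abs_integral_mul_le {f ρ : ℝ → ℝ} {M : ℝ} (hM : ∀ x, |f x| ≤ M) (hρ : Integrable ρ) :
    |∫ x, f x * ρ x| ≤ M * ∫ x, |ρ x| := by
  rw [← integral_const_mul]
  refine norm_integral_le_of_norm_le (f := fun x => f x * ρ x) (hρ.abs.const_mul M) ?_
  refine Eventually.of_forall fun x => ?_
  rw [Real.norm_eq_abs, abs_mul]
  exact mul_le_mul_of_nonneg_right (hM x) (abs_nonneg _)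

lemma ae_sub_right {P : ℝ → Prop} (h : ∀ᵐ t, P t) (a : ℝ) : ∀ᵐ t, P (t - a) :=
  (measurePreserving_sub_right volume a).quasiMeasurePreserving.ae h

/-- For a bounded field with `∂ₜ U + ∂ₓ F = 0`, the time integral of the flux over `[t - h, t]`
is an indefinite integral in `x` of the increment of `U`. -/
lemma flux_increment {U F : ℝ → ℝ → ℝ} (hU : Measurable (Function.uncurry U))
    (hF : Measurable (Function.uncurry F)) {K M : ℝ} (hK : ∀ x t, |U x t| ≤ K)
    (hM : ∀ x t, |F x t| ≤ M)
    (hweak : ∀ ξ η : ℝ → ℝ, ContDiff ℝ (⊤ : ℕ∞) ξ → HasCompactSupport ξ →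
      ContDiff ℝ (⊤ : ℕ∞) η → HasCompactSupport η →
      (∫ t, (∫ x, U x t * ξ x) * deriv η t) + ∫ t, (∫ x, F x t * deriv ξ x) * η t = 0)
    (h : ℝ) :
    ∃ c : ℝ → ℝ, Measurable c ∧ ∀ᵐ p : ℝ × ℝ,
      ∫ s in (p.2 - h)..p.2, F p.1 s
        = c p.2 - ∫ y in (0:ℝ)..p.1, (U y p.2 - U y (p.2 - h)) := by
  have hFh : Measurable (Function.uncurry fun x t => ∫ s in (t - h)..t, F x s) :=
    measurable_intervalIntegral_param (α := ℝ × ℝ) (f := fun p s => F p.1 s)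
      (hF.comp ((measurable_fst.comp measurable_fst).prodMk measurable_snd))
      (measurable_snd.sub_const h) measurable_snd
  have hUh : Measurable (Function.uncurry fun x t => U x (t - h)) :=
    hU.comp (measurable_fst.prodMk (measurable_snd.sub_const h))
  obtain ⟨c, hc, hce⟩ := weak_xderiv_ae_eq_prim isOpen_univ ordConnected_univ univ_nonempty
    (V := fun x t => ∫ s in (t - h)..t, F x s) (W := fun x t => -(U x t - U x (t - h)))
    hFh (hU.sub hUh).neg (K := M * |h|) (M := K + K)
    (fun x t => by simpa using abs_intervalIntegral_le (hM x) (t - h) t)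
    (fun x t => by rw [abs_neg]; exact (abs_sub _ _).trans (add_le_add (hK _ _) (hK _ _))) (by
      intro ξ h1 h2 _
      have hd : Continuous (deriv ξ) := h1.continuous_deriv (by simp)
      have i1 := h1.continuous.integrable_of_hasCompactSupport h2 (μ := volume)
      have i2 := hd.integrable_of_hasCompactSupport h2.deriv (μ := volume)
      have hmm : Measurable fun t => ∫ x, U x t * ξ x :=
        measurable_integral_param (f := fun t x => U x t * ξ x)
          ((hU.comp measurable_swap).mul (h1.continuous.measurable.comp measurable_snd))
      have hnm : Measurable fun t => ∫ x, F x t * deriv ξ x :=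
        measurable_integral_param (f := fun t x => F x t * deriv ξ x)
          ((hF.comp measurable_swap).mul (hd.measurable.comp measurable_snd))
      have hmb := fun t => abs_integral_mul_le (fun x => hK x t) i1
      have hnb := fun t => abs_integral_mul_le (fun x => hM x t) i2
      obtain ⟨d, hd⟩ := weak_deriv_ae_eq_prim isOpen_univ ordConnected_univ
        (locallyIntegrable_of_bdd hmm hmb) hnm hnb (fun η e1 e2 _ => by
          have := hweak ξ η h1 h2 e1 e2; linarith)
      filter_upwards [hd, ae_sub_right hd h] with t ht ht'
      have e1 := ht trivial
      have e2 := ht' trivial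
      have hi := fun a b => intervalIntegrable_of_bdd hnm hnb a b
      rw [← intervalIntegral_integral_swap_weight hF hM i2]
      have e3 : ∫ s in (t - h)..t, ∫ x, F x s * deriv ξ x
          = (∫ x, U x t * ξ x) - ∫ x, U x (t - h) * ξ x := by
        rw [e1, e2, ← intervalIntegral.integral_interval_sub_left (hi 0 t) (hi 0 (t - h))]; ring
      rw [e3, ← integral_sub, ← integral_neg]
      · congr 1; ext x; ring
      · exact i1.bdd_mul (c := K) (hU.of_uncurry_right).aestronglyMeasurable
          (Eventually.of_forall fun x => hK x t)
      · exact i1.bdd_mul (c := K) (hU.of_uncurry_right).aestronglyMeasurable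
          (Eventually.of_forall fun x => hK x (t - h)))
  refine ⟨c, hc, ?_⟩
  filter_upwards [hce] with p hp
  rw [hp trivial, intervalIntegral.integral_neg]; ring

/-- `F` is absolutely continuous on `[a, b]` and has derivative `f` almost everywhere. -/
structure ACDeriv (F f : ℝ → ℝ) (a b : ℝ) : Prop where
  ac : AbsolutelyContinuousOnInterval F a b
  deriv : ∀ᵐ x, HasDerivAt F (f x) x

namespace ACDeriv

variable {F f G g : ℝ → ℝ} {a b : ℝ}

lemma of_lipschitzWith {K : NNReal} (hF : LipschitzWith K F) (h : ∀ᵐ x, HasDerivAt F (f x) x) :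
    ACDeriv F f a b := ⟨(hF.lipschitzOnWith (s := uIcc a b)).absolutelyContinuousOnInterval, h⟩

lemma prim (hf : Measurable f) {M : ℝ} (hM : ∀ x, |f x| ≤ M) (c : ℝ) :
    ACDeriv (fun x => c + ∫ y in (0:ℝ)..x, f y) f a b :=
  of_lipschitzWith ((LipschitzWith.const c).add (lipschitzWith_prim hf hM 0))
    ((ae_hasDerivAt_prim hf hM 0).mono fun _ hx => hx.const_add c)

lemma sub (hF : ACDeriv F f a b) (hG : ACDeriv G g a b) :
    ACDeriv (fun x => F x - G x) (fun x => f x - g x) a b :=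
  ⟨hF.ac.sub hG.ac, by filter_upwards [hF.deriv, hG.deriv] with x h1 h2 using h1.sub h2⟩

lemma mul (hF : ACDeriv F f a b) (hG : ACDeriv G g a b) :
    ACDeriv (fun x => F x * G x) (fun x => f x * G x + F x * g x) a b :=
  ⟨hF.ac.mul hG.ac, by filter_upwards [hF.deriv, hG.deriv] with x h1 h2 using h1.mul h2⟩

lemma integral_eq_sub (hF : ACDeriv F f a b) : ∫ x in a..b, f x = F b - F a := by
  rw [← hF.ac.integral_deriv_eq_sub]
  apply intervalIntegral.integral_congr_ae
  filter_upwards [hF.deriv] with x hx _ using hx.deriv.symm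

end ACDeriv

lemma convex_ineq {Φ : ℝ → ℝ} (hm : Monotone Φ) (a b : ℝ) :
    ∫ s in b..a, Φ s ≤ (a - b) * Φ a := by
  rcases le_total b a with h | h
  · have := intervalIntegral.integral_mono_on (μ := volume) h hm.intervalIntegrable
      (intervalIntegrable_const (c := Φ a)) (fun x hx => hm hx.2)
    simpa using this
  · have := intervalIntegral.integral_mono_on (μ := volume) h
      (intervalIntegrable_const (c := Φ a)) hm.intervalIntegrable (fun x hx => hm hx.1)
    rw [intervalIntegral.integral_symm]
    simp at this
    linarith

/-- Backward Steklov averages in the second variable converge almost everywhere. -/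
lemma steklov_tendsto {F : ℝ → ℝ → ℝ} (hF : Measurable (Function.uncurry F)) {N : ℝ}
    (hN : ∀ x t, |F x t| ≤ N) :
    ∀ᵐ t : ℝ, ∀ᵐ x : ℝ, Tendsto (fun m : ℕ => ((m:ℝ) + 1) * ∫ s in (t - 1 / ((m:ℝ) + 1))..t, F x s)
      atTop (nhds (F x t)) := by
  apply ae_ae_swap (P := fun p : ℝ × ℝ => Tendsto (fun m : ℕ => ((m:ℝ) + 1) *
    ∫ s in (p.2 - 1 / ((m:ℝ) + 1))..p.2, F p.1 s) atTop (nhds (F p.1 p.2)))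
  have hms : MeasurableSet {p : ℝ × ℝ | Tendsto (fun m : ℕ => ((m:ℝ) + 1) *
      ∫ s in (p.2 - 1 / ((m:ℝ) + 1))..p.2, F p.1 s) atTop (nhds (F p.1 p.2))} := by
    refine measurableSet_tendsto_fun (fun m => ?_) hF
    exact (measurable_intervalIntegral_param (α := ℝ × ℝ) (f := fun p s => F p.1 s)
      (hF.comp ((measurable_fst.comp measurable_fst).prodMk measurable_snd))
      (measurable_snd.sub_const _) measurable_snd).const_mul _
  refine (Measure.ae_prod_mem_iff_ae_ae_mem (μ := volume) (ν := volume) hms).2 ?_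
  refine Eventually.of_forall fun x => ?_
  filter_upwards [ae_hasDerivAt_prim (hF.of_uncurry_left (x := x)) (hN x) 0] with t ht
  have h1 : Tendsto (fun m : ℕ => t - 1 / ((m:ℝ) + 1)) atTop (nhdsWithin t {t}ᶜ) := by
    refine tendsto_nhdsWithin_iff.2 ⟨?_, ?_⟩
    · simpa using (tendsto_const_nhds (x := t)).sub tendsto_one_div_add_atTop_nhds_zero_nat
    · refine Eventually.of_forall fun m => ?_
      have : 0 < 1 / ((m:ℝ) + 1) := by positivity
      simp only [mem_compl_iff, mem_singleton_iff]; linarith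
  have h2 := ht.tendsto_slope.comp h1
  refine h2.congr fun m => ?_
  have hi := fun a b => intervalIntegrable_of_bdd (hF.of_uncurry_left (x := x)) (hN x) a b
  rw [Function.comp, slope_def_field, intervalIntegral.integral_interval_sub_left (hi _ _) (hi _ _),
    intervalIntegral.integral_symm]
  have : ((m:ℝ) + 1) ≠ 0 := by positivity
  field_simp
  ring_nf

/-- The relative energy `∫_κ^s (Φ r - Φ κ) dr`. -/
def relEnergy (Φ : ℝ → ℝ) (κ s : ℝ) : ℝ := ∫ r in κ..s, (Φ r - Φ κ)

section relEnergy

variable {Φ : ℝ → ℝ}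

lemma relEnergy_eq (hΦ : Continuous Φ) (κ s : ℝ) :
    relEnergy Φ κ s = (∫ r in (0:ℝ)..s, Φ r) - (∫ r in (0:ℝ)..κ, Φ r) - (s - κ) * Φ κ := by
  have hi := fun a b => hΦ.intervalIntegrable (μ := volume) a b
  rw [relEnergy, intervalIntegral.integral_sub (hi _ _) intervalIntegrable_const,
    intervalIntegral.integral_interval_sub_left (hi _ _) (hi _ _)]
  simp

lemma continuous_relEnergy (hΦ : Continuous Φ) :
    Continuous (fun z : ℝ × ℝ => relEnergy Φ z.1 z.2) := by
  simp_rw [relEnergy_eq hΦ]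
  have h := intervalIntegral.continuous_primitive (μ := volume)
    (fun a b => hΦ.intervalIntegrable a b) 0
  fun_prop

lemma relEnergy_le (hm : Monotone Φ) (κ s : ℝ) : relEnergy Φ κ s ≤ (s - κ) * (Φ s - Φ κ) :=
  convex_ineq (Φ := fun r => Φ r - Φ κ) (fun _ _ h => sub_le_sub_right (hm h) _) s κ

lemma relEnergy_sub_le (hm : Monotone Φ) (hΦ : Continuous Φ) (κ a b : ℝ) :
    relEnergy Φ κ a - relEnergy Φ κ b ≤ (a - b) * (Φ a - Φ κ) := by
  have hc : Continuous fun r => Φ r - Φ κ := by fun_prop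
  rw [relEnergy, relEnergy, intervalIntegral.integral_interval_sub_left
    (hc.intervalIntegrable _ _) (hc.intervalIntegrable _ _)]
  exact convex_ineq (Φ := fun r => Φ r - Φ κ) (fun _ _ h => sub_le_sub_right (hm h) _) a b

lemma relEnergy_nonneg (hm : Monotone Φ) (hΦ : Continuous Φ) (κ s : ℝ) :
    0 ≤ relEnergy Φ κ s := by
  have := relEnergy_sub_le hm hΦ κ κ s
  simp [relEnergy] at this ⊢
  linarith

lemma relEnergy_le_abs (hm : Monotone Φ) (h0 : Φ 0 = 0) {κ s : ℝ} (hκ : κ ∈ Icc (0:ℝ) 1)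
    (hs : s ∈ Icc (0:ℝ) 1) : relEnergy Φ κ s ≤ Φ 1 * |s - κ| := by
  refine (relEnergy_le hm κ s).trans ?_
  have h1 := hm hs.1; have h2 := hm hs.2; have h3 := hm hκ.1; have h4 := hm hκ.2
  have h5 : |Φ s - Φ κ| ≤ Φ 1 := abs_sub_le_iff.2 ⟨by linarith, by linarith⟩
  calc _ ≤ |(s - κ) * (Φ s - Φ κ)| := le_abs_self _
    _ = |s - κ| * |Φ s - Φ κ| := abs_mul _ _
    _ ≤ |s - κ| * Φ 1 := by gcongr
    _ = _ := mul_comm _ _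

end relEnergy

/-- Nonlinearities on a half-line: `Φ` is the capillary pressure, `fh` the convective flux as a
function of the pressure. -/
structure HalfData (Φ fh : ℝ → ℝ) (B : ℝ) : Prop where
  mono : Monotone Φ
  cont : Continuous Φ
  zero : Φ 0 = 0
  cont_fh : Continuous fh
  bdd_fh : ∀ s, |fh s| ≤ B
  fh_zero : 0 ≤ fh 0

/-- A bounded flux solution restricted to the half-line `x < 0`: `W` is the pressure gradient,
`p` the trace of the pressure at `0` and `F` the flux. -/
structure HalfSol (ε : ℝ) (Φ fh u0 : ℝ → ℝ) (U W F : ℝ → ℝ → ℝ) (p : ℝ → ℝ) (M N : ℝ) :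
    Prop where
  mU : Measurable (Function.uncurry U)
  mW : Measurable (Function.uncurry W)
  mF : Measurable (Function.uncurry F)
  mp : Measurable p
  U_mem : ∀ x t, U x t ∈ Icc (0:ℝ) 1
  U_init : ∀ x t, t ≤ 0 → U x t = u0 x
  bW : ∀ x t, |W x t| ≤ M
  bF : ∀ x t, |F x t| ≤ N
  F_init : ∀ x t, t ≤ 0 → F x t = 0
  p_mem : ∀ t, p t ∈ Icc 0 (Φ 1)
  pressure : ∀ᵐ t : ℝ, ∀ᵐ x : ℝ, x < 0 → 0 < t → Φ (U x t) = p t + ∫ y in (0:ℝ)..x, W y t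
  flux : ∀ᵐ t : ℝ, ∀ᵐ x : ℝ, x < 0 → 0 < t →
    F x t = fh (p t + ∫ y in (0:ℝ)..x, W y t) - ε * W x t
  balance : ∀ h : ℝ, ∃ c : ℝ → ℝ, ∀ᵐ t : ℝ, ∀ᵐ x : ℝ, ∫ s in (t - h)..t, F x s
    = c t - ∫ y in (0:ℝ)..x, (U y t - U y (t - h))

/-- A reference state `κ` on the half-line, vanishing near the interface. -/
structure RefState (Φ u0 κ dk : ℝ → ℝ) (D : ℝ) : Prop where
  meas : Measurable κ
  mem : ∀ x, κ x ∈ Icc (0:ℝ) 1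
  deriv : ∀ a b, ACDeriv (fun x => Φ (κ x)) dk a b
  meas_dk : Measurable dk
  bdd_dk : ∀ x, |dk x| ≤ D
  int_dk : Integrable dk
  near : ∀ x, -1 ≤ x → κ x = 0
  int_sub : IntegrableOn (fun x => u0 x - κ x) (Iio 0)

/-- Lipschitz cut-off functions on `[a, 0]`. -/
structure Cutoff (ω dω : ℝ → ℝ) (a D : ℝ) : Prop where
  neg : a ≤ 0
  deriv : ACDeriv ω dω a 0
  meas : Measurable ω
  meas_d : Measurable dω
  mem : ∀ x, ω x ∈ Icc (0:ℝ) 1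
  bdd_d : ∀ x, |dω x| ≤ D
  left : ω a = 0
  right : ω 0 = 0

section energy

variable {ε : ℝ} {Φ fh u0 : ℝ → ℝ} {U W F : ℝ → ℝ → ℝ} {p : ℝ → ℝ} {M N B : ℝ}
  {κ dk : ℝ → ℝ} {D : ℝ} {ω dω : ℝ → ℝ} {a Dω : ℝ}

lemma energy_increment (hd : HalfData Φ fh B) (hs : HalfSol ε Φ fh u0 U W F p M N)
    (hr : RefState Φ u0 κ dk D) (hω : Cutoff ω dω a Dω) (h : ℝ) :
    ∀ᵐ t : ℝ, 0 < t →
      (∫ x in a..0, ω x * relEnergy Φ (κ x) (U x t))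
        - (∫ x in a..0, ω x * relEnergy Φ (κ x) (U x (t - h)))
      ≤ ∫ x in a..0, (∫ s in (t - h)..t, F x s) *
        (dω x * ((p t + ∫ y in (0:ℝ)..x, W y t) - Φ (κ x)) + ω x * (W x t - dk x)) := by
  obtain ⟨c, hc⟩ := hs.balance h
  filter_upwards [hc, hs.pressure] with t h1 h2 ht
  have mUt : ∀ t, Measurable fun x => U x t := fun t => hs.mU.of_uncurry_right
  have bΔ : ∀ x, |U x t - U x (t - h)| ≤ 1 := fun x => abs_sub_le_iff.2
    ⟨by linarith [(hs.U_mem x t).2, (hs.U_mem x (t - h)).1],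
      by linarith [(hs.U_mem x t).1, (hs.U_mem x (t - h)).2]⟩
  have mE : ∀ t, Measurable fun x => ω x * relEnergy Φ (κ x) (U x t) := fun t =>
    hω.meas.mul ((continuous_relEnergy hd.cont).measurable.comp (hr.meas.prodMk (mUt t)))
  have bE : ∀ t x, |ω x * relEnergy Φ (κ x) (U x t)| ≤ 1 * (Φ 1 * 1) := by
    intro t x
    rw [abs_mul, abs_of_nonneg (hω.mem x).1, abs_of_nonneg (relEnergy_nonneg hd.mono hd.cont _ _)]
    have hΦ1 : 0 ≤ Φ 1 := hd.zero ▸ hd.mono zero_le_one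
    refine mul_le_mul (hω.mem x).2 ((relEnergy_le_abs hd.mono hd.zero (hr.mem x)
      (hs.U_mem x t)).trans (mul_le_mul_of_nonneg_left ?_ hΦ1))
      (relEnergy_nonneg hd.mono hd.cont _ _) zero_le_one
    exact abs_sub_le_iff.2 ⟨by linarith [(hs.U_mem x t).2, (hr.mem x).1],
      by linarith [(hs.U_mem x t).1, (hr.mem x).2]⟩
  have hG := hω.deriv.mul ((ACDeriv.prim (a := a) (b := 0) (hs.mW.of_uncurry_right (y := t))
    (fun x => hs.bW x t) (p t)).sub (hr.deriv a 0))
  have hP := (ACDeriv.prim (a := a) (b := 0) (f := fun x => -(U x t - U x (t - h)))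
    ((mUt t).sub (mUt (t - h))).neg (fun x => by rw [abs_neg]; exact bΔ x) (c t))
  have hibp := (hP.mul hG).integral_eq_sub
  rw [hω.left, hω.right] at hibp
  simp only [zero_mul, mul_zero, sub_zero] at hibp
  set G := fun x => ω x * ((p t + ∫ y in (0:ℝ)..x, W y t) - Φ (κ x)) with hGdef
  have hVcont : Continuous fun x => p t + ∫ y in (0:ℝ)..x, W y t :=
    continuous_const.add
      (lipschitzWith_prim (hs.mW.of_uncurry_right (y := t)) (fun x => hs.bW x t) 0).continuous
  have i1 : IntervalIntegrable (fun x => (U x t - U x (t - h)) * G x) volume a 0 :=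
    (intervalIntegrable_of_bdd ((mUt t).sub (mUt (t - h))) bΔ a 0).mul_continuousOn
      hG.ac.continuousOn
  have mD : Measurable fun x => dω x * ((p t + ∫ y in (0:ℝ)..x, W y t) - Φ (κ x))
      + ω x * (W x t - dk x) :=
    (hω.meas_d.mul (hVcont.measurable.sub (hd.cont.measurable.comp hr.meas))).add
      (hω.meas.mul ((hs.mW.of_uncurry_right (y := t)).sub hr.meas_dk))
  have iD : IntervalIntegrable (fun x => dω x * ((p t + ∫ y in (0:ℝ)..x, W y t) - Φ (κ x))
      + ω x * (W x t - dk x)) volume a 0 := by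
    have hVk := (ACDeriv.prim (a := a) (b := 0) (hs.mW.of_uncurry_right (y := t))
      (fun x => hs.bW x t) (p t)).sub (hr.deriv a 0)
    refine IntervalIntegrable.add ?_ ?_
    · exact (intervalIntegrable_of_bdd hω.meas_d hω.bdd_d a 0).mul_continuousOn hVk.ac.continuousOn
    · exact ((intervalIntegrable_of_bdd (hs.mW.of_uncurry_right (y := t))
        (fun x => hs.bW x t) a 0).sub
        (intervalIntegrable_of_bdd hr.meas_dk hr.bdd_dk a 0)).continuousOn_mul
          hω.deriv.ac.continuousOn
  have i2 := iD.continuousOn_mul hP.ac.continuousOn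
  have e1 : ∫ x in a..0, (∫ s in (t - h)..t, F x s) *
        (dω x * ((p t + ∫ y in (0:ℝ)..x, W y t) - Φ (κ x)) + ω x * (W x t - dk x))
      = ∫ x in a..0, (U x t - U x (t - h)) * G x := by
    have i1' : IntervalIntegrable (fun x => -(U x t - U x (t - h)) * G x) volume a 0 :=
      i1.neg.congr (fun x _ => (neg_mul _ _).symm)
    rw [intervalIntegral.integral_add i1' i2] at hibp
    have e2 : ∫ x in a..0, (∫ s in (t - h)..t, F x s) *
        (dω x * ((p t + ∫ y in (0:ℝ)..x, W y t) - Φ (κ x)) + ω x * (W x t - dk x))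
        = ∫ x in a..0, (c t + ∫ y in (0:ℝ)..x, -(U y t - U y (t - h))) *
        (dω x * ((p t + ∫ y in (0:ℝ)..x, W y t) - Φ (κ x)) + ω x * (W x t - dk x)) := by
      apply intervalIntegral.integral_congr_ae
      filter_upwards [h1] with x hx _
      rw [hx, intervalIntegral.integral_neg, sub_eq_add_neg]
    rw [e2]
    have e3 : ∫ x in a..0, -(U x t - U x (t - h)) * G x
        = - ∫ x in a..0, (U x t - U x (t - h)) * G x := by
      rw [← intervalIntegral.integral_neg]; congr 1; ext x; ring
    rw [e3] at hibp
    linarith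
  rw [e1, ← intervalIntegral.integral_sub (intervalIntegrable_of_bdd (mE t) (bE t) a 0)
    (intervalIntegrable_of_bdd (mE (t - h)) (bE (t - h)) a 0)]
  refine intervalIntegral.integral_mono_ae_restrict hω.neg
    ((intervalIntegrable_of_bdd (mE t) (bE t) a 0).sub
    (intervalIntegrable_of_bdd (mE (t - h)) (bE (t - h)) a 0)) i1 ?_
  have hne : ∀ᵐ x : ℝ, x ≠ 0 := by simp [ae_iff]
  rw [EventuallyLE, ae_restrict_iff' measurableSet_Icc]
  filter_upwards [h2, hne] with x hx hx0 hxm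
  have := hx (lt_of_le_of_ne hxm.2 hx0) ht
  simp only [hGdef, ← this]
  have h3 := mul_le_mul_of_nonneg_left (relEnergy_sub_le hd.mono hd.cont (κ x) (U x t)
    (U x (t - h))) (hω.mem x).1
  linarith

lemma abs_energy_density_le (hd : HalfData Φ fh B) (hs : HalfSol ε Φ fh u0 U W F p M N)
    (hr : RefState Φ u0 κ dk D) (hω : Cutoff ω dω a Dω) {x : ℝ} (t : ℝ) (hx : x ∈ Icc a 0) :
    |dω x * ((p t + ∫ y in (0:ℝ)..x, W y t) - Φ (κ x)) + ω x * (W x t - dk x)|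
      ≤ Dω * (Φ 1 + M * |a| + Φ 1) + 1 * (M + D) := by
  have hM0 : 0 ≤ M := (abs_nonneg _).trans (hs.bW 0 0)
  have hD0 : 0 ≤ Dω := (abs_nonneg _).trans (hω.bdd_d 0)
  have h1 : |∫ y in (0:ℝ)..x, W y t| ≤ M * |a| := by
    refine (abs_intervalIntegral_le (fun y => hs.bW y t) 0 x).trans ?_
    rw [sub_zero, abs_of_nonpos hx.2, abs_of_nonpos hω.neg]
    exact mul_le_mul_of_nonneg_left (neg_le_neg hx.1) hM0
  have h2 : |p t| ≤ Φ 1 := by rw [abs_of_nonneg (hs.p_mem t).1]; exact (hs.p_mem t).2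
  have h3 : |Φ (κ x)| ≤ Φ 1 := by
    rw [abs_of_nonneg (hd.zero ▸ hd.mono (hr.mem x).1)]; exact hd.mono (hr.mem x).2
  have h4 : |ω x| ≤ 1 := by rw [abs_of_nonneg (hω.mem x).1]; exact (hω.mem x).2
  refine (abs_add_le _ _).trans (add_le_add ?_ ?_)
  · rw [abs_mul]
    refine mul_le_mul (hω.bdd_d x) ?_ (abs_nonneg _) hD0
    exact (abs_sub _ _).trans (add_le_add ((abs_add_le _ _).trans (add_le_add h2 h1)) h3)
  · rw [abs_mul]
    refine mul_le_mul h4 ?_ (abs_nonneg _) zero_le_one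
    exact (abs_sub _ _).trans (add_le_add (hs.bW x t) (hr.bdd_dk x))

lemma measurable_energy_density (hd : HalfData Φ fh B) (hs : HalfSol ε Φ fh u0 U W F p M N)
    (hr : RefState Φ u0 κ dk D) (hω : Cutoff ω dω a Dω) :
    Measurable (Function.uncurry fun t x =>
      dω x * ((p t + ∫ y in (0:ℝ)..x, W y t) - Φ (κ x)) + ω x * (W x t - dk x)) := by
  have h1 : Measurable fun z : ℝ × ℝ => ∫ y in (0:ℝ)..z.2, W y z.1 :=
    measurable_intervalIntegral_param (α := ℝ × ℝ) (f := fun z y => W y z.1)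
      (hs.mW.comp (measurable_snd.prodMk (measurable_fst.comp measurable_fst)))
      measurable_const measurable_snd
  exact ((hω.meas_d.comp measurable_snd).mul (((hs.mp.comp measurable_fst).add h1).sub
    (hd.cont.measurable.comp (hr.meas.comp measurable_snd)))).add
    ((hω.meas.comp measurable_snd).mul ((hs.mW.comp measurable_swap).sub
      (hr.meas_dk.comp measurable_snd)))

lemma energy_flux (hd : HalfData Φ fh B) (hs : HalfSol ε Φ fh u0 U W F p M N)
    (hr : RefState Φ u0 κ dk D) (hω : Cutoff ω dω a Dω) {T : ℝ} (hT : 0 ≤ T) :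
    -(∫ x in a..0, ω x * relEnergy Φ (κ x) (u0 x)) ≤
      ∫ t in (0:ℝ)..T, ∫ x in a..0, F x t *
        (dω x * ((p t + ∫ y in (0:ℝ)..x, W y t) - Φ (κ x)) + ω x * (W x t - dk x)) := by
  have hΦ1 : 0 ≤ Φ 1 := hd.zero ▸ hd.mono zero_le_one
  have mD := measurable_energy_density hd hs hr hω
  have bD := fun x (hx : x ∈ Icc a 0) t => abs_energy_density_le hd hs hr hω t hx
  set G : ℝ → ℝ → ℝ := fun t x =>
    dω x * ((p t + ∫ y in (0:ℝ)..x, W y t) - Φ (κ x)) + ω x * (W x t - dk x) with hG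
  set K := Dω * (Φ 1 + M * |a| + Φ 1) + 1 * (M + D) with hK
  have hK0 : 0 ≤ K := (abs_nonneg _).trans (bD 0 ⟨hω.neg, le_rfl⟩ 0)
  have hN0 : 0 ≤ N := (abs_nonneg _).trans (hs.bF 0 0)
  set E : ℝ → ℝ := fun t => ∫ x in a..0, ω x * relEnergy Φ (κ x) (U x t) with hE
  have mE : Measurable E := by
    refine measurable_intervalIntegral_param (f := fun t x => ω x * relEnergy Φ (κ x) (U x t))
      ?_ measurable_const measurable_const
    exact (hω.meas.comp measurable_snd).mul ((continuous_relEnergy hd.cont).measurable.comp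
      ((hr.meas.comp measurable_snd).prodMk (hs.mU.comp measurable_swap)))
  have bE : ∀ t, |E t| ≤ Φ 1 * 1 * |0 - a| := by
    intro t
    refine abs_intervalIntegral_le (fun x => ?_) a 0
    rw [abs_mul, abs_of_nonneg (hω.mem x).1, abs_of_nonneg (relEnergy_nonneg hd.mono hd.cont _ _),
      ← one_mul (Φ 1 * 1)]
    refine mul_le_mul (hω.mem x).2 ((relEnergy_le_abs hd.mono hd.zero (hr.mem x)
      (hs.U_mem x t)).trans (mul_le_mul_of_nonneg_left ?_ hΦ1))
      (relEnergy_nonneg hd.mono hd.cont _ _) zero_le_one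
    exact abs_sub_le_iff.2 ⟨by linarith [(hs.U_mem x t).2, (hr.mem x).1],
      by linarith [(hs.U_mem x t).1, (hr.mem x).2]⟩
  have E0 : ∀ t, 0 ≤ E t := fun t => intervalIntegral.integral_nonneg hω.neg fun x _ =>
    mul_nonneg (hω.mem x).1 (relEnergy_nonneg hd.mono hd.cont _ _)
  have Einit : ∀ t ≤ 0, E t = ∫ x in a..0, ω x * relEnergy Φ (κ x) (u0 x) := by
    intro t ht
    simp only [hE, hs.U_init _ t ht]
  have hiE := fun b c => intervalIntegrable_of_bdd mE bE b c
  set S : ℕ → ℝ → ℝ → ℝ := fun m x t => ((m:ℝ) + 1) * ∫ s in (t - 1 / ((m:ℝ) + 1))..t, F x s with hS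
  have mS : ∀ m, Measurable (Function.uncurry (S m)) := fun m =>
    (measurable_intervalIntegral_param (α := ℝ × ℝ) (f := fun p s => F p.1 s)
      (hs.mF.comp ((measurable_fst.comp measurable_fst).prodMk measurable_snd))
      (measurable_snd.sub_const _) measurable_snd).const_mul _
  have bS : ∀ m x t, |S m x t| ≤ N := by
    intro m x t
    have hm : (0:ℝ) < (m:ℝ) + 1 := by positivity
    rw [hS, abs_mul, abs_of_pos hm]
    calc _ ≤ ((m:ℝ) + 1) * (N * |t - (t - 1 / ((m:ℝ) + 1))|) :=
          mul_le_mul_of_nonneg_left (abs_intervalIntegral_le (hs.bF x) _ _) hm.le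
      _ = N := by
          rw [sub_sub_cancel, abs_of_pos (by positivity)]; field_simp
  have mI : ∀ f : ℝ → ℝ → ℝ, Measurable (Function.uncurry f) →
      Measurable fun t => ∫ x in a..0, f x t * G t x := fun f hf =>
    measurable_intervalIntegral_param (f := fun t x => f x t * G t x)
      ((hf.comp measurable_swap).mul mD) measurable_const measurable_const
  have bI : ∀ f : ℝ → ℝ → ℝ, (∀ x t, |f x t| ≤ N) → ∀ t,
      |∫ x in a..0, f x t * G t x| ≤ N * K * |0 - a| := by
    intro f hf t
    refine intervalIntegral.norm_integral_le_of_norm_le_const (f := fun x => f x t * G t x)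
      fun x hx => ?_
    rw [uIoc_of_le hω.neg] at hx
    rw [Real.norm_eq_abs, abs_mul]
    exact mul_le_mul (hf x t) (bD x ⟨hx.1.le, hx.2⟩ t) (abs_nonneg _) hN0
  have key : ∀ m : ℕ, -(∫ x in a..0, ω x * relEnergy Φ (κ x) (u0 x)) ≤
      ∫ t in (0:ℝ)..T, ∫ x in a..0, S m x t * G t x := by
    intro m
    have hm : (0:ℝ) < (m:ℝ) + 1 := by positivity
    set h : ℝ := 1 / ((m:ℝ) + 1) with hh
    have hh0 : 0 < h := by positivity
    have hhm : ((m:ℝ) + 1) * h = 1 := by rw [hh]; field_simp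
    have aux : ∀ X Y : ℝ, h * (((m:ℝ) + 1) * X * Y) = X * Y := fun X Y => by
      rw [← mul_assoc, ← mul_assoc, mul_comm h, hhm, one_mul]
    have hiE' : IntervalIntegrable (fun t => E (t - h)) volume 0 T :=
      intervalIntegrable_of_bdd (mE.comp (measurable_id.sub_const h)) (fun t => bE _) 0 T
    have e1 : ∫ t in (0:ℝ)..T, (E t - E (t - h)) ≤
        ∫ t in (0:ℝ)..T, ∫ x in a..0, (∫ s in (t - h)..t, F x s) * G t x := by
      refine intervalIntegral.integral_mono_ae_restrict hT ((hiE 0 T).sub hiE') ?_ ?_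
      · have h1 := mI _ (mS m)
        have h2 := bI _ (bS m)
        refine ((intervalIntegrable_of_bdd h1 h2 0 T).const_mul h).congr fun t _ => ?_
        simp only [hS]
        rw [← intervalIntegral.integral_const_mul]
        congr 1; ext x
        exact aux _ _
      · have hne : ∀ᵐ x : ℝ, x ≠ 0 := by simp [ae_iff]
        rw [EventuallyLE, ae_restrict_iff' measurableSet_Icc]
        filter_upwards [energy_increment hd hs hr hω h, hne] with t ht hne htm
        exact ht (lt_of_le_of_ne htm.1 hne.symm)
    have e2 : ∫ t in (0:ℝ)..T, (E t - E (t - h)) = (∫ t in (T - h)..T, E t)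
        - ∫ t in (-h)..0, E t := by
      rw [intervalIntegral.integral_sub (hiE 0 T) hiE',
        intervalIntegral.integral_comp_sub_right, zero_sub]
      have a1 := intervalIntegral.integral_add_adjacent_intervals (hiE (-h) 0) (hiE 0 T)
      have a2 := intervalIntegral.integral_add_adjacent_intervals (hiE (-h) (T - h)) (hiE (T - h) T)
      linarith
    have e3 : 0 ≤ ∫ t in (T - h)..T, E t :=
      intervalIntegral.integral_nonneg (by linarith) fun t _ => E0 t
    have e4 : ∫ t in (-h)..0, E t = h * ∫ x in a..0, ω x * relEnergy Φ (κ x) (u0 x) := by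
      rw [intervalIntegral.integral_congr (g := fun _ =>
        ∫ x in a..0, ω x * relEnergy Φ (κ x) (u0 x)) (fun t ht => ?_)]
      · rw [intervalIntegral.integral_const]; simp
      · rw [uIcc_of_le (by linarith)] at ht
        exact Einit t ht.2
    have e5 : ∫ t in (0:ℝ)..T, ∫ x in a..0, S m x t * G t x = ((m:ℝ) + 1) *
        ∫ t in (0:ℝ)..T, ∫ x in a..0, (∫ s in (t - h)..t, F x s) * G t x := by
      rw [← intervalIntegral.integral_const_mul]
      congr 1; ext t
      rw [← intervalIntegral.integral_const_mul]
      congr 1; ext x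
      simp only [hS, mul_assoc]
      rfl
    rw [e5]
    have := mul_le_mul_of_nonneg_left e1 hm.le
    rw [e2, e4, mul_sub, ← mul_assoc, hhm, one_mul] at this
    have := mul_nonneg hm.le e3
    linarith
  have lim : Tendsto (fun m : ℕ => ∫ t in (0:ℝ)..T, ∫ x in a..0, S m x t * G t x) atTop
      (nhds (∫ t in (0:ℝ)..T, ∫ x in a..0, F x t * G t x)) := by
    refine intervalIntegral.tendsto_integral_filter_of_dominated_convergence
      (fun _ => N * K * |0 - a|) (Eventually.of_forall fun m => (mI _ (mS m)).aestronglyMeasurable)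
      (Eventually.of_forall fun m => Eventually.of_forall fun t _ => bI _ (bS m) t)
      intervalIntegrable_const ?_
    filter_upwards [steklov_tendsto hs.mF hs.bF] with t ht _
    refine intervalIntegral.tendsto_integral_filter_of_dominated_convergence
      (fun _ => N * K) (Eventually.of_forall fun m =>
        (((mS m).of_uncurry_right).mul mD.of_uncurry_left).aestronglyMeasurable)
      (Eventually.of_forall fun m => Eventually.of_forall fun x hx => ?_)
      intervalIntegrable_const ?_
    · rw [uIoc_of_le hω.neg] at hx
      rw [Real.norm_eq_abs, abs_mul]
      exact mul_le_mul (bS m x t) (bD x ⟨hx.1.le, hx.2⟩ t) (abs_nonneg _) hN0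
    · filter_upwards [ht] with x hx _ using hx.mul_const _
  exact ge_of_tendsto lim (Eventually.of_forall key)

end energy

lemma intervalIntegral_indicator_Ioc {a b c d : ℝ} (hab : a ≤ b) (hbc : b ≤ c) (hcd : c ≤ d)
    (f : ℝ → ℝ) : ∫ x in a..d, (Ioc b c).indicator f x = ∫ x in b..c, f x := by
  rw [intervalIntegral.integral_of_le (hab.trans (hbc.trans hcd)),
    intervalIntegral.integral_of_le hbc, setIntegral_indicator measurableSet_Ioc,
    inter_eq_right.2 (Ioc_subset_Ioc hab hcd)]

/-- Trapezoidal cut-off: `0` at `0` and `-(n+1)`, equal to `1` on `[-n, -1/n]`. -/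
def trap (n x : ℝ) : ℝ := max 0 (min 1 (min (-(n * x)) (n + 1 + x)))

/-- The almost everywhere derivative of `trap n`. -/
def trapDeriv (n x : ℝ) : ℝ :=
  (Ioc (-(n + 1)) (-n)).indicator 1 x - n * (Ioc (-(1 / n)) 0).indicator 1 x

lemma lipschitzWith_trap {n : ℝ} (hn : 1 ≤ n) : ∃ K, LipschitzWith K (trap n) := by
  have h1 : LipschitzWith n.toNNReal fun x : ℝ => -(n * x) :=
    LipschitzWith.of_dist_le_mul fun x y => by
      rw [Real.dist_eq, Real.dist_eq, Real.coe_toNNReal _ (by linarith), ← abs_neg,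
        show -(-(n * x) - -(n * y)) = n * (x - y) by ring, abs_mul, abs_of_nonneg (by linarith)]
  have h2 : LipschitzWith 1 fun x : ℝ => n + 1 + x := by
    simpa using (LipschitzWith.const (n + 1)).add (LipschitzWith.id (α := ℝ))
  exact ⟨_, ((h1.min h2).const_min 1).const_max 0⟩

lemma hasDerivAt_trap {n : ℝ} (hn : 1 ≤ n) : ∀ᵐ x, HasDerivAt (trap n) (trapDeriv n x) x := by
  have hn0 : 0 < n := by linarith
  have hi : 1 / n ≤ 1 := by rw [div_le_one hn0]; exact hn
  have hi0 : 0 < 1 / n := by positivity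
  have hfin : ∀ᵐ x : ℝ, x ∉ ({-(n + 1), -n, -(1 / n), 0} : Set ℝ) :=
    (Set.toFinite _).countable.ae_notMem _
  filter_upwards [hfin] with x hx
  simp only [mem_insert_iff, mem_singleton_iff, not_or] at hx
  obtain ⟨h1, h2, h3, h4⟩ := hx
  have key : ∀ y, -(1 / n) < y → -(n * y) < 1 := fun y hy => by
    have := mul_lt_mul_of_pos_left hy hn0
    rw [mul_neg, mul_one_div_cancel hn0.ne'] at this; linarith
  have key' : ∀ y, y < -(1 / n) → 1 < -(n * y) := fun y hy => by
    have := mul_lt_mul_of_pos_left hy hn0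
    rw [mul_neg, mul_one_div_cancel hn0.ne'] at this; linarith
  rcases lt_or_gt_of_ne h1 with h | h1
  · have e : trapDeriv n x = 0 := by
      simp only [trapDeriv, indicator]
      rw [if_neg (fun h' => by linarith [h'.1]), if_neg (fun h' => by linarith [h'.1])]; simp
    rw [e]
    refine (hasDerivAt_const x (0:ℝ)).congr_of_eventuallyEq ?_
    filter_upwards [Iio_mem_nhds h] with y hy
    simp only [mem_Iio] at hy
    exact max_eq_left ((min_le_right _ _).trans ((min_le_right _ _).trans (by linarith)))
  rcases lt_or_gt_of_ne h2 with h | h2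
  · have e : trapDeriv n x = 1 := by
      simp only [trapDeriv, indicator]
      rw [if_pos ⟨h1, h.le⟩, if_neg (fun h' => by linarith [h'.1])]; simp
    rw [e]
    refine ((hasDerivAt_id x).const_add (n + 1)).congr_of_eventuallyEq ?_
    filter_upwards [Ioo_mem_nhds h1 h] with y hy
    have := key' y (by linarith [hy.2])
    rw [trap, min_eq_right (by linarith [hy.2] : n + 1 + y ≤ -(n * y)),
      min_eq_right (by linarith [hy.2]), max_eq_right (by linarith [hy.1])]
    rfl
  rcases lt_or_gt_of_ne h3 with h | h3
  · have e : trapDeriv n x = 0 := by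
      simp only [trapDeriv, indicator]
      rw [if_neg (fun h' => by linarith [h'.2]), if_neg (fun h' => by linarith [h'.1])]; simp
    rw [e]
    refine (hasDerivAt_const x (1:ℝ)).congr_of_eventuallyEq ?_
    filter_upwards [Ioo_mem_nhds h2 h] with y hy
    have := key' y hy.2
    rw [trap, min_eq_left (le_min this.le (by linarith [hy.1])), max_eq_right zero_le_one]
  rcases lt_or_gt_of_ne h4 with h | h4
  · have e : trapDeriv n x = -n := by
      simp only [trapDeriv, indicator]
      rw [if_neg (fun h' => by linarith [h'.2]), if_pos ⟨h3, h.le⟩]; simp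
    rw [e]
    have hd : HasDerivAt (fun y : ℝ => -(n * y)) (-n) x := by
      have := (hasDerivAt_id x).const_mul (-n)
      simpa [neg_mul] using this
    refine hd.congr_of_eventuallyEq ?_
    filter_upwards [Ioo_mem_nhds h3 h] with y hy
    have := key y hy.1
    have hy1 := hy.1
    rw [trap, min_eq_left (by linarith : -(n * y) ≤ n + 1 + y), min_eq_right this.le,
      max_eq_right (by nlinarith [hy.2])]
  · have e : trapDeriv n x = 0 := by
      simp only [trapDeriv, indicator]
      rw [if_neg (fun h' => by linarith [h'.2]), if_neg (fun h' => by linarith [h'.2])]; simp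
    rw [e]
    refine (hasDerivAt_const x (0:ℝ)).congr_of_eventuallyEq ?_
    filter_upwards [Ioi_mem_nhds h4] with y hy
    simp only [mem_Ioi] at hy
    exact max_eq_left ((min_le_right _ _).trans ((min_le_left _ _).trans (by nlinarith)))

lemma cutoff_trap {n : ℝ} (hn : 1 ≤ n) :
    Cutoff (trap n) (trapDeriv n) (-(n + 1)) (1 + n) where
  neg := by linarith
  deriv := ACDeriv.of_lipschitzWith (lipschitzWith_trap hn).choose_spec (hasDerivAt_trap hn)
  meas := (lipschitzWith_trap hn).choose_spec.continuous.measurable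
  meas_d := (measurable_one.indicator measurableSet_Ioc).sub
    ((measurable_one.indicator measurableSet_Ioc).const_mul n)
  mem := fun x => ⟨le_max_left _ _, max_le zero_le_one (min_le_left _ _)⟩
  bdd_d := fun x => by
    rw [trapDeriv]
    refine (abs_sub _ _).trans (add_le_add ?_ ?_)
    · by_cases h : x ∈ Ioc (-(n + 1)) (-n)
      · rw [indicator_of_mem h]; simp
      · rw [indicator_of_notMem h]; simp
    · rw [abs_mul, abs_of_nonneg (by linarith : 0 ≤ n)]
      by_cases h : x ∈ Ioc (-(1 / n)) 0
      · rw [indicator_of_mem h]; simp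
      · rw [indicator_of_notMem h]; simp; linarith
  left := by simp [trap]
  right := by simp [trap]

lemma bulk_ineq {ε w v d ω B D : ℝ} (hε : 0 < ε) (hε1 : ε < 1) (hω : ω ∈ Icc (0:ℝ) 1)
    (hv : |v| ≤ B) (hd : |d| ≤ D) :
    ω * ((v - ε * w) * (w - d)) - ω * (v * w) ≤ -(ε / 2) * (ω * w ^ 2) + (B + D / 2) * |d| := by
  have hB : 0 ≤ B := (abs_nonneg _).trans hv
  have hD : 0 ≤ D := (abs_nonneg _).trans hd
  have h1 : -(v * d) ≤ B * |d| := by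
    refine (neg_le_abs _).trans ?_
    rw [abs_mul]; exact mul_le_mul_of_nonneg_right hv (abs_nonneg _)
  have h2 : d ^ 2 ≤ D * |d| := by
    rw [← sq_abs, sq]; exact mul_le_mul_of_nonneg_right hd (abs_nonneg _)
  have h3 : ε * (w * d) ≤ ε / 2 * w ^ 2 + D / 2 * |d| := by
    have : ε * d ^ 2 ≤ D * |d| := by nlinarith [sq_nonneg d]
    nlinarith [mul_nonneg hε.le (sq_nonneg (w - d))]
  have h4 : 0 ≤ (B + D / 2) * |d| := by positivity
  have h5 : ω * ((B + D / 2) * |d|) ≤ (B + D / 2) * |d| := mul_le_of_le_one_left h4 hω.2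
  have h6 := mul_le_mul_of_nonneg_left (add_le_add h1 h3) hω.1
  linarith

lemma strip_ineq {ε w v b B P : ℝ} (hε : 0 < ε) (hε1 : ε < 1) (hv : |v| ≤ B) (hb : |b| ≤ P) :
    (v - ε * w) * b ≤ ε / 8 * w ^ 2 + (B * P + 2 * P ^ 2) := by
  have hB : 0 ≤ B := (abs_nonneg _).trans hv
  have h1 : v * b ≤ B * P := by
    refine (le_abs_self _).trans ?_
    rw [abs_mul]; exact mul_le_mul hv hb (abs_nonneg _) hB
  have h2 : b ^ 2 ≤ P ^ 2 := by
    rw [← sq_abs]; exact pow_le_pow_left₀ (abs_nonneg _) hb 2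
  have h3 : 0 ≤ ε * (w + 4 * b) ^ 2 := by positivity
  have h4 : ε * b ^ 2 ≤ P ^ 2 := by nlinarith [sq_nonneg b]
  nlinarith

section estimate

variable {ε : ℝ} {Φ fh u0 : ℝ → ℝ} {U W F : ℝ → ℝ → ℝ} {p : ℝ → ℝ} {M N B : ℝ}
  {κ dk : ℝ → ℝ} {D : ℝ}

lemma slice_estimate (hd : HalfData Φ fh B) (hs : HalfSol ε Φ fh u0 U W F p M N)
    (hr : RefState Φ u0 κ dk D) (hε : 0 < ε) (hε1 : ε < 1) {n : ℝ} (hn : 1 ≤ n) :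
    ∀ᵐ t : ℝ, 0 < t →
      ∫ x in (-(n + 1))..0, F x t * (trapDeriv n x * ((p t + ∫ y in (0:ℝ)..x, W y t) - Φ (κ x))
        + trap n x * (W x t - dk x))
      ≤ -(ε / 2) * (∫ x in (-(n + 1))..0, trap n x * W x t ^ 2)
        + ε / 8 * (∫ x in (-(n + 1))..0, W x t ^ 2)
        + (3 * B * Φ 1 + 2 * Φ 1 ^ 2 + (B + D / 2) * ∫ x, |dk x|)
        - n * ∫ x in (-(1 / n))..0, F x t * (p t + ∫ y in (0:ℝ)..x, W y t) := by
  have hn0 : 0 < n := by linarith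
  have hi : 1 / n ≤ 1 := by rw [div_le_one hn0]; exact hn
  have hi0 : 0 < 1 / n := by positivity
  have hΦ1 : 0 ≤ Φ 1 := hd.zero ▸ hd.mono zero_le_one
  have hB : 0 ≤ B := (abs_nonneg _).trans (hd.bdd_fh 0)
  have hD : 0 ≤ D := (abs_nonneg _).trans (hr.bdd_dk 0)
  have hω := cutoff_trap hn
  filter_upwards [hs.pressure, hs.flux] with t h1 h2 ht
  have mUt : Measurable fun x => U x t := hs.mU.of_uncurry_right
  have mWt : Measurable fun x => W x t := hs.mW.of_uncurry_right
  have mFt : Measurable fun x => F x t := hs.mF.of_uncurry_right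
  have bWt : ∀ x, |W x t| ≤ M := fun x => hs.bW x t
  have bFt : ∀ x, |F x t| ≤ N := fun x => hs.bF x t
  have aV : ∀ a b, ACDeriv (fun x => p t + ∫ y in (0:ℝ)..x, W y t) (fun x => W x t) a b :=
    fun a b => ACDeriv.prim mWt bWt (p t)
  have lV : LipschitzWith (0 + M.toNNReal) (fun x => p t + ∫ y in (0:ℝ)..x, W y t) :=
    (LipschitzWith.const (p t)).add (lipschitzWith_prim mWt bWt 0)
  set V := fun x => p t + ∫ y in (0:ℝ)..x, W y t with hV
  have cV : Continuous V := lV.continuous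
  set H := fun v => ∫ s in (0:ℝ)..v, fh s with hH
  have aH : ACDeriv (fun x => H (V x)) (fun x => fh (V x) * W x t) (-(n + 1)) 0 := by
    refine ACDeriv.of_lipschitzWith
      ((lipschitzWith_prim hd.cont_fh.measurable hd.bdd_fh 0).comp lV) ?_
    filter_upwards [(aV 0 0).deriv] with x hx
    exact (hd.cont_fh.integral_hasStrictDerivAt 0 (V x)).hasDerivAt.comp x hx
  have hibp := (hω.deriv.mul aH).integral_eq_sub
  rw [hω.left, hω.right] at hibp
  simp only [zero_mul, sub_zero] at hibp
  have iω : IntervalIntegrable (trapDeriv n) volume (-(n + 1)) 0 :=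
    intervalIntegrable_of_bdd hω.meas_d hω.bdd_d _ _
  have iW : ∀ a b, IntervalIntegrable (fun x => W x t) volume a b :=
    intervalIntegrable_of_bdd mWt bWt
  have bW2 : ∀ x, |W x t ^ 2| ≤ M ^ 2 := fun x => by
    rw [abs_pow]; exact pow_le_pow_left₀ (abs_nonneg _) (bWt x) 2
  have iW2 : ∀ a b, IntervalIntegrable (fun x => W x t ^ 2) volume a b :=
    intervalIntegrable_of_bdd (mWt.pow_const 2) bW2
  have iF : ∀ a b, IntervalIntegrable (fun x => F x t) volume a b :=
    intervalIntegrable_of_bdd mFt bFt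
  have iωW2 : IntervalIntegrable (fun x => trap n x * W x t ^ 2) volume (-(n + 1)) 0 :=
    (iW2 _ _).continuousOn_mul hω.deriv.ac.continuousOn
  have idk : ∀ a b, IntervalIntegrable dk volume a b :=
    intervalIntegrable_of_bdd hr.meas_dk hr.bdd_dk
  have iabs : IntervalIntegrable (fun x => |dk x|) volume (-(n + 1)) 0 := (idk _ _).abs
  have i1 : IntervalIntegrable (fun x => F x t * (trapDeriv n x * (V x - Φ (κ x))
      + trap n x * (W x t - dk x))) volume (-(n + 1)) 0 := by
    have hG : Measurable fun x => trapDeriv n x * (V x - Φ (κ x)) + trap n x * (W x t - dk x) :=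
      (hω.meas_d.mul (cV.measurable.sub (hd.cont.measurable.comp hr.meas))).add
        (hω.meas.mul (mWt.sub hr.meas_dk))
    have h3 := (iω.mul_continuousOn ((aV _ _).sub (hr.deriv _ _)).ac.continuousOn).add
      (((iW _ _).sub (idk _ _)).continuousOn_mul hω.deriv.ac.continuousOn)
    rw [intervalIntegrable_iff] at h3 ⊢
    exact Integrable.bdd_mul (c := N) h3 mFt.aestronglyMeasurable (Eventually.of_forall bFt)
  have i2 : IntervalIntegrable (fun x => trapDeriv n x * H (V x)
      + trap n x * (fh (V x) * W x t)) volume (-(n + 1)) 0 := by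
    refine (iω.mul_continuousOn aH.ac.continuousOn).add ?_
    exact ((iW _ _).continuousOn_mul (hd.cont_fh.comp cV).continuousOn).continuousOn_mul
      hω.deriv.ac.continuousOn
  have iFV : ∀ a b, IntervalIntegrable (fun x => F x t * V x) volume a b := fun a b =>
    (iF a b).mul_continuousOn cV.continuousOn
  set S := Ioc (-(n + 1)) (-n) with hS
  set L := Ioc (-(1 / n)) 0 with hL
  set cS := 2 * B * Φ 1 + 2 * Φ 1 ^ 2 with hcS
  have hcS0 : 0 ≤ cS := by positivity
  have iS : IntervalIntegrable (S.indicator fun _ => cS) volume (-(n + 1)) 0 := by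
    rw [intervalIntegrable_iff]
    exact ((intervalIntegrable_iff.1 (intervalIntegrable_const (c := cS)))).indicator
      measurableSet_Ioc
  have iL : IntervalIntegrable (L.indicator fun x => n * (B * Φ 1 - F x t * V x))
      volume (-(n + 1)) 0 := by
    rw [intervalIntegrable_iff]
    exact (intervalIntegrable_iff.1
      ((intervalIntegrable_const.sub (iFV _ _)).const_mul n)).indicator measurableSet_Ioc
  have hne : ∀ᵐ x : ℝ, x ≠ 0 := by simp [ae_iff]
  have main : ∫ x in (-(n + 1))..0, (F x t * (trapDeriv n x * (V x - Φ (κ x))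
      + trap n x * (W x t - dk x)) - (trapDeriv n x * H (V x) + trap n x * (fh (V x) * W x t)))
      ≤ ∫ x in (-(n + 1))..0, ((((-(ε / 2) * (trap n x * W x t ^ 2) + ε / 8 * W x t ^ 2)
        + (B + D / 2) * |dk x|) + S.indicator (fun _ => cS) x)
        + L.indicator (fun x => n * (B * Φ 1 - F x t * V x)) x) := by
    refine intervalIntegral.integral_mono_ae_restrict hω.neg (i1.sub i2)
      (((((iωW2.const_mul _).add ((iW2 _ _).const_mul _)).add (iabs.const_mul _)).add iS).add iL) ?_
    rw [EventuallyLE, ae_restrict_iff' measurableSet_Icc]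
    filter_upwards [h1, h2, hne] with x hp hf hx0 hxm
    have hx : x < 0 := lt_of_le_of_ne hxm.2 hx0
    have hp := hp hx ht
    have hf := hf hx ht
    have hVx : V x ∈ Icc 0 (Φ 1) := by
      rw [hV]; simp only; rw [← hp]
      exact ⟨hd.zero ▸ hd.mono (hs.U_mem x t).1, hd.mono (hs.U_mem x t).2⟩
    have hHx : |H (V x)| ≤ B * Φ 1 := by
      refine (abs_intervalIntegral_le hd.bdd_fh 0 (V x)).trans ?_
      rw [sub_zero, abs_of_nonneg hVx.1]
      exact mul_le_mul_of_nonneg_left hVx.2 hB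
    have hk0 : 0 ≤ Φ (κ x) := hd.zero ▸ hd.mono (hr.mem x).1
    have hk1 : Φ (κ x) ≤ Φ 1 := hd.mono (hr.mem x).2
    have hVk : |V x - Φ (κ x)| ≤ Φ 1 := abs_sub_le_iff.2
      ⟨by linarith [hVx.2], by linarith [hVx.1]⟩
    have hb := bulk_ineq (w := W x t) hε hε1 (hω.mem x) (hd.bdd_fh (V x)) (hr.bdd_dk x)
    have hf' : F x t = fh (V x) - ε * W x t := hf
    have hW8 : 0 ≤ ε / 8 * W x t ^ 2 := by positivity
    by_cases hxS : x ∈ S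
    · have hxL : x ∉ L := fun h' => by linarith [hxS.2, h'.1]
      have hder : trapDeriv n x = 1 := by
        rw [trapDeriv, indicator_of_mem hxS, indicator_of_notMem hxL]; simp
      have hst := strip_ineq (w := W x t) hε hε1 (hd.bdd_fh (V x)) hVk
      simp only [indicator_of_mem hxS, indicator_of_notMem hxL, hder, one_mul, add_zero]
      rw [hf']
      linarith [neg_abs_le (H (V x))]
    · by_cases hxL : x ∈ L
      · have hder : trapDeriv n x = -n := by
          rw [trapDeriv, indicator_of_notMem hxS, indicator_of_mem hxL]; simp
        have hk : Φ (κ x) = 0 := by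
          rw [hr.near x (by linarith [hxL.1]), hd.zero]
        simp only [indicator_of_mem hxL, indicator_of_notMem hxS, hder, hk, sub_zero, add_zero]
        have := mul_le_mul_of_nonneg_left ((le_abs_self _).trans hHx) hn0.le
        have e : F x t * (-n * V x + trap n x * (W x t - dk x))
            = -(n * (F x t * V x)) + trap n x * (F x t * (W x t - dk x)) := by ring
        rw [e]
        rw [hf'] at *
        linarith
      · have hder : trapDeriv n x = 0 := by
          rw [trapDeriv, indicator_of_notMem hxS, indicator_of_notMem hxL]; simp
        simp only [indicator_of_notMem hxL, indicator_of_notMem hxS, hder, zero_mul, add_zero,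
          zero_add]
        rw [hf']
        linarith
  rw [intervalIntegral.integral_sub i1 i2, hibp, sub_zero, intervalIntegral.integral_add
    ((((iωW2.const_mul _).add ((iW2 _ _).const_mul _)).add (iabs.const_mul _)).add iS) iL,
    intervalIntegral.integral_add
    (((iωW2.const_mul _).add ((iW2 _ _).const_mul _)).add (iabs.const_mul _)) iS,
    intervalIntegral.integral_add
    ((iωW2.const_mul _).add ((iW2 _ _).const_mul _)) (iabs.const_mul _),
    intervalIntegral.integral_add (iωW2.const_mul _) ((iW2 _ _).const_mul _),
    intervalIntegral_indicator_Ioc le_rfl (by linarith) (by linarith),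
    intervalIntegral_indicator_Ioc (by linarith) (by linarith) le_rfl,
    intervalIntegral.integral_const_mul, intervalIntegral.integral_const_mul,
    intervalIntegral.integral_const_mul, intervalIntegral.integral_const_mul,
    intervalIntegral.integral_sub intervalIntegrable_const (iFV _ _)] at main
  have e1 : ∫ x in (-(n + 1))..0, |dk x| ≤ ∫ x, |dk x| := by
    rw [intervalIntegral.integral_of_le hω.neg]
    exact setIntegral_le_integral hr.int_dk.abs (Eventually.of_forall fun x => abs_nonneg _)
  have e2 := mul_le_mul_of_nonneg_left e1 (by positivity : 0 ≤ B + D / 2)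
  have e3 : n * (1 / n) = 1 := mul_one_div_cancel hn0.ne'
  simp only [intervalIntegral.integral_const, smul_eq_mul] at main
  have e4 : n * ((0 - -(1 / n)) * (B * Φ 1) - ∫ x in (-(1 / n))..0, F x t * V x)
      = B * Φ 1 - n * ∫ x in (-(1 / n))..0, F x t * V x := by
    rw [mul_sub, ← mul_assoc, zero_sub, neg_neg, e3, one_mul]
  rw [e4] at main
  linarith

end estimate

lemma intervalIntegrable_param {f : ℝ → ℝ → ℝ} (hf : Measurable (Function.uncurry f)) {a b M : ℝ}
    (hM : ∀ t, ∀ x ∈ uIoc a b, |f t x| ≤ M) (c d : ℝ) :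
    IntervalIntegrable (fun t => ∫ x in a..b, f t x) volume c d := by
  refine intervalIntegrable_of_bdd (M := M * |b - a|)
    (measurable_intervalIntegral_param hf measurable_const measurable_const) (fun t => ?_) c d
  exact intervalIntegral.norm_integral_le_of_norm_le_const (f := f t) (fun x hx => hM t x hx)

section
variable {ε : ℝ} {Φ fh u0 : ℝ → ℝ} {U W F : ℝ → ℝ → ℝ} {p : ℝ → ℝ} {M N B : ℝ}
  {κ dk : ℝ → ℝ} {D : ℝ}

lemma abs_pressure_le (hs : HalfSol ε Φ fh u0 U W F p M N) {b : ℝ} (t : ℝ) {x : ℝ}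
    (hx : x ∈ uIoc b 0) : |p t + ∫ y in (0:ℝ)..x, W y t| ≤ Φ 1 + M * |b| := by
  have h1 := abs_intervalIntegral_le (fun y => hs.bW y t) 0 x
  have h2 := hs.p_mem t
  have hM : 0 ≤ M := (abs_nonneg _).trans (hs.bW 0 0)
  have h3 : |x| ≤ |b| := by
    rcases le_total b 0 with hb | hb
    · rw [uIoc_of_le hb] at hx
      rw [abs_of_nonpos hx.2, abs_of_nonpos hb]; linarith [hx.1]
    · rw [uIoc_of_ge hb] at hx
      rw [abs_of_pos hx.1, abs_of_nonneg hb]; exact hx.2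
  have h4 := mul_le_mul_of_nonneg_left h3 hM
  have h5 := abs_add_le (p t) (∫ y in (0:ℝ)..x, W y t)
  rw [abs_of_nonneg h2.1] at h5
  rw [sub_zero] at h1
  linarith [h2.2]

lemma measurable_pressure (hs : HalfSol ε Φ fh u0 U W F p M N) :
    Measurable (Function.uncurry fun t x => p t + ∫ y in (0:ℝ)..x, W y t) := by
  refine (hs.mp.comp measurable_fst).add ?_
  exact measurable_intervalIntegral_param (α := ℝ × ℝ) (f := fun z y => W y z.1)
    (hs.mW.comp (measurable_snd.prodMk measurable_fst.fst)) measurable_const measurable_snd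

lemma measurable_flux_pressure (hs : HalfSol ε Φ fh u0 U W F p M N) :
    Measurable (Function.uncurry fun t x => F x t * (p t + ∫ y in (0:ℝ)..x, W y t)) :=
  (hs.mF.comp measurable_swap).mul (measurable_pressure hs)

lemma integrated_estimate (hd : HalfData Φ fh B) (hs : HalfSol ε Φ fh u0 U W F p M N)
    (hr : RefState Φ u0 κ dk D) (hε : 0 < ε) (hε1 : ε < 1) {n : ℝ} (hn : 1 ≤ n)
    {T : ℝ} (hT : 0 ≤ T) :
    (ε / 2) * (∫ t in (0:ℝ)..T, ∫ x in (-(n + 1))..0, trap n x * W x t ^ 2)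
      ≤ Φ 1 * (∫ x in Iio (0:ℝ), |u0 x - κ x|)
        + T * (3 * B * Φ 1 + 2 * Φ 1 ^ 2 + (B + D / 2) * ∫ x, |dk x|)
        + ε / 8 * (∫ t in (0:ℝ)..T, ∫ x in (-(n + 1))..0, W x t ^ 2)
        - ∫ t in (0:ℝ)..T, n * ∫ x in (-(1 / n))..0, F x t * (p t + ∫ y in (0:ℝ)..x, W y t) := by
  have hω := cutoff_trap hn
  have ha : -(n + 1) ≤ 0 := hω.neg
  have hM0 : 0 ≤ M := (abs_nonneg _).trans (hs.bW 0 0)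
  have hN0 : 0 ≤ N := (abs_nonneg _).trans (hs.bF 0 0)
  have hu0 : ∀ x, u0 x ∈ Icc (0:ℝ) 1 := fun x => by
    rw [← hs.U_init x 0 le_rfl]; exact hs.U_mem x 0
  have h1 := energy_flux hd hs hr hω hT
  have hW2 : ∀ x t, |W x t ^ 2| ≤ M ^ 2 := fun x t => by
    rw [abs_of_nonneg (sq_nonneg _)]
    exact sq_le_sq' (abs_le.1 (hs.bW x t)).1 (abs_le.1 (hs.bW x t)).2
  have hmW2 : Measurable (Function.uncurry fun t x => W x t ^ 2) :=
    (hs.mW.comp measurable_swap).pow_const 2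
  have i1 : IntervalIntegrable (fun t => ∫ x in (-(n + 1))..0, trap n x * W x t ^ 2) volume 0 T := by
    refine intervalIntegrable_param (f := fun t x => trap n x * W x t ^ 2) (M := M ^ 2)
      (by refine (hω.meas.comp measurable_snd).mul ?_; exact hmW2)
      (fun t x _ => ?_) 0 T
    rw [abs_mul, abs_of_nonneg (hω.mem x).1]
    have := hW2 x t
    calc _ ≤ 1 * |W x t ^ 2| := mul_le_mul_of_nonneg_right (hω.mem x).2 (abs_nonneg _)
      _ ≤ _ := by rw [one_mul]; exact this
  have i2 : IntervalIntegrable (fun t => ∫ x in (-(n + 1))..0, W x t ^ 2) volume 0 T :=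
    intervalIntegrable_param hmW2 (fun t x _ => hW2 x t) 0 T
  have i3 : IntervalIntegrable (fun t => ∫ x in (-(1 / n))..0,
      F x t * (p t + ∫ y in (0:ℝ)..x, W y t)) volume 0 T := by
    refine intervalIntegrable_param (M := N * (Φ 1 + M * |-(1 / n)|)) (measurable_flux_pressure hs)
      (fun t x hx => ?_) 0 T
    rw [abs_mul]
    exact mul_le_mul (hs.bF x t) (abs_pressure_le hs t hx) (abs_nonneg _) hN0
  have i4 : IntervalIntegrable (fun t => ∫ x in (-(n + 1))..0, F x t *
        (trapDeriv n x * ((p t + ∫ y in (0:ℝ)..x, W y t) - Φ (κ x))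
          + trap n x * (W x t - dk x))) volume 0 T := by
    refine intervalIntegrable_param (f := fun t x => F x t *
        (trapDeriv n x * ((p t + ∫ y in (0:ℝ)..x, W y t) - Φ (κ x)) + trap n x * (W x t - dk x)))
      (M := N * ((1 + n) * (Φ 1 + M * |-(n + 1)| + Φ 1) + 1 * (M + D)))
      ((hs.mF.comp measurable_swap).mul (measurable_energy_density hd hs hr hω))
      (fun t x hx => ?_) 0 T
    rw [abs_mul]
    rw [uIoc_of_le ha] at hx
    exact mul_le_mul (hs.bF x t) (abs_energy_density_le hd hs hr hω t (Ioc_subset_Icc_self hx))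
      (abs_nonneg _) hN0
  have h2 : ∫ t in (0:ℝ)..T, ∫ x in (-(n + 1))..0, F x t *
        (trapDeriv n x * ((p t + ∫ y in (0:ℝ)..x, W y t) - Φ (κ x))
          + trap n x * (W x t - dk x)) ≤
      ∫ t in (0:ℝ)..T, (-(ε / 2) * (∫ x in (-(n + 1))..0, trap n x * W x t ^ 2)
        + ε / 8 * (∫ x in (-(n + 1))..0, W x t ^ 2)
        + (3 * B * Φ 1 + 2 * Φ 1 ^ 2 + (B + D / 2) * ∫ x, |dk x|)
        - n * ∫ x in (-(1 / n))..0, F x t * (p t + ∫ y in (0:ℝ)..x, W y t)) := by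
    rw [intervalIntegral.integral_of_le hT, intervalIntegral.integral_of_le hT]
    refine integral_mono_ae i4.1 ((((i1.const_mul _).add (i2.const_mul _)).add
      intervalIntegrable_const).sub (i3.const_mul _)).1 ?_
    rw [EventuallyLE, ae_restrict_iff' measurableSet_Ioc]
    filter_upwards [slice_estimate hd hs hr hε hε1 hn] with t ht hmem using ht hmem.1
  rw [intervalIntegral.integral_sub (((i1.const_mul _).add (i2.const_mul _)).add
      intervalIntegrable_const) (i3.const_mul _),
    intervalIntegral.integral_add ((i1.const_mul _).add (i2.const_mul _)) intervalIntegrable_const,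
    intervalIntegral.integral_add (i1.const_mul _) (i2.const_mul _),
    intervalIntegral.integral_const_mul, intervalIntegral.integral_const_mul,
    intervalIntegral.integral_const, sub_zero, smul_eq_mul] at h2
  have h3 : ∫ x in (-(n + 1))..0, trap n x * relEnergy Φ (κ x) (u0 x) ≤
      Φ 1 * (∫ x in Iio (0:ℝ), |u0 x - κ x|) := by
    have hΦ1 : 0 ≤ Φ 1 := (hs.p_mem 0).1.trans (hs.p_mem 0).2
    have hΦκ : IntegrableOn (fun x => Φ 1 * |u0 x - κ x|) (Iic 0) := by
      rw [integrableOn_Iic_iff_integrableOn_Iio]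
      exact hr.int_sub.abs.const_mul _
    rw [intervalIntegral.integral_of_le ha, ← integral_Iic_eq_integral_Iio,
      ← integral_const_mul]
    refine (integral_mono_of_nonneg (Eventually.of_forall fun x =>
      mul_nonneg (hω.mem x).1 (relEnergy_nonneg hd.mono hd.cont _ _))
      (hΦκ.mono_set Ioc_subset_Iic_self) (Eventually.of_forall fun x => ?_)).trans
      (setIntegral_mono_set hΦκ (Eventually.of_forall fun x =>
        mul_nonneg hΦ1 (abs_nonneg _)) Ioc_subset_Iic_self.eventuallyLE)
    calc trap n x * relEnergy Φ (κ x) (u0 x) ≤ 1 * relEnergy Φ (κ x) (u0 x) :=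
          mul_le_mul_of_nonneg_right (hω.mem x).2 (relEnergy_nonneg hd.mono hd.cont _ _)
      _ ≤ _ := by rw [one_mul]; exact relEnergy_le_abs hd.mono hd.zero (hr.mem x) (hu0 x)
  linarith

end

lemma volume_restrict_Iio_prod (T : ℝ) :
    (volume : Measure (ℝ × ℝ)).restrict (Iio 0 ×ˢ Ioc 0 T)
      = (volume : Measure (ℝ × ℝ)).restrict (Iic 0 ×ˢ Ioc 0 T) := by
  rw [Measure.volume_eq_prod, ← Measure.prod_restrict, ← Measure.prod_restrict,
    restrict_Iio_eq_restrict_Iic]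

lemma intervalIntegral_eq_setIntegral_prod {f : ℝ × ℝ → ℝ} {a b c d : ℝ} (hab : a ≤ b)
    (hcd : c ≤ d) (hf : IntegrableOn f (Ioc a b ×ˢ Ioc c d)) :
    ∫ t in c..d, ∫ x in a..b, f (x, t) = ∫ z in Ioc a b ×ˢ Ioc c d, f z := by
  rw [intervalIntegral.integral_of_le hcd, Measure.volume_eq_prod, ← Measure.prod_restrict,
    integral_prod_symm]
  · simp only [intervalIntegral.integral_of_le hab]
  · rw [Measure.prod_restrict, ← Measure.volume_eq_prod]; exact hf

lemma trap_mem (n x : ℝ) : trap n x ∈ Icc (0:ℝ) 1 :=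
  ⟨le_max_left _ _, max_le zero_le_one (min_le_left _ _)⟩

lemma tendsto_trap {x : ℝ} (hx : x < 0) :
    Tendsto (fun m : ℕ => trap (m + 1) x) atTop (nhds 1) := by
  refine tendsto_const_nhds.congr' ?_
  filter_upwards [eventually_ge_atTop ⌈-x⌉₊, eventually_ge_atTop ⌈1 / (-x)⌉₊] with m h1 h2
  have h1 : -x ≤ m := Nat.ceil_le.1 h1
  have h2 : 1 / (-x) ≤ m := Nat.ceil_le.1 h2
  rw [div_le_iff₀ (by linarith)] at h2
  rw [trap, min_eq_left, max_eq_right zero_le_one]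
  refine le_min ?_ ?_ <;> nlinarith

lemma tendsto_integral_trap {f : ℝ × ℝ → ℝ} (hf : Measurable f) (h0 : ∀ z, 0 ≤ f z) {T : ℝ}
    (hT : 0 ≤ T) (hi : IntegrableOn f (Iio 0 ×ˢ Ioc 0 T)) :
    Tendsto (fun m : ℕ => ∫ t in (0:ℝ)..T, ∫ x in (-((m + 1 : ℝ) + 1))..0,
      trap (m + 1) x * f (x, t)) atTop (nhds (∫ z in Iio 0 ×ˢ Ioc 0 T, f z)) := by
  rw [IntegrableOn, volume_restrict_Iio_prod] at hi
  have hm : ∀ m : ℕ, Measurable (fun z : ℝ × ℝ => trap (m + 1) z.1 * f z) := fun m =>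
    ((cutoff_trap (n := m + 1) (by simp)).meas.comp measurable_fst).mul hf
  have hb : ∀ m : ℕ, ∀ z, ‖trap (m + 1) z.1 * f z‖ ≤ f z := fun m z => by
    rw [Real.norm_of_nonneg (mul_nonneg (trap_mem _ _).1 (h0 z))]
    exact (mul_le_mul_of_nonneg_right (trap_mem _ _).2 (h0 z)).trans_eq (one_mul _)
  have heq : ∀ m : ℕ, ∫ t in (0:ℝ)..T, ∫ x in (-((m + 1 : ℝ) + 1))..0, trap (m + 1) x * f (x, t)
      = ∫ z in Iio 0 ×ˢ Ioc 0 T, trap (m + 1) z.1 * f z := fun m => by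
    have ha : -((m + 1 : ℝ) + 1) ≤ 0 := by have := m.cast_nonneg (α := ℝ); linarith
    have hsub : Ioc (-((m + 1 : ℝ) + 1)) 0 ×ˢ Ioc 0 T ⊆ Iic 0 ×ˢ Ioc 0 T :=
      prod_mono Ioc_subset_Iic_self le_rfl
    have hi' : Integrable (fun z : ℝ × ℝ => trap (m + 1) z.1 * f z)
        ((volume : Measure (ℝ × ℝ)).restrict (Iic 0 ×ˢ Ioc 0 T)) :=
      hi.mono' (hm m).aestronglyMeasurable (Eventually.of_forall (hb m))
    rw [intervalIntegral_eq_setIntegral_prod (f := fun z : ℝ × ℝ => trap (m + 1) z.1 * f z) ha hT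
      (IntegrableOn.mono_set hi' hsub),
      volume_restrict_Iio_prod]
    refine (setIntegral_eq_of_subset_of_forall_sdiff_eq_zero
      (measurableSet_Iic.prod measurableSet_Ioc) hsub fun z hz => ?_).symm
    have : z.1 ≤ -((m + 1 : ℝ) + 1) := by
      by_contra! h
      exact hz.2 ⟨⟨h, hz.1.1⟩, hz.1.2⟩
    rw [trap, max_eq_left, zero_mul]
    exact (min_le_right _ _).trans ((min_le_right _ _).trans (by linarith))
  simp_rw [heq]
  rw [volume_restrict_Iio_prod]
  refine tendsto_integral_of_dominated_convergence f (fun m => (hm m).aestronglyMeasurable)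
    hi (fun m => Eventually.of_forall (hb m)) ?_
  rw [← volume_restrict_Iio_prod,
    ae_restrict_iff' (measurableSet_Iio.prod measurableSet_Ioc)]
  refine Eventually.of_forall fun z hz => ?_
  simpa using (tendsto_trap hz.1).mul_const (f z)

lemma integral_box_le {f : ℝ × ℝ → ℝ} (h0 : ∀ z, 0 ≤ f z) {T : ℝ}
    (hT : 0 ≤ T) (hi : IntegrableOn f (Iio 0 ×ˢ Ioc 0 T)) {a : ℝ} (ha : a ≤ 0) :
    ∫ t in (0:ℝ)..T, ∫ x in a..0, f (x, t) ≤ ∫ z in Iio 0 ×ˢ Ioc 0 T, f z := by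
  rw [IntegrableOn, volume_restrict_Iio_prod] at hi
  have hsub : Ioc a 0 ×ˢ Ioc 0 T ⊆ Iic 0 ×ˢ Ioc 0 T :=
    prod_mono Ioc_subset_Iic_self le_rfl
  rw [intervalIntegral_eq_setIntegral_prod ha hT (IntegrableOn.mono_set hi hsub),
    volume_restrict_Iio_prod]
  exact setIntegral_mono_set hi (Eventually.of_forall h0) hsub.eventuallyLE

lemma exists_smooth_integral_sub_le {f : ℝ → ℝ} (hf : Integrable f) {δ : ℝ} (hδ : 0 < δ) :
    ∃ g : ℝ → ℝ, HasCompactSupport g ∧ ContDiff ℝ (⊤ : ℕ∞) g ∧ ∫ x, |f x - g x| ≤ δ := by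
  obtain ⟨g, h1, h2, h3⟩ := MemLp.exist_eLpNorm_sub_le (p := 1) (by simp) le_rfl
    (memLp_one_iff_integrable.2 hf) hδ
  refine ⟨g, h1, h2, ?_⟩
  have hg : Integrable g := h2.continuous.integrable_of_hasCompactSupport h1
  rw [eLpNorm_one_eq_lintegral_enorm] at h3
  have h4 := ofReal_integral_norm_eq_lintegral_enorm (hf.sub hg)
  rw [← h4, ENNReal.ofReal_le_ofReal_iff hδ.le] at h3
  exact h3

lemma tendsto_integral_mul_of_prim {G : ℕ → ℝ → ℝ} (hG : ∀ m, Measurable (G m)) {K : ℝ}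
    (hK : ∀ m t, |G m t| ≤ K) {T : ℝ} (hT : 0 ≤ T) {r : ℕ → ℝ}
    (hr : Tendsto r atTop (nhds 0)) (h : ∀ m, ∀ t ∈ Icc 0 T, |∫ s in (0:ℝ)..t, G m s| ≤ r m)
    {θ : ℝ → ℝ} (hθ : Measurable θ) {L : ℝ} (hL : ∀ t, |θ t| ≤ L) :
    Tendsto (fun m => ∫ t in (0:ℝ)..T, θ t * G m t) atTop (nhds 0) := by
  have hK0 : 0 ≤ K := (abs_nonneg _).trans (hK 0 0)
  rw [Metric.tendsto_atTop']
  intro δ hδ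
  have hfi : Integrable ((Ioc 0 T).indicator θ) := by
    rw [integrable_indicator_iff measurableSet_Ioc]
    exact (intervalIntegrable_of_bdd hθ hL 0 T).1
  obtain ⟨g, hgc, hg, hfg⟩ := exists_smooth_integral_sub_le hfi
    (δ := δ / (2 * (K + 1))) (by positivity)
  obtain ⟨A, hA⟩ : ∃ A, ∀ x, |g x| ≤ A := hgc.exists_bound_of_continuous hg.continuous
  have hg' : Continuous (deriv g) := hg.continuous_deriv (by simp)
  obtain ⟨A', hA'⟩ : ∃ A, ∀ x, |deriv g x| ≤ A :=
    hgc.deriv.exists_bound_of_continuous hg'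
  have hA0 : 0 ≤ A := (abs_nonneg _).trans (hA 0)
  have hA0' : 0 ≤ A' := (abs_nonneg _).trans (hA' 0)
  have hsm : ∀ᶠ m in atTop, (A + A' * T) * r m < δ / 2 := by
    have := hr.const_mul (A + A' * T)
    rw [mul_zero] at this
    exact this.eventually_lt_const (by positivity)
  obtain ⟨m0, hm0⟩ := eventually_atTop.1 hsm
  refine ⟨m0, fun m hm => ?_⟩
  have hm := hm0 m hm.le
  have e1 : ∫ t in (0:ℝ)..T, θ t * G m t
      = (∫ t in (0:ℝ)..T, (θ t - g t) * G m t) + ∫ t in (0:ℝ)..T, g t * G m t := by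
    rw [← intervalIntegral.integral_add]
    · congr 1; ext t; ring
    · refine intervalIntegrable_of_bdd ((hθ.sub hg.continuous.measurable).mul (hG m))
        (M := (L + A) * K) (fun t => ?_) 0 T
      rw [Pi.mul_apply, abs_mul]
      exact mul_le_mul ((abs_sub _ _).trans (add_le_add (hL t) (hA t))) (hK m t) (abs_nonneg _)
        (add_nonneg ((abs_nonneg _).trans (hL 0)) hA0)
    · refine intervalIntegrable_of_bdd (hg.continuous.measurable.mul (hG m))
        (M := A * K) (fun t => ?_) 0 T
      rw [Pi.mul_apply, abs_mul]
      exact mul_le_mul (hA t) (hK m t) (abs_nonneg _) hA0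
  have e2 : |∫ t in (0:ℝ)..T, (θ t - g t) * G m t| ≤ K * (δ / (2 * (K + 1))) := by
    have hgi : Integrable g := hg.continuous.integrable_of_hasCompactSupport hgc
    have hd : Integrable fun t => |(Ioc 0 T).indicator θ t - g t| := (hfi.sub hgi).abs
    rw [intervalIntegral.integral_of_le hT, ← Real.norm_eq_abs]
    calc ‖∫ t in Ioc 0 T, (θ t - g t) * G m t‖
        ≤ ∫ t in Ioc 0 T, K * |(Ioc 0 T).indicator θ t - g t| := by
          refine norm_integral_le_of_norm_le (hd.const_mul K).integrableOn ?_
          rw [ae_restrict_iff' measurableSet_Ioc]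
          refine Eventually.of_forall fun t ht => ?_
          rw [indicator_of_mem ht, Real.norm_eq_abs, abs_mul, mul_comm]
          exact mul_le_mul_of_nonneg_right (hK m t) (abs_nonneg _)
      _ ≤ ∫ t, K * |(Ioc 0 T).indicator θ t - g t| :=
          setIntegral_le_integral (hd.const_mul K)
            (Eventually.of_forall fun t => mul_nonneg hK0 (abs_nonneg _))
      _ ≤ _ := by
          rw [integral_const_mul]
          exact mul_le_mul_of_nonneg_left hfg hK0
  have e3 : |∫ t in (0:ℝ)..T, g t * G m t| ≤ (A + A' * T) * r m := by
    have hH := ACDeriv.prim (a := 0) (b := T) (hG m) (hK m) 0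
    obtain ⟨Lg, hLg⟩ := contDiff_compactSupport_lipschitz hg hgc
    have hgd : ACDeriv g (deriv g) 0 T := ACDeriv.of_lipschitzWith hLg
      (Eventually.of_forall fun x => (hg.differentiable (by simp) x).hasDerivAt)
    have key := (hgd.mul hH).integral_eq_sub
    simp only [zero_add, intervalIntegral.integral_same, mul_zero, sub_zero] at key
    have hc : Continuous fun x => ∫ y in (0:ℝ)..x, G m y :=
      (lipschitzWith_prim (hG m) (hK m) 0).continuous
    rw [intervalIntegral.integral_add] at key
    · have b1 : |g T * ∫ y in (0:ℝ)..T, G m y| ≤ A * r m := by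
        rw [abs_mul]
        exact mul_le_mul (hA T) (h m T ⟨hT, le_rfl⟩) (abs_nonneg _) hA0
      have b2 : |∫ x in (0:ℝ)..T, deriv g x * ∫ y in (0:ℝ)..x, G m y| ≤ (A' * r m) * |T - 0| := by
        rw [← Real.norm_eq_abs]
        refine intervalIntegral.norm_integral_le_of_norm_le_const fun x hx => ?_
        rw [uIoc_of_le hT] at hx
        rw [Real.norm_eq_abs, abs_mul]
        exact mul_le_mul (hA' x) (h m x (Ioc_subset_Icc_self hx)) (abs_nonneg _) hA0'
      rw [sub_zero, abs_of_nonneg hT] at b2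
      have : ∫ t in (0:ℝ)..T, g t * G m t = g T * (∫ y in (0:ℝ)..T, G m y)
        - ∫ x in (0:ℝ)..T, deriv g x * ∫ y in (0:ℝ)..x, G m y := by linarith
      rw [this]
      refine (abs_sub _ _).trans ?_
      linarith
    · exact (hg'.mul hc).intervalIntegrable _ _
    · refine intervalIntegrable_of_bdd (hg.continuous.measurable.mul (hG m))
        (M := A * K) (fun t => ?_) 0 T
      rw [Pi.mul_apply, abs_mul]
      exact mul_le_mul (hA t) (hK m t) (abs_nonneg _) hA0
  have e4 : K * (δ / (2 * (K + 1))) ≤ δ / 2 := by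
    rw [mul_div_assoc', div_le_div_iff₀ (by positivity) (by norm_num)]
    nlinarith
  rw [Real.dist_eq, sub_zero, e1]
  refine (abs_add_le _ _).trans_lt ?_
  linarith

lemma le_of_ae_le_of_continuous {H : ℝ → ℝ} (hH : Continuous H) {b c : ℝ}
    (h : ∀ᵐ t, t < b → H t ≤ c) {t : ℝ} (ht : t < b) : H t ≤ c := by
  have := Measure.eqOn_open_of_ae_eq (μ := volume) (f := fun t => max (H t) c) (g := fun _ => c)
    (U := Iio b) ?_ isOpen_Iio (hH.max continuous_const).continuousOn continuousOn_const ht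
  · exact max_eq_right_iff.1 this
  · rw [EventuallyEq, ae_restrict_iff' measurableSet_Iio]
    filter_upwards [h] with s hs hmem using max_eq_right (hs hmem)

lemma ae_neg {P : ℝ → Prop} (h : ∀ᵐ x, P x) : ∀ᵐ x : ℝ, P (-x) :=
  (Measure.measurePreserving_neg (volume : Measure ℝ)).quasiMeasurePreserving.ae h

/-- Difference of the means of the flux on both sides of the interface. -/
def fluxJump (F : ℝ → ℝ → ℝ) (n t : ℝ) : ℝ := n * ∫ x in (-(1 / n))..0, (F x t - F (-x) t)

lemma measurable_fluxJump {F : ℝ → ℝ → ℝ} (hF : Measurable (Function.uncurry F)) (n : ℝ) :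
    Measurable (fluxJump F n) := by
  refine Measurable.const_mul ?_ n
  refine measurable_intervalIntegral_param (α := ℝ) (f := fun t x => F x t - F (-x) t)
    ?_ measurable_const measurable_const
  exact (hF.comp measurable_swap).sub (hF.comp (measurable_snd.neg.prodMk measurable_fst))

lemma abs_fluxJump_le {F : ℝ → ℝ → ℝ} {N : ℝ} (hN : ∀ x t, |F x t| ≤ N) {n : ℝ} (hn : 0 < n)
    (t : ℝ) : |fluxJump F n t| ≤ 2 * N := by
  have h : |∫ x in (-(1 / n))..0, (F x t - F (-x) t)| ≤ (2 * N) * |0 - (-(1 / n))| :=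
    abs_intervalIntegral_le (fun x => (abs_sub _ _).trans (by linarith [hN x t, hN (-x) t])) _ _
  rw [zero_sub, neg_neg, abs_of_pos (by positivity : 0 < 1 / n)] at h
  rw [fluxJump, abs_mul, abs_of_pos hn]
  calc _ ≤ n * (2 * N * (1 / n)) := mul_le_mul_of_nonneg_left h hn.le
    _ = 2 * N := by field_simp

lemma abs_prim_fluxJump_le {U F : ℝ → ℝ → ℝ}
    (hF : Measurable (Function.uncurry F)) {N : ℝ} (hU1 : ∀ x t, U x t ∈ Icc (0:ℝ) 1)
    (hN : ∀ x t, |F x t| ≤ N) (h0 : ∀ x t, t ≤ 0 → F x t = 0)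
    (hbal : ∀ h : ℝ, ∃ c : ℝ → ℝ, ∀ᵐ t : ℝ, ∀ᵐ x : ℝ, ∫ s in (t - h)..t, F x s
      = c t - ∫ y in (0:ℝ)..x, (U y t - U y (t - h)))
    {n : ℝ} (hn : 0 < n) {T t : ℝ} (ht : t ∈ Icc 0 T) :
    |∫ s in (0:ℝ)..t, fluxJump F n s| ≤ 2 / n := by
  have hcont : Continuous fun t => |∫ s in (0:ℝ)..t, fluxJump F n s| :=
    (lipschitzWith_prim (measurable_fluxJump hF n) (abs_fluxJump_le hN hn) 0).continuous.abs
  refine le_of_ae_le_of_continuous hcont (b := T + 1) ?_ (by linarith [ht.2])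
  clear ht t
  obtain ⟨c, hc⟩ := hbal (T + 1)
  filter_upwards [hc] with t hct ht
  have hF0 : ∀ x, ∫ s in (t - (T + 1))..t, F x s = ∫ s in (0:ℝ)..t, F x s := fun x => by
    have hi := fun a b => intervalIntegrable_of_bdd (hF.of_uncurry_left (x := x)) (hN x) a b
    rw [← intervalIntegral.integral_add_adjacent_intervals (hi _ 0) (hi 0 t)]
    have : ∫ s in (t - (T + 1))..0, F x s = ∫ s in (t - (T + 1))..0, (0:ℝ) := by
      refine intervalIntegral.integral_congr fun s hs => ?_
      rw [uIcc_of_le (by linarith)] at hs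
      exact h0 x s hs.2
    rw [this, intervalIntegral.integral_zero, zero_add]
  simp_rw [hF0] at hct
  have hswap : ∫ s in (0:ℝ)..t, fluxJump F n s
      = n * ∫ x in (-(1 / n))..0, ∫ s in (0:ℝ)..t, (F x s - F (-x) s) := by
    simp only [fluxJump]
    rw [intervalIntegral.integral_const_mul,
      intervalIntegral_swap (f := fun x s => F x s - F (-x) s) (M := 2 * N)
      (hF.sub (hF.comp (measurable_fst.neg.prodMk measurable_snd)))
      (fun x _ s _ => (abs_sub _ _).trans (by linarith [hN x s, hN (-x) s]))]
  have hD : ∀ x, |∫ y in (0:ℝ)..x, (U y t - U y (t - (T + 1)))| ≤ 1 * |x - 0| := fun x =>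
    abs_intervalIntegral_le (fun y => abs_le.2
      ⟨by linarith [(hU1 y t).1, (hU1 y (t - (T + 1))).2],
       by linarith [(hU1 y t).2, (hU1 y (t - (T + 1))).1]⟩) 0 x
  have hb : ‖∫ x in (-(1 / n))..0, ∫ s in (0:ℝ)..t, (F x s - F (-x) s)‖
      ≤ (2 / n) * |0 - (-(1 / n))| := by
    refine intervalIntegral.norm_integral_le_of_norm_le_const_ae ?_
    filter_upwards [hct, ae_neg hct] with x hx hx' hmem
    rw [uIoc_of_le (by have := one_div_pos.2 hn; linarith)] at hmem
    have hi := fun x => intervalIntegrable_of_bdd (hF.of_uncurry_left (x := x)) (hN x) 0 t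
    rw [intervalIntegral.integral_sub (hi x) (hi (-x)), hx, hx', Real.norm_eq_abs]
    have h1 := abs_le.1 (hD x)
    have h2 := abs_le.1 (hD (-x))
    rw [sub_zero, one_mul, abs_neg, abs_of_nonpos hmem.2] at h2
    rw [sub_zero, one_mul, abs_of_nonpos hmem.2] at h1
    have h3 : 2 / n = 2 * (1 / n) := by ring
    rw [abs_le, h3]
    constructor <;> linarith [hmem.1, h1.1, h1.2, h2.1, h2.2]
  rw [zero_sub, neg_neg, abs_of_pos (by positivity : 0 < 1 / n), Real.norm_eq_abs] at hb
  rw [hswap, abs_mul, abs_of_pos hn]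
  calc _ ≤ n * (2 / n * (1 / n)) := mul_le_mul_of_nonneg_left hb hn.le
    _ = 2 / n := by field_simp

lemma tendsto_integral_mul_fluxJump {U F : ℝ → ℝ → ℝ}
    (hF : Measurable (Function.uncurry F)) {N : ℝ} (hU1 : ∀ x t, U x t ∈ Icc (0:ℝ) 1)
    (hN : ∀ x t, |F x t| ≤ N) (h0 : ∀ x t, t ≤ 0 → F x t = 0)
    (hbal : ∀ h : ℝ, ∃ c : ℝ → ℝ, ∀ᵐ t : ℝ, ∀ᵐ x : ℝ, ∫ s in (t - h)..t, F x s
      = c t - ∫ y in (0:ℝ)..x, (U y t - U y (t - h)))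
    {T : ℝ} (hT : 0 ≤ T) {θ : ℝ → ℝ} (hθ : Measurable θ) {L : ℝ} (hL : ∀ t, |θ t| ≤ L) :
    Tendsto (fun m : ℕ => ∫ t in (0:ℝ)..T, θ t * fluxJump F (m + 1) t) atTop (nhds 0) := by
  refine tendsto_integral_mul_of_prim (r := fun m : ℕ => 2 / ((m:ℝ) + 1))
    (fun m => measurable_fluxJump hF _)
    (fun m t => abs_fluxJump_le hN (by positivity) t) hT ?_
    (fun m t ht => abs_prim_fluxJump_le hF hU1 hN h0 hbal (by positivity) ht) hθ hL
  have := tendsto_one_div_add_atTop_nhds_zero_nat (𝕜 := ℝ)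
  simpa [div_eq_mul_inv] using this.const_mul 2

section
variable {ε : ℝ} {Φ fh u0 : ℝ → ℝ} {U W F : ℝ → ℝ → ℝ} {p : ℝ → ℝ} {M N B : ℝ}

lemma pressure_nonneg (hd : HalfData Φ fh B) (hs : HalfSol ε Φ fh u0 U W F p M N) :
    ∀ᵐ t : ℝ, 0 < t → ∀ x < 0, 0 ≤ p t + ∫ y in (0:ℝ)..x, W y t := by
  filter_upwards [hs.pressure] with t ht h0 x hx
  have hc : Continuous fun x => -(p t + ∫ y in (0:ℝ)..x, W y t) :=
    (continuous_const.add
      (lipschitzWith_prim (hs.mW.of_uncurry_right (y := t)) (fun y => hs.bW y t) 0).continuous).neg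
  have := le_of_ae_le_of_continuous hc (b := 0) (c := 0) ?_ hx
  · linarith
  · filter_upwards [ht] with y hy hy0
    have h1 := hd.mono (hs.U_mem y t).1
    rw [hd.zero, hy hy0 h0] at h1
    linarith

/-- Where the interface pressure vanishes, the mean flux towards the interface is asymptotically
nonnegative. -/
lemma mean_flux_ge (hd : HalfData Φ fh B) (hs : HalfSol ε Φ fh u0 U W F p M N) (hε : 0 < ε)
    {δ : ℝ} (hδ : 0 < δ) :
    ∀ᶠ m : ℕ in atTop, ∀ᵐ t : ℝ, 0 < t → p t = 0 →
      -δ ≤ (m + 1) * ∫ x in (-(1 / ((m:ℝ) + 1)))..0, F x t := by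
  have hM0 : 0 ≤ M := (abs_nonneg _).trans (hs.bW 0 0)
  obtain ⟨r, hr, hfr⟩ : ∃ r > 0, ∀ v, |v| < r → -δ ≤ fh v := by
    obtain ⟨r, hr, h⟩ := Metric.continuousAt_iff.1 (hd.cont_fh.continuousAt (x := 0)) δ hδ
    refine ⟨r, hr, fun v hv => ?_⟩
    have := h (x := v) (by rwa [Real.dist_eq, sub_zero])
    rw [Real.dist_eq] at this
    linarith [(abs_lt.1 this).1, hd.fh_zero]
  have hsm : ∀ᶠ m : ℕ in atTop, M * (1 / ((m:ℝ) + 1)) < r := by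
    have := (tendsto_one_div_add_atTop_nhds_zero_nat (𝕜 := ℝ)).const_mul M
    rw [mul_zero] at this
    exact this.eventually_lt_const hr
  filter_upwards [hsm] with m hm
  filter_upwards [pressure_nonneg hd hs, hs.flux] with t h1 h2 ht hpt
  have hn : (0:ℝ) < m + 1 := by positivity
  generalize (m:ℝ) + 1 = n at hm hn ⊢
  have hn' : 0 < 1 / n := by positivity
  have hWi := fun a b => intervalIntegrable_of_bdd (hs.mW.of_uncurry_right (y := t))
    (fun y => hs.bW y t) a b
  have hcV : Continuous fun x => p t + ∫ y in (0:ℝ)..x, W y t :=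
    continuous_const.add
      (lipschitzWith_prim (hs.mW.of_uncurry_right (y := t)) (fun y => hs.bW y t) 0).continuous
  have hfi : IntervalIntegrable (fun x => fh (p t + ∫ y in (0:ℝ)..x, W y t)) volume (-(1 / n)) 0 :=
    (hd.cont_fh.comp hcV).intervalIntegrable _ _
  have e1 : ∫ x in (-(1 / n))..0, F x t
      = ∫ x in (-(1 / n))..0, (fh (p t + ∫ y in (0:ℝ)..x, W y t) - ε * W x t) := by
    refine intervalIntegral.integral_congr_ae ?_
    filter_upwards [h2, Measure.ae_ne volume 0] with x hx hx0 hmem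
    rw [uIoc_of_le (by linarith)] at hmem
    exact hx (lt_of_le_of_ne hmem.2 hx0) ht
  rw [e1, intervalIntegral.integral_sub hfi ((hWi _ _).const_mul ε),
    intervalIntegral.integral_const_mul]
  have e2 : 0 ≤ -∫ x in (-(1 / n))..0, W x t := by
    have := h1 ht (-(1 / n)) (by linarith)
    rwa [hpt, zero_add, intervalIntegral.integral_symm] at this
  have e3 : -δ * (1 / n) ≤ ∫ x in (-(1 / n))..0, fh (p t + ∫ y in (0:ℝ)..x, W y t) := by
    have : ∫ x in (-(1 / n))..0, -δ = -δ * (1 / n) := by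
      rw [intervalIntegral.integral_const, smul_eq_mul]; ring
    rw [← this]
    refine intervalIntegral.integral_mono_on (by linarith) intervalIntegrable_const hfi
      fun x hx => hfr _ ?_
    rw [hpt, zero_add]
    refine (abs_intervalIntegral_le (fun y => hs.bW y t) 0 x).trans_lt (lt_of_le_of_lt ?_ hm)
    refine mul_le_mul_of_nonneg_left ?_ hM0
    rw [sub_zero, abs_of_nonpos hx.2]
    linarith [hx.1]
  have e4 := mul_nonneg hε.le e2
  have e5 : n * (-δ * (1 / n)) = -δ := by field_simp
  rw [← e5]
  refine mul_le_mul_of_nonneg_left ?_ hn.le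
  linarith

lemma mean_flux_pressure_ge (hs : HalfSol ε Φ fh u0 U W F p M N) {n : ℝ} (hn : 0 < n) (t : ℝ) :
    p t * (n * ∫ x in (-(1 / n))..0, F x t) - N * M / n
      ≤ n * ∫ x in (-(1 / n))..0, F x t * (p t + ∫ y in (0:ℝ)..x, W y t) := by
  have hM0 : 0 ≤ M := (abs_nonneg _).trans (hs.bW 0 0)
  have hN0 : 0 ≤ N := (abs_nonneg _).trans (hs.bF 0 0)
  have hn' : 0 < 1 / n := by positivity
  have hFi := intervalIntegrable_of_bdd (hs.mF.of_uncurry_right (y := t))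
    (fun y => hs.bF y t) (-(1 / n)) 0
  have hcV : Continuous fun x => ∫ y in (0:ℝ)..x, W y t :=
      (lipschitzWith_prim (hs.mW.of_uncurry_right (y := t)) (fun y => hs.bW y t) 0).continuous
  have e1 : ∫ x in (-(1 / n))..0, F x t * (p t + ∫ y in (0:ℝ)..x, W y t)
      = p t * (∫ x in (-(1 / n))..0, F x t)
        + ∫ x in (-(1 / n))..0, F x t * ∫ y in (0:ℝ)..x, W y t := by
    rw [← intervalIntegral.integral_const_mul, ← intervalIntegral.integral_add
      (hFi.const_mul _) (hFi.mul_continuousOn hcV.continuousOn)]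
    congr 1; ext x; ring
  have e2 : ‖∫ x in (-(1 / n))..0, F x t * ∫ y in (0:ℝ)..x, W y t‖
      ≤ (N * (M * (1 / n))) * |0 - (-(1 / n))| := by
    refine intervalIntegral.norm_integral_le_of_norm_le_const fun x hx => ?_
    rw [uIoc_of_le (by linarith)] at hx
    rw [Real.norm_eq_abs, abs_mul]
    refine mul_le_mul (hs.bF x t) ?_ (abs_nonneg _) hN0
    refine (abs_intervalIntegral_le (fun y => hs.bW y t) 0 x).trans ?_
    refine mul_le_mul_of_nonneg_left ?_ hM0
    rw [sub_zero, abs_of_nonpos hx.2]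
    linarith [hx.1]
  rw [zero_sub, neg_neg, abs_of_pos hn'] at e2
  have e3 := mul_le_mul_of_nonneg_left (neg_le_of_abs_le e2) hn.le
  have e4 : n * -(N * (M * (1 / n)) * (1 / n)) = -(N * M / n) := by field_simp
  rw [e4] at e3
  rw [e1, mul_add]
  linarith

variable {Φ' fh' u0' : ℝ → ℝ} {U' W' F' : ℝ → ℝ → ℝ} {p' : ℝ → ℝ} {M' B' : ℝ}

lemma interface_ineq {a b l r P P' δ : ℝ} (ha : a ∈ Icc 0 P) (hb : b ∈ Icc 0 P') (hδ : 0 < δ)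
    (hl : a = 0 → -δ ≤ l) (hr : b = 0 → -δ ≤ r) (hab : a = 0 ∨ b = 0) :
    (a - b) * (l - r) - (P + P') * δ ≤ a * l + b * r := by
  obtain ⟨ha0, haP⟩ := ha
  obtain ⟨hb0, hbP⟩ := hb
  rcases hab with rfl | rfl
  · have := hl rfl
    nlinarith
  · have := hr rfl
    nlinarith

lemma boundary_term_ge (hd : HalfData Φ fh B) (hs : HalfSol ε Φ fh u0 U W F p M N)
    (hd' : HalfData Φ' fh' B')
    (hs' : HalfSol ε Φ' fh' u0' U' W' (fun x t => F (-x) t) p' M' N) (hε : 0 < ε)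
    (hp : ∀ᵐ t : ℝ, 0 < t → p t = 0 ∨ p' t = 0)
    {V : ℝ → ℝ → ℝ} (hV : ∀ x t, V x t ∈ Icc (0:ℝ) 1)
    (hbal : ∀ h : ℝ, ∃ c : ℝ → ℝ, ∀ᵐ t : ℝ, ∀ᵐ x : ℝ, ∫ s in (t - h)..t, F x s
      = c t - ∫ y in (0:ℝ)..x, (V y t - V y (t - h)))
    {T : ℝ} (hT : 0 < T) {δ : ℝ} (hδ : 0 < δ) :
    ∀ᶠ m : ℕ in atTop, -δ ≤
      (∫ t in (0:ℝ)..T, (m + 1) * ∫ x in (-(1 / ((m:ℝ) + 1)))..0,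
          F x t * (p t + ∫ y in (0:ℝ)..x, W y t))
        + ∫ t in (0:ℝ)..T, (m + 1) * ∫ x in (-(1 / ((m:ℝ) + 1)))..0,
          F (-x) t * (p' t + ∫ y in (0:ℝ)..x, W' y t) := by
  have hN0 : 0 ≤ N := (abs_nonneg _).trans (hs.bF 0 0)
  have hP : 0 ≤ Φ 1 := (hs.p_mem 0).1.trans (hs.p_mem 0).2
  have hP' : 0 ≤ Φ' 1 := (hs'.p_mem 0).1.trans (hs'.p_mem 0).2
  have hθ : Measurable fun t => p t - p' t := hs.mp.sub hs'.mp
  have hθb : ∀ t, |p t - p' t| ≤ Φ 1 + Φ' 1 := fun t => abs_le.2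
    ⟨by linarith [(hs.p_mem t).1, (hs'.p_mem t).2],
     by linarith [(hs.p_mem t).2, (hs'.p_mem t).1]⟩
  set δ₀ := δ / (3 * (T * (Φ 1 + Φ' 1) + 1)) with hδ₀
  have hpos : 0 < T * (Φ 1 + Φ' 1) + 1 := by positivity
  have hδ₀p : 0 < δ₀ := by positivity
  have hδ₀T : T * (Φ 1 + Φ' 1) * δ₀ ≤ δ / 3 := by
    rw [hδ₀, mul_div_assoc', div_le_div_iff₀ (by positivity) (by norm_num)]
    nlinarith
  have hlim := tendsto_integral_mul_fluxJump hs.mF hV hs.bF hs.F_init hbal hT.le hθ hθb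
  have hsm1 := hlim.eventually_const_lt (show -(δ / 3) < 0 by linarith)
  have hsm2 : ∀ᶠ m : ℕ in atTop, (T * (N * M + N * M')) * (1 / ((m:ℝ) + 1)) < δ / 3 := by
    have := (tendsto_one_div_add_atTop_nhds_zero_nat (𝕜 := ℝ)).const_mul (T * (N * M + N * M'))
    rw [mul_zero] at this
    exact this.eventually_lt_const (by positivity)
  filter_upwards [hsm1, hsm2, mean_flux_ge hd hs hε hδ₀p, mean_flux_ge hd' hs' hε hδ₀p]
    with m h1 h2 h3 h4
  have hn : (0:ℝ) < m + 1 := by positivity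
  generalize (m:ℝ) + 1 = n at h1 h2 h3 h4 hn ⊢
  have i1 : IntervalIntegrable (fun t => ∫ x in (-(1 / n))..0,
      F x t * (p t + ∫ y in (0:ℝ)..x, W y t)) volume 0 T := by
    refine intervalIntegrable_param (M := N * (Φ 1 + M * |-(1 / n)|)) (measurable_flux_pressure hs)
      (fun t x hx => ?_) 0 T
    rw [abs_mul]
    exact mul_le_mul (hs.bF x t) (abs_pressure_le hs t hx) (abs_nonneg _) hN0
  have i2 : IntervalIntegrable (fun t => ∫ x in (-(1 / n))..0,
      F (-x) t * (p' t + ∫ y in (0:ℝ)..x, W' y t)) volume 0 T := by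
    refine intervalIntegrable_param (M := N * (Φ' 1 + M' * |-(1 / n)|))
      (measurable_flux_pressure hs') (fun t x hx => ?_) 0 T
    rw [abs_mul]
    exact mul_le_mul (hs'.bF x t) (abs_pressure_le hs' t hx) (abs_nonneg _) hN0
  have i3 : IntervalIntegrable (fun t => (p t - p' t) * fluxJump F n t) volume 0 T := by
    refine intervalIntegrable_of_bdd (M := (Φ 1 + Φ' 1) * (2 * N))
      (hθ.mul (measurable_fluxJump hs.mF n)) (fun t => ?_) 0 T
    rw [Pi.mul_apply, abs_mul]
    exact mul_le_mul (hθb t) (abs_fluxJump_le hs.bF hn t) (abs_nonneg _) (by positivity)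
  have key : ∫ t in (0:ℝ)..T, ((p t - p' t) * fluxJump F n t
        - ((Φ 1 + Φ' 1) * δ₀ + N * M / n + N * M' / n)) ≤
      ∫ t in (0:ℝ)..T, (n * (∫ x in (-(1 / n))..0, F x t * (p t + ∫ y in (0:ℝ)..x, W y t))
        + n * ∫ x in (-(1 / n))..0, F (-x) t * (p' t + ∫ y in (0:ℝ)..x, W' y t)) := by
    rw [intervalIntegral.integral_of_le hT.le, intervalIntegral.integral_of_le hT.le]
    refine integral_mono_ae (i3.sub intervalIntegrable_const).1
      ((i1.const_mul n).add (i2.const_mul n)).1 ?_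
    rw [EventuallyLE, ae_restrict_iff' measurableSet_Ioc]
    filter_upwards [hp, h3, h4] with t hpt ht3 ht4 hmem
    have e1 := mean_flux_pressure_ge hs hn t
    have e2 := mean_flux_pressure_ge hs' hn t
    have e3 := interface_ineq (hs.p_mem t) (hs'.p_mem t) hδ₀p (ht3 hmem.1) (ht4 hmem.1)
      (hpt hmem.1)
    have e4 : fluxJump F n t = n * (∫ x in (-(1 / n))..0, F x t)
        - n * ∫ x in (-(1 / n))..0, F (-x) t := by
      rw [fluxJump, intervalIntegral.integral_sub, mul_sub]
      · exact intervalIntegrable_of_bdd (hs.mF.of_uncurry_right (y := t)) (fun y => hs.bF y t) _ _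
      · exact intervalIntegrable_of_bdd (hs'.mF.of_uncurry_right (y := t))
          (fun y => hs'.bF y t) _ _
    simp only [e4]
    linarith
  rw [intervalIntegral.integral_sub i3 intervalIntegrable_const, intervalIntegral.integral_const,
    sub_zero, smul_eq_mul,
    intervalIntegral.integral_add (i1.const_mul n) (i2.const_mul n)] at key
  have e5 : T * ((Φ 1 + Φ' 1) * δ₀ + N * M / n + N * M' / n)
      = T * (Φ 1 + Φ' 1) * δ₀ + T * (N * M + N * M') * (1 / n) := by ring
  rw [e5] at key
  linarith
end

section
variable {ε : ℝ} {Φ fh u0 : ℝ → ℝ} {U W F : ℝ → ℝ → ℝ} {p : ℝ → ℝ} {M N B : ℝ}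
  {κ dk : ℝ → ℝ} {D : ℝ}
  {Φ' fh' u0' : ℝ → ℝ} {U' W' : ℝ → ℝ → ℝ} {p' : ℝ → ℝ} {M' B' : ℝ}
  {κ' dk' : ℝ → ℝ} {D' : ℝ}

/-- The bound for the energy dissipated on one side of the interface up to time `T`. -/
def energyBound (Φ u0 κ dk : ℝ → ℝ) (B D T : ℝ) : ℝ :=
  Φ 1 * (∫ x in Iio (0:ℝ), |u0 x - κ x|)
    + T * (3 * B * Φ 1 + 2 * Φ 1 ^ 2 + (B + D / 2) * ∫ x, |dk x|)

lemma dissipation_le (hd : HalfData Φ fh B) (hs : HalfSol ε Φ fh u0 U W F p M N)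
    (hr : RefState Φ u0 κ dk D)
    (hd' : HalfData Φ' fh' B')
    (hs' : HalfSol ε Φ' fh' u0' U' W' (fun x t => F (-x) t) p' M' N)
    (hr' : RefState Φ' u0' κ' dk' D') (hε : 0 < ε) (hε1 : ε < 1)
    (hp : ∀ᵐ t : ℝ, 0 < t → p t = 0 ∨ p' t = 0)
    {V : ℝ → ℝ → ℝ} (hV : ∀ x t, V x t ∈ Icc (0:ℝ) 1)
    (hbal : ∀ h : ℝ, ∃ c : ℝ → ℝ, ∀ᵐ t : ℝ, ∀ᵐ x : ℝ, ∫ s in (t - h)..t, F x s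
      = c t - ∫ y in (0:ℝ)..x, (V y t - V y (t - h)))
    {T : ℝ} (hT : 0 < T)
    (hi : IntegrableOn (fun z : ℝ × ℝ => W z.1 z.2 ^ 2) (Iio 0 ×ˢ Ioc 0 T))
    (hi' : IntegrableOn (fun z : ℝ × ℝ => W' z.1 z.2 ^ 2) (Iio 0 ×ˢ Ioc 0 T)) :
    3 * ε / 8 * ((∫ z in Iio (0:ℝ) ×ˢ Ioc (0:ℝ) T, W z.1 z.2 ^ 2)
        + ∫ z in Iio (0:ℝ) ×ˢ Ioc (0:ℝ) T, W' z.1 z.2 ^ 2)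
      ≤ energyBound Φ u0 κ dk B D T + energyBound Φ' u0' κ' dk' B' D' T := by
  have l1 := tendsto_integral_trap (f := fun z => W z.1 z.2 ^ 2) (hs.mW.pow_const 2)
    (fun z => sq_nonneg _) hT.le hi
  have l2 := tendsto_integral_trap (f := fun z => W' z.1 z.2 ^ 2) (hs'.mW.pow_const 2)
    (fun z => sq_nonneg _) hT.le hi'
  refine le_of_forall_pos_le_add fun δ hδ => ?_
  have key := le_of_tendsto ((l1.add l2).const_mul (ε / 2))
    (b := energyBound Φ u0 κ dk B D T + energyBound Φ' u0' κ' dk' B' D' T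
      + ε / 8 * ((∫ z in Iio (0:ℝ) ×ˢ Ioc (0:ℝ) T, W z.1 z.2 ^ 2)
        + ∫ z in Iio (0:ℝ) ×ˢ Ioc (0:ℝ) T, W' z.1 z.2 ^ 2) + δ) ?_
  · linarith
  · filter_upwards [boundary_term_ge hd hs hd' hs' hε hp hV hbal hT hδ] with m hm
    have hn : (1:ℝ) ≤ m + 1 := by simp
    have e1 := integrated_estimate hd hs hr hε hε1 hn hT.le
    have e2 := integrated_estimate hd' hs' hr' hε hε1 hn hT.le
    have e3 := integral_box_le (f := fun z => W z.1 z.2 ^ 2) (fun z => sq_nonneg _) hT.le hi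
      (a := -((m + 1 : ℝ) + 1)) (by linarith)
    have e4 := integral_box_le (f := fun z => W' z.1 z.2 ^ 2) (fun z => sq_nonneg _) hT.le hi'
      (a := -((m + 1 : ℝ) + 1)) (by linarith)
    have e5 := mul_le_mul_of_nonneg_left e3 (show 0 ≤ ε / 8 by positivity)
    have e6 := mul_le_mul_of_nonneg_left e4 (show 0 ≤ ε / 8 by positivity)
    simp only [energyBound]
    linarith
end

lemma exists_measurable_rep {α : Type*} [MeasurableSpace α] {μ : Measure α} {f : α → ℝ}
    (hf : AEMeasurable f μ) {a b : ℝ} (hab : a ≤ b) :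
    ∃ f' : α → ℝ, Measurable f' ∧ (∀ x, f' x ∈ Icc a b) ∧
      ∀ᵐ x ∂μ, f x ∈ Icc a b → f' x = f x := by
  refine ⟨fun x => max a (min b (hf.mk f x)),
    measurable_const.max (measurable_const.min hf.measurable_mk),
    fun x => ⟨le_max_left _ _, max_le hab (min_le_left _ _)⟩, ?_⟩
  filter_upwards [hf.ae_eq_mk] with x hx hmem
  rw [← hx, min_eq_right hmem.2, max_eq_right hmem.1]

/-- Projection onto `[0,1]`. -/
def clip (s : ℝ) : ℝ := max 0 (min 1 s)

lemma clip_mem (s : ℝ) : clip s ∈ Icc (0:ℝ) 1 :=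
  ⟨le_max_left _ _, max_le zero_le_one (min_le_left _ _)⟩

lemma clip_of_mem {s : ℝ} (hs : s ∈ Icc (0:ℝ) 1) : clip s = s := by
  rw [clip, min_eq_right hs.2, max_eq_right hs.1]

lemma continuous_clip : Continuous clip := by unfold clip; fun_prop

lemma continuous_comp_clip {f : ℝ → ℝ} (hf : ContinuousOn f (Icc 0 1)) :
    Continuous fun s => f (clip s) := hf.comp_continuous continuous_clip clip_mem

/-- The capillary pressure associated with `g`, extended to the real line. -/
def pressureFun (Cc : ℝ) (g : ℝ → ℝ) (s : ℝ) : ℝ := Cc * ∫ r in (0:ℝ)..s, g (clip r)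

section pressureFun
variable {Cc : ℝ} {g : ℝ → ℝ}

lemma pressureFun_zero : pressureFun Cc g 0 = 0 := by simp [pressureFun]

lemma pressureFun_eq {s : ℝ} (hs : s ∈ Icc (0:ℝ) 1) :
    pressureFun Cc g s = Cc * ∫ r in (0:ℝ)..s, g r := by
  rw [pressureFun]
  congr 1
  refine intervalIntegral.integral_congr fun r hr => ?_
  rw [uIcc_of_le hs.1] at hr
  simp only [clip_of_mem ⟨hr.1, hr.2.trans hs.2⟩]

lemma hasDerivAt_pressureFun (hg : ContinuousOn g (Icc 0 1)) (s : ℝ) :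
    HasDerivAt (pressureFun Cc g) (Cc * g (clip s)) s :=
  ((continuous_comp_clip hg).integral_hasStrictDerivAt 0 s).hasDerivAt.const_mul Cc

lemma continuous_pressureFun (hg : ContinuousOn g (Icc 0 1)) : Continuous (pressureFun Cc g) :=
  continuous_iff_continuousAt.2 fun s => (hasDerivAt_pressureFun hg s).continuousAt

lemma monotone_pressureFun (hC : 0 < Cc) (hg : ContinuousOn g (Icc 0 1))
    (h0 : ∀ s ∈ Icc (0:ℝ) 1, 0 ≤ g s) : Monotone (pressureFun Cc g) :=
  monotone_of_hasDerivAt_nonneg (hasDerivAt_pressureFun hg)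
    fun s => mul_nonneg hC.le (h0 _ (clip_mem s))

lemma strictMonoOn_pressureFun (hC : 0 < Cc) (hg : ContinuousOn g (Icc 0 1))
    (h0 : ∀ s ∈ Ioo (0:ℝ) 1, 0 < g s) : StrictMonoOn (pressureFun Cc g) (Icc 0 1) := by
  refine strictMonoOn_of_deriv_pos (convex_Icc 0 1) (continuous_pressureFun hg).continuousOn
    fun s hs => ?_
  rw [interior_Icc] at hs
  rw [(hasDerivAt_pressureFun hg s).deriv, clip_of_mem (Ioo_subset_Icc_self hs)]
  exact mul_pos hC (h0 s hs)

end pressureFun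

lemma exists_flux_function {Φ f : ℝ → ℝ} (hΦ : Continuous Φ) (hm : StrictMonoOn Φ (Icc 0 1))
    (hf : ContinuousOn f (Icc 0 1)) :
    ∃ (fh : ℝ → ℝ) (B : ℝ), Continuous fh ∧ (∀ v, |fh v| ≤ B) ∧
      ∀ s ∈ Icc (0:ℝ) 1, fh (Φ s) = f s := by
  have he : Topology.IsClosedEmbedding (fun s : Icc (0:ℝ) 1 => Φ s) :=
    (hΦ.comp continuous_subtype_val).isClosedEmbedding fun a b hab =>
      Subtype.ext (hm.injOn a.2 b.2 hab)
  let f0 : BoundedContinuousFunction (Icc (0:ℝ) 1) ℝ :=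
    BoundedContinuousFunction.mkOfCompact ⟨fun s => f s, hf.domRestrict⟩
  obtain ⟨fh, -, h⟩ := f0.exists_extension_norm_eq_of_isClosedEmbedding he
  exact ⟨fh, ‖fh‖, fh.continuous, fun v => fh.norm_coe_le_norm v, fun s hs => congrFun h ⟨s, hs⟩⟩

lemma hasDerivAt_clip_neg {x : ℝ} (h1 : x ≠ -1) (h2 : x ≠ -2) :
    HasDerivAt (fun x => clip (-x - 1)) ((Ioo (-2:ℝ) (-1)).indicator (fun _ => -1) x) x := by
  rcases lt_or_gt_of_ne h1 with h1 | h1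
  · rcases lt_or_gt_of_ne h2 with h2 | h2
    · rw [indicator_of_notMem (fun h : x ∈ Ioo (-2:ℝ) (-1) => absurd h.1 (by linarith))]
      refine (hasDerivAt_const x (1:ℝ)).congr_of_eventuallyEq ?_
      filter_upwards [Iio_mem_nhds h2] with y hy
      have : y < -2 := hy
      rw [clip, min_eq_left (by linarith), max_eq_right zero_le_one]
    · rw [indicator_of_mem (show x ∈ Ioo (-2:ℝ) (-1) from ⟨h2, h1⟩)]
      refine ((hasDerivAt_id x).neg.sub_const 1).congr_of_eventuallyEq ?_
      filter_upwards [Ioo_mem_nhds h2 h1] with y hy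
      rw [clip_of_mem ⟨by linarith [hy.2], by linarith [hy.1]⟩]
      rfl
  · rw [indicator_of_notMem (fun h : x ∈ Ioo (-2:ℝ) (-1) => absurd h.2 (by linarith))]
    refine (hasDerivAt_const x (0:ℝ)).congr_of_eventuallyEq ?_
    filter_upwards [Ioi_mem_nhds h1] with y hy
    have : -1 < y := hy
    rw [clip, max_eq_left]
    exact (min_le_right _ _).trans (by linarith)

lemma abs_clip_sub_le (a b : ℝ) : |clip a - clip b| ≤ |a - b| := by
  have h1 : |clip a - clip b| ≤ |min 1 a - min 1 b| := by
    simpa [clip] using abs_max_sub_max_le_max 0 (min 1 a) 0 (min 1 b)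
  have h2 : |min 1 a - min 1 b| ≤ |a - b| := by
    simpa using abs_min_sub_min_le_max 1 a 1 b
  exact h1.trans h2

lemma exists_refState {Φ ψ u0 v dv : ℝ → ℝ} (hΦ : ∀ s, HasDerivAt Φ (ψ s) s)
    (hψ : Continuous ψ) {G : ℝ} (hG : ∀ s, |ψ s| ≤ G) {K : NNReal} (hv : LipschitzWith K v)
    (hv1 : ∀ x, v x ∈ Icc (0:ℝ) 1) (hdv : Measurable dv) {A : ℝ} (hA : ∀ x, |dv x| ≤ A)
    (hi : Integrable dv) (hder : ∀ᵐ x, HasDerivAt v (dv x) x)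
    (hsub : Integrable fun x => u0 x - v x) :
    ∃ (κ dk : ℝ → ℝ) (D : ℝ), 0 ≤ D ∧ RefState Φ u0 κ dk D := by
  have hG0 : 0 ≤ G := (abs_nonneg _).trans (hG 0)
  have hA0 : 0 ≤ A := (abs_nonneg _).trans (hA 0)
  have hχc : Continuous fun x : ℝ => clip (-x - 1) := continuous_clip.comp (by fun_prop)
  have hκc : Continuous fun x => clip (-x - 1) * v x := hχc.mul hv.continuous
  have hκmem : ∀ x, clip (-x - 1) * v x ∈ Icc (0:ℝ) 1 := fun x =>
    ⟨mul_nonneg (clip_mem _).1 (hv1 x).1, mul_le_one₀ (clip_mem _).2 (hv1 x).1 (hv1 x).2⟩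
  set dχ : ℝ → ℝ := (Ioo (-2:ℝ) (-1)).indicator (fun _ => -1) with hdχ
  have hdχm : Measurable dχ := measurable_const.indicator measurableSet_Ioo
  have hdχb : ∀ x, |dχ x| ≤ 1 := fun x => by
    rw [hdχ]; by_cases hx : x ∈ Ioo (-2:ℝ) (-1)
    · rw [indicator_of_mem hx]; simp
    · rw [indicator_of_notMem hx]; simp
  have hdχi : Integrable dχ := by
    rw [hdχ, integrable_indicator_iff measurableSet_Ioo]
    exact integrableOn_const (by simp)
  have hdκm : Measurable fun x => dχ x * v x + clip (-x - 1) * dv x :=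
    (hdχm.mul hv.continuous.measurable).add (hχc.measurable.mul hdv)
  have hdκb : ∀ x, |dχ x * v x + clip (-x - 1) * dv x| ≤ 1 + A := fun x => by
    refine (abs_add_le _ _).trans ?_
    rw [abs_mul, abs_mul, abs_of_nonneg (hv1 x).1, abs_of_nonneg (clip_mem _).1]
    refine add_le_add ?_ ?_
    · exact mul_le_one₀ (hdχb x) (hv1 x).1 (hv1 x).2
    · calc _ ≤ 1 * A := mul_le_mul (clip_mem _).2 (hA x) (abs_nonneg _) zero_le_one
        _ = A := one_mul A
  have hdκi : Integrable fun x => dχ x * v x + clip (-x - 1) * dv x := by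
    refine Integrable.add ?_ ?_
    · refine hdχi.mono (hdχm.mul hv.continuous.measurable).aestronglyMeasurable
        (Eventually.of_forall fun x => ?_)
      rw [norm_mul, Real.norm_of_nonneg (hv1 x).1]
      exact mul_le_of_le_one_right (norm_nonneg _) (hv1 x).2
    · refine hi.mono (hχc.measurable.mul hdv).aestronglyMeasurable
        (Eventually.of_forall fun x => ?_)
      rw [norm_mul, Real.norm_of_nonneg (clip_mem _).1]
      exact mul_le_of_le_one_left (norm_nonneg _) (clip_mem _).2
  have hψκ : Continuous fun x => ψ (clip (-x - 1) * v x) := hψ.comp hκc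
  have hκL : LipschitzWith (1 + K) fun x => clip (-x - 1) * v x := by
    refine LipschitzWith.of_dist_le_mul fun x y => ?_
    have h1 := hv.dist_le_mul x y
    rw [Real.dist_eq] at h1 ⊢
    rw [Real.dist_eq] at h1 ⊢
    have h2 := abs_clip_sub_le (-x - 1) (-y - 1)
    have e : -x - 1 - (-y - 1) = -(x - y) := by ring
    rw [e, abs_neg] at h2
    have e2 : clip (-x - 1) * v x - clip (-y - 1) * v y
        = (clip (-x - 1) - clip (-y - 1)) * v x + clip (-y - 1) * (v x - v y) := by ring
    rw [e2, NNReal.coe_add, NNReal.coe_one, add_mul, one_mul]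
    refine (abs_add_le _ _).trans (add_le_add ?_ ?_)
    · rw [abs_mul, abs_of_nonneg (hv1 x).1]
      exact (mul_le_of_le_one_right (abs_nonneg _) (hv1 x).2).trans h2
    · rw [abs_mul, abs_of_nonneg (clip_mem _).1]
      exact (mul_le_of_le_one_left (abs_nonneg _) (clip_mem _).2).trans h1
  have hΦL : LipschitzWith G.toNNReal Φ := by
    refine lipschitzWith_of_nnnorm_deriv_le (fun s => (hΦ s).differentiableAt) fun s => ?_
    rw [(hΦ s).deriv, ← NNReal.coe_le_coe, coe_nnnorm, Real.coe_toNNReal _ hG0]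
    exact hG s
  refine ⟨fun x => clip (-x - 1) * v x,
    fun x => ψ (clip (-x - 1) * v x) * (dχ x * v x + clip (-x - 1) * dv x), G * (1 + A),
    by positivity, ?_⟩
  constructor
  · exact hκc.measurable
  · exact hκmem
  · intro a b
    refine ACDeriv.of_lipschitzWith (hΦL.comp hκL) ?_
    filter_upwards [hder, Measure.ae_ne volume (-1), Measure.ae_ne volume (-2)] with x hx h1 h2
    exact (hΦ _).comp x ((hasDerivAt_clip_neg h1 h2).mul hx)
  · exact hψκ.measurable.mul hdκm
  · intro x
    rw [abs_mul]
    exact mul_le_mul (hG _) (hdκb x) (abs_nonneg _) hG0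
  · exact hdκi.bdd_mul (c := G) hψκ.aestronglyMeasurable (Eventually.of_forall fun x => hG _)
  · intro x hx
    have : clip (-x - 1) = 0 := max_eq_left ((min_le_right _ _).trans (by linarith))
    rw [this, zero_mul]
  · have h2 : IntegrableOn (fun x => v x - clip (-x - 1) * v x) (Iio 0) := by
      have hI : Integrable ((Icc (-2:ℝ) 0).indicator fun _ => (1:ℝ)) := by
        rw [integrable_indicator_iff measurableSet_Icc]
        exact integrableOn_const (by simp)
      refine hI.integrableOn.mono' (hv.continuous.sub hκc).aestronglyMeasurable ?_
      rw [ae_restrict_iff' measurableSet_Iio]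
      refine Eventually.of_forall fun x hx => ?_
      have hx : x < 0 := hx
      by_cases h : -2 ≤ x
      · rw [indicator_of_mem (show x ∈ Icc (-2:ℝ) 0 from ⟨h, hx.le⟩), Real.norm_eq_abs, abs_le]
        constructor <;> linarith [(hκmem x).1, (hκmem x).2, (hv1 x).1, (hv1 x).2]
      · have : clip (-x - 1) = 1 := by
          rw [clip, min_eq_left (by linarith), max_eq_right zero_le_one]
        rw [this, one_mul, sub_self, norm_zero]
        exact indicator_nonneg (fun _ _ => zero_le_one) _
    refine (hsub.integrableOn.add h2).congr_fun (fun x _ => ?_) measurableSet_Iio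
    simp

lemma exists_lipschitz_rep {v w : ℝ → ℝ} (hvm : AEMeasurable v)
    (hv : ∀ᵐ x : ℝ, v x ∈ Icc (0:ℝ) 1) (hd : IsWeakDeriv v w) (hw1 : Integrable w)
    (hwb : ∃ M : ℝ, ∀ᵐ x : ℝ, |w x| ≤ M) :
    ∃ (v' dv : ℝ → ℝ) (K : NNReal) (A : ℝ), LipschitzWith K v' ∧ (∀ x, v' x ∈ Icc (0:ℝ) 1) ∧
      Measurable dv ∧ (∀ x, |dv x| ≤ A) ∧ Integrable dv ∧ (∀ᵐ x, HasDerivAt v' (dv x) x) ∧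
      v =ᵐ[volume] v' := by
  obtain ⟨M, hM⟩ := hwb
  have hM0 : 0 ≤ M := by
    obtain ⟨x, hx⟩ := hM.exists
    exact (abs_nonneg _).trans hx
  obtain ⟨V, hVm, hV1, hVv⟩ := exists_measurable_rep hvm (zero_le_one (α := ℝ))
  obtain ⟨W, hWm, hW1, hWw⟩ := exists_measurable_rep hw1.aemeasurable (a := -M) (b := M)
    (by linarith)
  have hVv : v =ᵐ[volume] V := by filter_upwards [hVv, hv] with x h1 h2 using (h1 h2).symm
  have hWw : w =ᵐ[volume] W := by
    filter_upwards [hWw, hM] with x h1 h2 using (h1 (abs_le.1 h2)).symm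
  have hWb : ∀ x, |W x| ≤ M := fun x => abs_le.2 (hW1 x)
  obtain ⟨c, hc⟩ := weak_deriv_ae_eq_prim (Ω := univ) isOpen_univ ordConnected_univ
    (locallyIntegrable_of_bdd hVm (M := 1) fun x => abs_le.2 ⟨by linarith [(hV1 x).1], (hV1 x).2⟩)
    hWm hWb (fun ξ h1 h2 _ => by
      have := hd ξ h1 h2
      have e1 : ∫ x, v x * deriv ξ x = ∫ x, V x * deriv ξ x :=
        integral_congr_ae (by filter_upwards [hVv] with x hx; rw [hx])
      have e2 : ∫ x, w x * ξ x = ∫ x, W x * ξ x :=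
        integral_congr_ae (by filter_upwards [hWw] with x hx; rw [hx])
      rwa [e1, e2] at this)
  have hL := lipschitzWith_prim hWm hWb 0
  have hLc : LipschitzWith (0 + M.toNNReal) fun x => c + ∫ y in (0:ℝ)..x, W y :=
    (LipschitzWith.const c).add hL
  have hae : ∀ᵐ x, V x = c + ∫ y in (0:ℝ)..x, W y := hc.mono fun x hx => hx trivial
  refine ⟨_, W, _, M, hLc, fun x => ⟨?_, ?_⟩, hWm, hWb, hw1.congr hWw, ?_, hVv.trans hae⟩
  · have hneg : Continuous fun x => -(c + ∫ y in (0:ℝ)..x, W y) := hLc.continuous.neg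
    have := le_of_ae_le_of_continuous hneg (b := x + 1) (c := 0) ?_ (lt_add_one x)
    · linarith
    · filter_upwards [hae] with y hy _
      rw [← hy]; linarith [(hV1 y).1]
  · refine le_of_ae_le_of_continuous hLc.continuous (b := x + 1) ?_ (lt_add_one x)
    filter_upwards [hae] with y hy _
    rw [← hy]; exact (hV1 y).2
  · filter_upwards [ae_hasDerivAt_prim hWm hWb 0] with x hx using hx.const_add c

lemma halfData_left {Cc q : ℝ} (hC : 0 < Cc) {g c f fh : ℝ → ℝ} {B : ℝ}
    (hg : ContinuousOn g (Icc 0 1)) (hg0 : g 0 = 0) (hgp : ∀ s ∈ Icc (0:ℝ) 1, 0 ≤ g s)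
    (hc0 : c 0 = 0) (hf : ∀ s, f s = q * c s - g s)
    (hfh : Continuous fh) (hB : ∀ v, |fh v| ≤ B)
    (h : ∀ s ∈ Icc (0:ℝ) 1, fh (pressureFun Cc g s) = f s) :
    HalfData (pressureFun Cc g) fh B where
  mono := monotone_pressureFun hC hg hgp
  cont := continuous_pressureFun hg
  zero := pressureFun_zero
  cont_fh := hfh
  bdd_fh := hB
  fh_zero := by
    have := h 0 ⟨le_rfl, zero_le_one⟩
    rw [pressureFun_zero, hf, hc0, hg0] at this
    rw [this]; simp

lemma halfData_right {Cc q : ℝ} (hC : 0 < Cc) (hq : 0 ≤ q) {g c f fh : ℝ → ℝ} {B : ℝ}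
    (hg : ContinuousOn g (Icc 0 1)) (hg1 : g 1 = 0) (hgp : ∀ s ∈ Icc (0:ℝ) 1, 0 ≤ g s)
    (hc1 : c 1 = 1) (hf : ∀ s, f s = q * c s - g s)
    (hfh : Continuous fh) (hB : ∀ v, |fh v| ≤ B)
    (h : ∀ s ∈ Icc (0:ℝ) 1, fh (pressureFun Cc g s) = f s) :
    HalfData (fun s => pressureFun Cc g 1 - pressureFun Cc g (1 - s))
      (fun v => fh (pressureFun Cc g 1 - v)) B where
  mono := fun a b hab => by
    have := monotone_pressureFun hC hg hgp (show 1 - b ≤ 1 - a by linarith)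
    simp only; linarith
  cont := continuous_const.sub ((continuous_pressureFun hg).comp (by fun_prop))
  zero := by simp
  cont_fh := hfh.comp (by fun_prop)
  bdd_fh := fun v => hB _
  fh_zero := by
    have := h 1 ⟨zero_le_one, le_rfl⟩
    rw [hf, hc1, hg1] at this
    simp only [sub_zero]
    rw [this]; linarith

/-- Reference state on the left of the interface. -/
lemma exists_refState_left {Cc : ℝ} {g u0 v dv : ℝ → ℝ} (hg : ContinuousOn g (Icc 0 1))
    {K : NNReal} (hv : LipschitzWith K v) (hv1 : ∀ x, v x ∈ Icc (0:ℝ) 1) (hdv : Measurable dv)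
    {A : ℝ} (hA : ∀ x, |dv x| ≤ A) (hi : Integrable dv) (hder : ∀ᵐ x, HasDerivAt v (dv x) x)
    (hsub : Integrable fun x => u0 x - v x) :
    ∃ (κ dk : ℝ → ℝ) (D : ℝ), 0 ≤ D ∧ RefState (pressureFun Cc g) u0 κ dk D := by
  obtain ⟨G, hG⟩ := isCompact_Icc.exists_bound_of_continuousOn hg
  refine exists_refState (G := |Cc| * G) (hasDerivAt_pressureFun hg)
    (continuous_const.mul (continuous_comp_clip hg)) (fun s => ?_) hv hv1 hdv hA hi hder hsub
  rw [abs_mul]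
  exact mul_le_mul_of_nonneg_left (hG _ (clip_mem s)) (abs_nonneg _)

lemma exists_refState_right {Cc : ℝ} {g u0 v dv : ℝ → ℝ} (hg : ContinuousOn g (Icc 0 1))
    {K : NNReal} (hv : LipschitzWith K v) (hv1 : ∀ x, v x ∈ Icc (0:ℝ) 1) (hdv : Measurable dv)
    {A : ℝ} (hA : ∀ x, |dv x| ≤ A) (hi : Integrable dv) (hder : ∀ᵐ x, HasDerivAt v (dv x) x)
    (hsub : Integrable fun x => u0 x - v x) :
    ∃ (κ dk : ℝ → ℝ) (D : ℝ), 0 ≤ D ∧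
      RefState (fun s => pressureFun Cc g 1 - pressureFun Cc g (1 - s)) (fun x => 1 - u0 (-x))
        κ dk D := by
  obtain ⟨G, hG⟩ := isCompact_Icc.exists_bound_of_continuousOn hg
  refine exists_refState (G := |Cc| * G) (ψ := fun s => Cc * g (clip (1 - s)))
    (v := fun x => 1 - v (-x)) (dv := fun x => dv (-x)) (K := K) (A := A) (fun s => ?_)
    (continuous_const.mul ((continuous_comp_clip hg).comp (by fun_prop))) (fun s => ?_)
    ?_ ?_ ?_ ?_ ?_ ?_ ?_
  · have h1 := (hasDerivAt_pressureFun (Cc := Cc) hg (1 - s)).comp s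
      ((hasDerivAt_id s).const_sub 1)
    simpa using h1.const_sub (pressureFun Cc g 1)
  · rw [abs_mul]
    exact mul_le_mul_of_nonneg_left (hG _ (clip_mem _)) (abs_nonneg _)
  · refine LipschitzWith.of_dist_le_mul fun x y => ?_
    have := hv.dist_le_mul (-y) (-x)
    rw [Real.dist_eq, Real.dist_eq] at this ⊢
    have e1 : (1 - v (-x) - (1 - v (-y))) = v (-y) - v (-x) := by ring
    have e2 : -y - -x = x - y := by ring
    rwa [e1, ← e2]
  · exact fun x => ⟨by linarith [(hv1 (-x)).2], by linarith [(hv1 (-x)).1]⟩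
  · exact hdv.comp measurable_neg
  · exact fun x => hA _
  · exact hi.comp_neg
  · filter_upwards [ae_neg hder] with x hx
    have := (hx.comp x (hasDerivAt_neg x)).const_sub 1
    simpa using this
  · refine (hsub.comp_neg).neg.congr (Eventually.of_forall fun x => ?_)
    simp

lemma Test.mul {ξ η : ℝ → ℝ} (h1 : ContDiff ℝ (⊤ : ℕ∞) ξ) (h2 : HasCompactSupport ξ)
    (h3 : ContDiff ℝ (⊤ : ℕ∞) η) (h4 : HasCompactSupport η) : Test fun x t => ξ x * η t := by
  refine ⟨(h1.comp contDiff_fst).mul (h3.comp contDiff_snd), ?_⟩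
  refine HasCompactSupport.of_support_subset_isCompact (h2.isCompact.prod h4.isCompact) ?_
  intro p hp
  have hp : ξ p.1 * η p.2 ≠ 0 := hp
  exact ⟨subset_tsupport _ (left_ne_zero_of_mul hp), subset_tsupport _ (right_ne_zero_of_mul hp)⟩

lemma integral_slice {Ω : Set ℝ} (hΩ : MeasurableSet Ω) {v V : ℝ → ℝ → ℝ} {ζ η : ℝ → ℝ}
    (hv : ∀ᵐ t : ℝ, 0 < t → ∀ᵐ x : ℝ, x ∈ Ω → v x t = V x t)
    (hV : ∀ x t, t ≤ 0 → V x t = 0) (hζ : ∀ x ∉ Ω, ζ x = 0) :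
    (∫ t in Ioi (0:ℝ), ∫ x in Ω, v x t * (ζ x * η t)) = ∫ t, (∫ x, V x t * ζ x) * η t := by
  rw [← setIntegral_eq_integral_of_forall_compl_eq_zero (s := Ioi (0:ℝ))
    (f := fun t => (∫ x, V x t * ζ x) * η t)]
  · refine setIntegral_congr_ae measurableSet_Ioi ?_
    filter_upwards [hv] with t ht h0
    rw [← integral_mul_const]
    rw [← setIntegral_eq_integral_of_forall_compl_eq_zero (s := Ω)
      (f := fun x => V x t * ζ x * η t)]
    · refine setIntegral_congr_ae hΩ ?_
      filter_upwards [ht h0] with x hx hxΩ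
      rw [hx hxΩ]; ring
    · intro x hx; simp [hζ x hx]
  · intro t ht
    have : t ≤ 0 := not_lt.1 ht
    simp [hV _ t this]

lemma measurable_timePos {V : ℝ → ℝ → ℝ} (hV : Measurable (Function.uncurry V)) :
    Measurable (Function.uncurry fun x t => if 0 < t then V x t else 0) :=
  Measurable.ite (measurableSet_lt measurable_const measurable_snd) hV measurable_const

lemma abs_timePos_le {V : ℝ → ℝ → ℝ} {K : ℝ} (hK : ∀ x t, |V x t| ≤ K) (x t : ℝ) :
    |if 0 < t then V x t else 0| ≤ K := by
  split_ifs
  · exact hK x t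
  · simpa using (abs_nonneg _).trans (hK x t)

lemma pressure_ae_eq_prim {Ω : Set ℝ} (hΩ : IsOpen Ω) (hoc : OrdConnected Ω) (hne : Ω.Nonempty)
    {v w V W : ℝ → ℝ → ℝ} (hV : Measurable (Function.uncurry V))
    (hW : Measurable (Function.uncurry W)) {K M : ℝ} (hK : ∀ x t, |V x t| ≤ K)
    (hM : ∀ x t, |W x t| ≤ M)
    (hv : ∀ᵐ p : ℝ × ℝ, 0 < p.2 → p.1 ∈ Ω → v p.1 p.2 = V p.1 p.2)
    (hw : ∀ᵐ p : ℝ × ℝ, 0 < p.2 → p.1 ∈ Ω → w p.1 p.2 = W p.1 p.2)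
    (h : IsWeakXDeriv Ω v w) :
    ∃ c : ℝ → ℝ, Measurable c ∧ ∀ᵐ t : ℝ, 0 < t → ∀ᵐ x : ℝ, x ∈ Ω →
      V x t = c t + ∫ y in (0:ℝ)..x, W y t := by
  let V' : ℝ → ℝ → ℝ := fun x t => if 0 < t then V x t else 0
  let W' : ℝ → ℝ → ℝ := fun x t => if 0 < t then W x t else 0
  have hV' : Measurable (Function.uncurry V') := measurable_timePos hV
  have hW' : Measurable (Function.uncurry W') := measurable_timePos hW
  have hvt : ∀ᵐ t : ℝ, 0 < t → ∀ᵐ x : ℝ, x ∈ Ω → v x t = V' x t := by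
    filter_upwards [ae_ae_swap hv] with t ht h0
    filter_upwards [ht] with x hx hxΩ
    simp only [V', if_pos h0]; exact hx h0 hxΩ
  have hwt : ∀ᵐ t : ℝ, 0 < t → ∀ᵐ x : ℝ, x ∈ Ω → w x t = W' x t := by
    filter_upwards [ae_ae_swap hw] with t ht h0
    filter_upwards [ht] with x hx hxΩ
    simp only [W', if_pos h0]; exact hx h0 hxΩ
  obtain ⟨c, hc, hce⟩ := weak_xderiv_ae_eq_prim hΩ hoc hne hV' hW' (abs_timePos_le hK)
    (abs_timePos_le hM) (by
      intro ξ h1 h2 h3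
      have hd : Continuous (deriv ξ) := h1.continuous_deriv (by simp)
      have i1 := h1.continuous.integrable_of_hasCompactSupport h2 (μ := volume)
      have i2 := hd.integrable_of_hasCompactSupport h2.deriv (μ := volume)
      have m1 : Measurable fun t => ∫ x, V' x t * deriv ξ x :=
        measurable_integral_param (f := fun t x => V' x t * deriv ξ x)
          ((hV'.comp measurable_swap).mul (hd.measurable.comp measurable_snd))
      have m2 : Measurable fun t => ∫ x, W' x t * ξ x :=
        measurable_integral_param (f := fun t x => W' x t * ξ x)
          ((hW'.comp measurable_swap).mul (h1.continuous.measurable.comp measurable_snd))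
      have b1 := fun t => abs_integral_mul_le (fun x => abs_timePos_le hK x t) i2
      have b2 := fun t => abs_integral_mul_le (fun x => abs_timePos_le hM x t) i1
      have key := ae_eq_zero_of_integral_contDiff_smul_eq_zero (μ := volume)
        (f := fun t => (∫ x, V' x t * deriv ξ x) + ∫ x, W' x t * ξ x)
        ((locallyIntegrable_of_bdd m1 b1).add (locallyIntegrable_of_bdd m2 b2)) (by
          intro η h5 h6
          have z1 : ∀ x ∉ Ω, ξ x = 0 := fun x hx => image_eq_zero_of_notMem_tsupport
            fun hx' => hx (h3 hx')
          have z2 : ∀ x ∉ Ω, deriv ξ x = 0 := fun x hx => image_eq_zero_of_notMem_tsupport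
            fun hx' => hx (h3 (tsupport_deriv_subset hx'))
          have := h (fun x t => ξ x * η t) (Test.mul h1 h2 h5 h6)
            (fun x t hx => by simp [z1 x hx])
          simp only [deriv_mul_const_field] at this
          rw [integral_slice hΩ.measurableSet hvt (fun x t ht => if_neg (not_lt.2 ht)) z2,
            integral_slice hΩ.measurableSet hwt (fun x t ht => if_neg (not_lt.2 ht)) z1] at this
          have iη := h5.continuous.integrable_of_hasCompactSupport h6 (μ := volume)
          have j1 := iη.bdd_mul (c := _) m1.aestronglyMeasurable
            (Eventually.of_forall fun t => b1 t)
          have j2 := iη.bdd_mul (c := _) m2.aestronglyMeasurable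
            (Eventually.of_forall fun t => b2 t)
          simp only [smul_eq_mul, mul_add]
          rw [integral_add]
          · simp_rw [mul_comm (η _)]
            linarith
          · exact j1.congr (Eventually.of_forall fun t => mul_comm _ _)
          · exact j2.congr (Eventually.of_forall fun t => mul_comm _ _))
      filter_upwards [key] with t ht
      linarith)
  refine ⟨c, hc, ?_⟩
  filter_upwards [ae_ae_swap hce] with t ht h0
  filter_upwards [ht] with x hx hxΩ
  simpa only [V', W', if_pos h0] using hx hxΩ

/-- The trace of the pressure is the pressure of the trace. -/
lemma pressure_trace {Ω : Set ℝ} (hΩ : IsOpen Ω) (h0 : (0:ℝ) ∈ closure Ω) {Φ v V W : ℝ → ℝ}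
    (hΦ : Continuous Φ) (hW : Measurable W) {M : ℝ} (hM : ∀ x, |W x| ≤ M)
    (hV : ∀ x, V x ∈ Icc (0:ℝ) 1) (hv : ∀ᵐ x, x ∈ Ω → v x = V x) {c a : ℝ}
    (hc : ∀ᵐ x, x ∈ Ω → Φ (V x) = c + ∫ y in (0:ℝ)..x, W y)
    (ha : Tendsto v (nhdsWithin 0 Ω) (nhds a)) : a ∈ Icc (0:ℝ) 1 ∧ c = Φ a := by
  have hdense := Measure.dense_of_ae (hv.and hc)
  let S : Set ℝ := Ω ∩ {x | (x ∈ Ω → v x = V x) ∧ (x ∈ Ω → Φ (V x) = c + ∫ y in (0:ℝ)..x, W y)}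
  have hS : (nhdsWithin 0 S).NeBot := by
    rw [← mem_closure_iff_nhdsWithin_neBot]
    exact closure_minimal (hdense.open_subset_closure_inter hΩ) isClosed_closure h0
  have hSΩ : nhdsWithin (0:ℝ) S ≤ nhdsWithin 0 Ω := nhdsWithin_mono _ inter_subset_left
  have ha' : Tendsto V (nhdsWithin 0 S) (nhds a) := by
    refine (ha.mono_left hSΩ).congr' ?_
    filter_upwards [self_mem_nhdsWithin] with x hx using hx.2.1 hx.1
  refine ⟨isClosed_Icc.mem_of_tendsto ha' (Eventually.of_forall hV), ?_⟩
  have hcont : Continuous fun x => c + ∫ y in (0:ℝ)..x, W y :=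
    continuous_const.add (lipschitzWith_prim hW hM 0).continuous
  have l1 : Tendsto (fun x => c + ∫ y in (0:ℝ)..x, W y) (nhdsWithin 0 S) (nhds c) := by
    have := hcont.tendsto 0
    simp only [intervalIntegral.integral_same, add_zero] at this
    exact this.mono_left nhdsWithin_le_nhds
  refine tendsto_nhds_unique l1 (((hΦ.tendsto a).comp ha').congr' ?_)
  filter_upwards [self_mem_nhdsWithin] with x hx using hx.2.2 hx.1

lemma integral_Iio_add_Ioi {f : ℝ → ℝ} (hf : Integrable f) (a : ℝ) :
    (∫ x in Iio a, f x) + ∫ x in Ioi a, f x = ∫ x, f x := by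
  rw [← integral_Iic_eq_integral_Iio,
    intervalIntegral.integral_Iic_add_Ioi hf.integrableOn hf.integrableOn]

lemma weak_form_rep {u G₁ G₂ U F : ℝ → ℝ → ℝ} {u₀ U₀ : ℝ → ℝ}
    (hU : Measurable (Function.uncurry U)) (hF : Measurable (Function.uncurry F)) {K N : ℝ}
    (hK : ∀ x t, |U x t| ≤ K) (hN : ∀ x t, |F x t| ≤ N)
    (hu : ∀ᵐ t : ℝ, 0 < t → ∀ᵐ x : ℝ, u x t = U x t) (hUi : ∀ x t, t ≤ 0 → U x t = U₀ x)
    (hu₀ : u₀ =ᵐ[volume] U₀)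
    (hG₁ : ∀ᵐ t : ℝ, 0 < t → ∀ᵐ x : ℝ, x < 0 → G₁ x t = F x t)
    (hG₂ : ∀ᵐ t : ℝ, 0 < t → ∀ᵐ x : ℝ, 0 < x → G₂ x t = F x t)
    (hF0 : ∀ x t, t ≤ 0 → F x t = 0)
    (h : ∀ ψ : ℝ → ℝ → ℝ, Test ψ →
      (∫ t in Ioi (0:ℝ), ∫ x : ℝ, u x t * deriv (fun s => ψ x s) t) + (∫ x : ℝ, u₀ x * ψ x 0)
      + (∫ t in Ioi (0:ℝ), (∫ x in Iio (0:ℝ), G₁ x t * deriv (fun y => ψ y t) x)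
        + (∫ x in Ioi (0:ℝ), G₂ x t * deriv (fun y => ψ y t) x)) = 0)
    {ξ η : ℝ → ℝ} (h1 : ContDiff ℝ (⊤ : ℕ∞) ξ) (h2 : HasCompactSupport ξ)
    (h3 : ContDiff ℝ (⊤ : ℕ∞) η) (h4 : HasCompactSupport η) :
    (∫ t, (∫ x, U x t * ξ x) * deriv η t) + ∫ t, (∫ x, F x t * deriv ξ x) * η t = 0 := by
  have hd : Continuous (deriv ξ) := h1.continuous_deriv (by simp)
  have hdη : Continuous (deriv η) := h3.continuous_deriv (by simp)
  have i1 := h1.continuous.integrable_of_hasCompactSupport h2 (μ := volume)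
  have i2 := hd.integrable_of_hasCompactSupport h2.deriv (μ := volume)
  have i3 := hdη.integrable_of_hasCompactSupport h4.deriv (μ := volume)
  have key := h (fun x t => ξ x * η t) (Test.mul h1 h2 h3 h4)
  simp only [deriv_mul_const_field, deriv_const_mul_field] at key
  have m1 : Measurable fun t => ∫ x, U x t * ξ x :=
    measurable_integral_param (f := fun t x => U x t * ξ x)
      ((hU.comp measurable_swap).mul (h1.continuous.measurable.comp measurable_snd))
  have b1 := fun t => abs_integral_mul_le (fun x => hK x t) i1
  have j1 : Integrable fun t => (∫ x, U x t * ξ x) * deriv η t :=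
    i3.bdd_mul (c := _) m1.aestronglyMeasurable (Eventually.of_forall fun t => b1 t)
  have e1 : (∫ t in Ioi (0:ℝ), ∫ x : ℝ, u x t * (ξ x * deriv η t))
      = ∫ t in Ioi (0:ℝ), (∫ x, U x t * ξ x) * deriv η t := by
    refine setIntegral_congr_ae measurableSet_Ioi ?_
    filter_upwards [hu] with t ht h0
    rw [← integral_mul_const]
    refine integral_congr_ae ?_
    filter_upwards [ht h0] with x hx
    rw [hx]; ring
  have e2 : (∫ x : ℝ, u₀ x * (ξ x * η 0)) = ∫ t in Iic (0:ℝ), (∫ x, U x t * ξ x) * deriv η t := by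
    have : ∫ t in Iic (0:ℝ), (∫ x, U x t * ξ x) * deriv η t
        = ∫ t in Iic (0:ℝ), (∫ x, U₀ x * ξ x) * deriv η t :=
      setIntegral_congr_fun measurableSet_Iic fun t ht => by
        simp only [fun x => hUi x t ht]
    rw [this, integral_const_mul, h4.integral_Iic_deriv_eq (h3.of_le (by simp)),
      ← integral_mul_const]
    refine integral_congr_ae ?_
    filter_upwards [hu₀] with x hx
    rw [hx]; ring
  have e3 : (∫ t in Ioi (0:ℝ), (∫ x in Iio (0:ℝ), G₁ x t * (deriv ξ x * η t))
        + (∫ x in Ioi (0:ℝ), G₂ x t * (deriv ξ x * η t)))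
      = ∫ t, (∫ x, F x t * deriv ξ x) * η t := by
    rw [← setIntegral_eq_integral_of_forall_compl_eq_zero (s := Ioi (0:ℝ))
      (f := fun t => (∫ x, F x t * deriv ξ x) * η t)]
    · refine setIntegral_congr_ae measurableSet_Ioi ?_
      filter_upwards [hG₁, hG₂] with t ht1 ht2 h0
      have k1 : Integrable fun x => F x t * deriv ξ x * η t :=
        (i2.bdd_mul (c := N) (hF.of_uncurry_right).aestronglyMeasurable
          (Eventually.of_forall fun x => hN x t)).mul_const _
      rw [← integral_mul_const, ← integral_Iio_add_Ioi k1 0]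
      congr 1
      · refine setIntegral_congr_ae measurableSet_Iio ?_
        filter_upwards [ht1 h0] with x hx hx0
        rw [hx hx0]; ring
      · refine setIntegral_congr_ae measurableSet_Ioi ?_
        filter_upwards [ht2 h0] with x hx hx0
        rw [hx hx0]; ring
    · intro t ht
      have : t ≤ 0 := not_lt.1 ht
      simp [hF0 _ t this]
  rw [e1, e2, e3] at key
  rw [← intervalIntegral.integral_Iic_add_Ioi j1.integrableOn j1.integrableOn (b := 0)]
  linarith

lemma integral_comp_neg_zero (f : ℝ → ℝ) (x : ℝ) :
    ∫ y in (0:ℝ)..x, f (-y) = -∫ y in (0:ℝ)..(-x), f y := by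
  rw [intervalIntegral.integral_comp_neg, neg_zero, intervalIntegral.integral_symm]

/-- A solution on the half-line `x > 0`, reflected. -/
lemma HalfSol.of_right {ε : ℝ} {Φ fh u0 : ℝ → ℝ} {U W F : ℝ → ℝ → ℝ} {r : ℝ → ℝ} {M N : ℝ}
    (hΦ0 : Φ 0 = 0)
    (mU : Measurable (Function.uncurry U)) (mW : Measurable (Function.uncurry W))
    (mF : Measurable (Function.uncurry F)) (mr : Measurable r)
    (U_mem : ∀ x t, U x t ∈ Icc (0:ℝ) 1) (U_init : ∀ x t, t ≤ 0 → U x t = u0 x)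
    (bW : ∀ x t, |W x t| ≤ M) (bF : ∀ x t, |F x t| ≤ N) (F_init : ∀ x t, t ≤ 0 → F x t = 0)
    (r_mem : ∀ t, r t ∈ Icc 0 (Φ 1))
    (pressure : ∀ᵐ t : ℝ, ∀ᵐ x : ℝ, 0 < x → 0 < t → Φ (U x t) = r t + ∫ y in (0:ℝ)..x, W y t)
    (flux : ∀ᵐ t : ℝ, ∀ᵐ x : ℝ, 0 < x → 0 < t →
      F x t = fh (r t + ∫ y in (0:ℝ)..x, W y t) - ε * W x t)
    (balance : ∀ h : ℝ, ∃ c : ℝ → ℝ, ∀ᵐ t : ℝ, ∀ᵐ x : ℝ, ∫ s in (t - h)..t, F x s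
      = c t - ∫ y in (0:ℝ)..x, (U y t - U y (t - h))) :
    HalfSol ε (fun s => Φ 1 - Φ (1 - s)) (fun v => fh (Φ 1 - v)) (fun x => 1 - u0 (-x))
      (fun x t => 1 - U (-x) t) (fun x t => W (-x) t) (fun x t => F (-x) t)
      (fun t => Φ 1 - r t) M N where
  mU := measurable_const.sub (mU.comp (measurable_fst.neg.prodMk measurable_snd))
  mW := mW.comp (measurable_fst.neg.prodMk measurable_snd)
  mF := mF.comp (measurable_fst.neg.prodMk measurable_snd)
  mp := measurable_const.sub mr
  U_mem x t := ⟨by linarith [(U_mem (-x) t).2], by linarith [(U_mem (-x) t).1]⟩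
  U_init x t ht := by simp only [U_init _ t ht]
  bW x t := bW _ t
  bF x t := bF _ t
  F_init x t ht := F_init _ t ht
  p_mem t := by
    simp only [sub_self, hΦ0, sub_zero]
    exact ⟨by linarith [(r_mem t).2], by linarith [(r_mem t).1]⟩
  pressure := by
    filter_upwards [pressure] with t ht
    filter_upwards [ae_neg ht] with x hx h1 h2
    have := hx (by linarith) h2
    rw [integral_comp_neg_zero (fun y => W y t)]
    simp only [sub_sub_cancel]
    rw [this]; ring
  flux := by
    filter_upwards [flux] with t ht
    filter_upwards [ae_neg ht] with x hx h1 h2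
    rw [integral_comp_neg_zero (fun y => W y t), hx (by linarith) h2]
    congr 2; ring
  balance h := by
    obtain ⟨c, hc⟩ := balance h
    refine ⟨c, ?_⟩
    filter_upwards [hc] with t ht
    filter_upwards [ae_neg ht] with x hx
    rw [hx]
    have : ∫ y in (0:ℝ)..x, (1 - U (-y) t - (1 - U (-y) (t - h)))
        = ∫ y in (0:ℝ)..x, -(fun z => U z t - U z (t - h)) (-y) := by
      congr 1; ext y; ring
    rw [this, intervalIntegral.integral_neg,
      integral_comp_neg_zero (fun z => U z t - U z (t - h))]
    ring

lemma exists_halfSol {ε Cc : ℝ} {g₁ g₂ f₁ f₂ φ₁ φ₂ u₀ U₀ fh₁ fh₂ : ℝ → ℝ} {B₁ B₂ : ℝ}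
    {u w₁ w₂ : ℝ → ℝ → ℝ} (hC : 0 < Cc)
    (hg₁ : ContinuousOn g₁ (Icc 0 1)) (hg₂ : ContinuousOn g₂ (Icc 0 1))
    (hg₁n : ∀ s ∈ Icc (0:ℝ) 1, 0 ≤ g₁ s) (hg₂n : ∀ s ∈ Icc (0:ℝ) 1, 0 ≤ g₂ s)
    (hφ₁ : ∀ s, φ₁ s = Cc * ∫ r in (0:ℝ)..s, g₁ r)
    (hφ₂ : ∀ s, φ₂ s = Cc * ∫ r in (0:ℝ)..s, g₂ r)
    (hfh₁ : Continuous fh₁) (hB₁ : ∀ v, |fh₁ v| ≤ B₁)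
    (hf₁ : ∀ s ∈ Icc (0:ℝ) 1, fh₁ (pressureFun Cc g₁ s) = f₁ s)
    (hfh₂ : Continuous fh₂) (hB₂ : ∀ v, |fh₂ v| ≤ B₂)
    (hf₂ : ∀ s ∈ Icc (0:ℝ) 1, fh₂ (pressureFun Cc g₂ s) = f₂ s)
    (hU₀m : Measurable U₀) (hU₀ : ∀ x, U₀ x ∈ Icc (0:ℝ) 1) (hu₀ : u₀ =ᵐ[volume] U₀)
    (h : IsBFS ε f₁ f₂ φ₁ φ₂ u₀ u w₁ w₂) :
    ∃ (U W₁ W₂ F : ℝ → ℝ → ℝ) (p r : ℝ → ℝ) (M N : ℝ),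
      HalfSol ε (pressureFun Cc g₁) fh₁ U₀ U W₁ F p M N ∧
      HalfSol ε (fun s => pressureFun Cc g₂ 1 - pressureFun Cc g₂ (1 - s))
        (fun v => fh₂ (pressureFun Cc g₂ 1 - v)) (fun x => 1 - U₀ (-x))
        (fun x t => 1 - U (-x) t) (fun x t => W₂ (-x) t) (fun x t => F (-x) t)
        (fun t => pressureFun Cc g₂ 1 - r t) M N ∧
      (∀ᵐ t : ℝ, 0 < t → p t = 0 ∨ pressureFun Cc g₂ 1 - r t = 0) ∧
      (∀ᵐ z : ℝ × ℝ, 0 < z.2 → z.1 ∈ Iio (0:ℝ) → w₁ z.1 z.2 = W₁ z.1 z.2) ∧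
      (∀ᵐ z : ℝ × ℝ, 0 < z.2 → z.1 ∈ Ioi (0:ℝ) → w₂ z.1 z.2 = W₂ z.1 z.2) := by
  obtain ⟨hum, hub, hx₁, hx₂, hw₁m, hw₂m, ⟨M, hM⟩, -, htr, hweak⟩ := h
  obtain ⟨Ur, hUr, hUr1, hUru⟩ := exists_measurable_rep hum (zero_le_one (α := ℝ))
  obtain ⟨Wr₁, hWr₁, hWr₁b, hWr₁w⟩ := exists_measurable_rep hw₁m (a := -|M|) (b := |M|)
    (by linarith [abs_nonneg M])
  obtain ⟨Wr₂, hWr₂, hWr₂b, hWr₂w⟩ := exists_measurable_rep hw₂m (a := -|M|) (b := |M|)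
    (by linarith [abs_nonneg M])
  set Φ₁ := pressureFun Cc g₁ with hΦ₁
  set Φ₂ := pressureFun Cc g₂ with hΦ₂
  have cΦ₁ : Continuous Φ₁ := continuous_pressureFun hg₁
  have cΦ₂ : Continuous Φ₂ := continuous_pressureFun hg₂
  have mΦ₁ : Monotone Φ₁ := monotone_pressureFun hC hg₁ hg₁n
  have mΦ₂ : Monotone Φ₂ := monotone_pressureFun hC hg₂ hg₂n
  have zΦ₁ : Φ₁ 0 = 0 := pressureFun_zero
  have zΦ₂ : Φ₂ 0 = 0 := pressureFun_zero
  have pΦ₁ : 0 ≤ Φ₁ 1 := zΦ₁ ▸ mΦ₁ zero_le_one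
  have pΦ₂ : 0 ≤ Φ₂ 1 := zΦ₂ ▸ mΦ₂ zero_le_one
  let U : ℝ → ℝ → ℝ := fun x t => if 0 < t then Ur (x, t) else U₀ x
  let W₁ : ℝ → ℝ → ℝ := fun x t => Wr₁ (x, t)
  let W₂ : ℝ → ℝ → ℝ := fun x t => Wr₂ (x, t)
  let F : ℝ → ℝ → ℝ := fun x t => if 0 < t then
    (if x < 0 then fh₁ (Φ₁ (U x t)) - ε * W₁ x t else fh₂ (Φ₂ (U x t)) - ε * W₂ x t) else 0
  have mU : Measurable (Function.uncurry U) :=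
    Measurable.ite (measurableSet_lt measurable_const measurable_snd) hUr
      (hU₀m.comp measurable_fst)
  have U_mem : ∀ x t, U x t ∈ Icc (0:ℝ) 1 := by
    intro x t; simp only [U]; split_ifs
    · exact hUr1 _
    · exact hU₀ x
  have U_init : ∀ x t, t ≤ 0 → U x t = U₀ x := fun x t ht => if_neg (not_lt.2 ht)
  have bU : ∀ x t, |U x t| ≤ 1 := fun x t =>
    abs_le.2 ⟨by linarith [(U_mem x t).1], (U_mem x t).2⟩
  have mW₁ : Measurable (Function.uncurry W₁) := hWr₁
  have mW₂ : Measurable (Function.uncurry W₂) := hWr₂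
  have bW₁ : ∀ x t, |W₁ x t| ≤ |M| := fun x t => abs_le.2 (hWr₁b _)
  have bW₂ : ∀ x t, |W₂ x t| ≤ |M| := fun x t => abs_le.2 (hWr₂b _)
  have mF : Measurable (Function.uncurry F) := by
    refine Measurable.ite (measurableSet_lt measurable_const measurable_snd) ?_ measurable_const
    refine Measurable.ite (measurableSet_lt measurable_fst measurable_const) ?_ ?_
    · exact ((hfh₁.comp cΦ₁).measurable.comp mU).sub (mW₁.const_mul ε)
    · exact ((hfh₂.comp cΦ₂).measurable.comp mU).sub (mW₂.const_mul ε)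
  have bF : ∀ x t, |F x t| ≤ max B₁ B₂ + |ε| * |M| := by
    intro x t
    have hb : ∀ {a b C : ℝ}, |a| ≤ C → C ≤ max B₁ B₂ → |b| ≤ |M| →
        |a - ε * b| ≤ max B₁ B₂ + |ε| * |M| := fun h1 h2 h3 =>
      (abs_sub _ _).trans (add_le_add (h1.trans h2)
        ((abs_mul _ _).trans_le (mul_le_mul_of_nonneg_left h3 (abs_nonneg _))))
    simp only [F]
    split_ifs
    · exact hb (hB₁ _) (le_max_left _ _) (bW₁ x t)
    · exact hb (hB₂ _) (le_max_right _ _) (bW₂ x t)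
    · rw [abs_zero]
      have := (abs_nonneg _).trans (hB₁ 0)
      have := le_max_left B₁ B₂
      positivity
  have F_init : ∀ x t, t ≤ 0 → F x t = 0 := fun x t ht => if_neg (not_lt.2 ht)
  have hu : ∀ᵐ z : ℝ × ℝ, 0 < z.2 → u z.1 z.2 = U z.1 z.2 := by
    filter_upwards [hUru, hub] with z h1 h2 h0
    simp only [U, if_pos h0]
    exact (h1 (h2 h0)).symm
  have hw₁ : ∀ᵐ z : ℝ × ℝ, 0 < z.2 → z.1 ∈ Iio (0:ℝ) → w₁ z.1 z.2 = W₁ z.1 z.2 := by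
    filter_upwards [hWr₁w, hM] with z h1 h2 h0 hz
    exact (h1 (abs_le.1 (((h2 h0).1 hz).trans (le_abs_self M)))).symm
  have hw₂ : ∀ᵐ z : ℝ × ℝ, 0 < z.2 → z.1 ∈ Ioi (0:ℝ) → w₂ z.1 z.2 = W₂ z.1 z.2 := by
    filter_upwards [hWr₂w, hM] with z h1 h2 h0 hz
    exact (h1 (abs_le.1 (((h2 h0).2 hz).trans (le_abs_self M)))).symm
  have hut : ∀ᵐ t : ℝ, 0 < t → ∀ᵐ x : ℝ, u x t = U x t := by
    filter_upwards [ae_ae_swap hu] with t ht h0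
    filter_upwards [ht] with x hx using hx h0
  have bΦ : ∀ {Φ : ℝ → ℝ}, Monotone Φ → Φ 0 = 0 → ∀ x t, |Φ (U x t)| ≤ Φ 1 := by
    intro Φ hm h0 x t
    have h1 := hm (U_mem x t).1
    have h2 := hm (U_mem x t).2
    exact abs_le.2 ⟨by linarith, h2⟩
  obtain ⟨c₁, mc₁, hc₁⟩ := pressure_ae_eq_prim isOpen_Iio ordConnected_Iio nonempty_Iio
    (V := fun x t => Φ₁ (U x t)) (cΦ₁.measurable.comp mU) mW₁ (bΦ mΦ₁ zΦ₁) bW₁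
    (by
      filter_upwards [hu] with z hz h0 _
      rw [hz h0, hφ₁, hΦ₁, pressureFun_eq (U_mem _ _)]) hw₁ hx₁
  obtain ⟨c₂, mc₂, hc₂⟩ := pressure_ae_eq_prim isOpen_Ioi ordConnected_Ioi nonempty_Ioi
    (V := fun x t => Φ₂ (U x t)) (cΦ₂.measurable.comp mU) mW₂ (bΦ mΦ₂ zΦ₂) bW₂
    (by
      filter_upwards [hu] with z hz h0 _
      rw [hz h0, hφ₂, hΦ₂, pressureFun_eq (U_mem _ _)]) hw₂ hx₂
  have htrace : ∀ᵐ t : ℝ, 0 < t → ∃ a ∈ Icc (0:ℝ) 1, ∃ b ∈ Icc (0:ℝ) 1,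
      c₁ t = Φ₁ a ∧ c₂ t = Φ₂ b ∧ a * (1 - b) = 0 := by
    filter_upwards [htr, hut, hc₁, hc₂] with t ht hux h1 h2 h0
    obtain ⟨a, b, ha, hb, hab⟩ := ht h0
    obtain ⟨ha1, ha2⟩ := pressure_trace isOpen_Iio (by simp) cΦ₁
      (mW₁.of_uncurry_right (y := t)) (fun x => bW₁ x t) (fun x => U_mem x t)
      ((hux h0).mono fun x hx _ => hx) (h1 h0) ha
    obtain ⟨hb1, hb2⟩ := pressure_trace isOpen_Ioi (by simp) cΦ₂
      (mW₂.of_uncurry_right (y := t)) (fun x => bW₂ x t) (fun x => U_mem x t)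
      ((hux h0).mono fun x hx _ => hx) (h2 h0) hb
    exact ⟨a, ha1, b, hb1, ha2, hb2, hab⟩
  let p : ℝ → ℝ := fun t => max 0 (min (Φ₁ 1) (c₁ t))
  let r : ℝ → ℝ := fun t => max 0 (min (Φ₂ 1) (c₂ t))
  have hpc : ∀ {Φ : ℝ → ℝ}, Monotone Φ → Φ 0 = 0 → ∀ a ∈ Icc (0:ℝ) 1,
      max 0 (min (Φ 1) (Φ a)) = Φ a := fun hm h0 a ha => by
    rw [min_eq_right (hm ha.2), max_eq_right (h0 ▸ hm ha.1)]
  have hp : ∀ᵐ t : ℝ, 0 < t → p t = c₁ t ∧ r t = c₂ t ∧ (p t = 0 ∨ Φ₂ 1 - r t = 0) := by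
    filter_upwards [htrace] with t ht h0
    obtain ⟨a, ha, b, hb, e1, e2, hab⟩ := ht h0
    have k1 : p t = Φ₁ a := by simp only [p, e1]; exact hpc mΦ₁ zΦ₁ a ha
    have k2 : r t = Φ₂ b := by simp only [r, e2]; exact hpc mΦ₂ zΦ₂ b hb
    refine ⟨k1.trans e1.symm, k2.trans e2.symm, ?_⟩
    rcases mul_eq_zero.1 hab with h | h
    · left; rw [k1, h, zΦ₁]
    · right; rw [k2, ← sub_eq_zero.1 h, sub_self]
  have hpr₁ : ∀ᵐ t : ℝ, ∀ᵐ x : ℝ, x < 0 → 0 < t →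
      Φ₁ (U x t) = p t + ∫ y in (0:ℝ)..x, W₁ y t := by
    filter_upwards [hc₁, hp] with t h1 h2
    by_cases h0 : 0 < t
    · filter_upwards [h1 h0] with x hx hx0 _
      rw [hx hx0, (h2 h0).1]
    · exact Eventually.of_forall fun x _ h => absurd h h0
  have hpr₂ : ∀ᵐ t : ℝ, ∀ᵐ x : ℝ, 0 < x → 0 < t →
      Φ₂ (U x t) = r t + ∫ y in (0:ℝ)..x, W₂ y t := by
    filter_upwards [hc₂, hp] with t h1 h2
    by_cases h0 : 0 < t
    · filter_upwards [h1 h0] with x hx hx0 _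
      rw [hx hx0, (h2 h0).2.1]
    · exact Eventually.of_forall fun x _ h => absurd h h0
  have hbal : ∀ h : ℝ, ∃ c : ℝ → ℝ, ∀ᵐ t : ℝ, ∀ᵐ x : ℝ, ∫ s in (t - h)..t, F x s
      = c t - ∫ y in (0:ℝ)..x, (U y t - U y (t - h)) := by
    intro h
    obtain ⟨c, -, hc⟩ := flux_increment mU mF bU bF (fun ξ η h1 h2 h3 h4 =>
      weak_form_rep mU mF bU bF hut U_init hu₀ (by
        filter_upwards [hut, ae_ae_swap hw₁] with t ht1 ht2 h0
        filter_upwards [ht1 h0, ht2] with x hx1 hx2 hx0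
        simp only [F, if_pos h0, if_pos hx0]
        rw [hf₁ _ (U_mem x t), hx1, hx2 h0 hx0]) (by
        filter_upwards [hut, ae_ae_swap hw₂] with t ht1 ht2 h0
        filter_upwards [ht1 h0, ht2] with x hx1 hx2 hx0
        simp only [F, if_pos h0, if_neg (not_lt.2 (le_of_lt hx0))]
        rw [hf₂ _ (U_mem x t), hx1, hx2 h0 hx0]) F_init hweak h1 h2 h3 h4) h
    exact ⟨c, ae_ae_swap hc⟩
  refine ⟨U, W₁, W₂, F, p, r, |M|, max B₁ B₂ + |ε| * |M|, ?_, ?_, ?_, hw₁, hw₂⟩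
  · exact
      { mU := mU
        mW := mW₁
        mF := mF
        mp := measurable_const.max (measurable_const.min mc₁)
        U_mem := U_mem
        U_init := U_init
        bW := bW₁
        bF := bF
        F_init := F_init
        p_mem := fun t => ⟨le_max_left _ _, max_le pΦ₁ (min_le_left _ _)⟩
        pressure := hpr₁
        flux := by
          filter_upwards [hpr₁] with t ht
          filter_upwards [ht] with x hx hx0 h0
          simp only [F, if_pos h0, if_pos hx0, hx hx0 h0]
        balance := hbal }
  · refine HalfSol.of_right zΦ₂ mU mW₂ mF (measurable_const.max (measurable_const.min mc₂)) U_mem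
      U_init bW₂ bF F_init (fun t => ⟨le_max_left _ _, max_le pΦ₂ (min_le_left _ _)⟩) hpr₂ ?_ hbal
    filter_upwards [hpr₂] with t ht
    filter_upwards [ht] with x hx hx0 h0
    simp only [F, if_pos h0, if_neg (not_lt.2 (le_of_lt hx0)), hx hx0 h0]
  · filter_upwards [hp] with t ht h0 using (ht h0).2.2

lemma setIntegral_sq_congr {Ω : Set ℝ} (hΩ : MeasurableSet Ω) {w W : ℝ → ℝ → ℝ} {T : ℝ}
    (h : ∀ᵐ z : ℝ × ℝ, 0 < z.2 → z.1 ∈ Ω → w z.1 z.2 = W z.1 z.2)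
    (hi : IntegrableOn (fun z : ℝ × ℝ => w z.1 z.2 ^ 2) (Ω ×ˢ Ioc 0 T)) :
    IntegrableOn (fun z : ℝ × ℝ => W z.1 z.2 ^ 2) (Ω ×ˢ Ioc 0 T) ∧
      ∫ z in Ω ×ˢ Ioc (0:ℝ) T, w z.1 z.2 ^ 2 = ∫ z in Ω ×ˢ Ioc (0:ℝ) T, W z.1 z.2 ^ 2 := by
  have hms := hΩ.prod (measurableSet_Ioc (a := (0:ℝ)) (b := T))
  have e : ∀ᵐ z : ℝ × ℝ, z ∈ Ω ×ˢ Ioc (0:ℝ) T → w z.1 z.2 ^ 2 = W z.1 z.2 ^ 2 := by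
    filter_upwards [h] with z hz hm
    rw [hz hm.2.1 hm.1]
  exact ⟨hi.congr_fun_ae ((ae_restrict_iff' hms).2 e), setIntegral_congr_ae hms e⟩

lemma setIntegral_sq_reflect {W : ℝ → ℝ → ℝ} {T : ℝ}
    (hi : IntegrableOn (fun z : ℝ × ℝ => W z.1 z.2 ^ 2) (Ioi 0 ×ˢ Ioc 0 T)) :
    IntegrableOn (fun z : ℝ × ℝ => W (-z.1) z.2 ^ 2) (Iio 0 ×ˢ Ioc 0 T) ∧
      ∫ z in Iio (0:ℝ) ×ˢ Ioc (0:ℝ) T, W (-z.1) z.2 ^ 2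
        = ∫ z in Ioi (0:ℝ) ×ˢ Ioc (0:ℝ) T, W z.1 z.2 ^ 2 := by
  let e : ℝ × ℝ ≃ᵐ ℝ × ℝ := (MeasurableEquiv.neg ℝ).prodCongr (MeasurableEquiv.refl ℝ)
  have he : MeasurePreserving e := (Measure.measurePreserving_neg (volume : Measure ℝ)).prod
    (MeasurePreserving.id (volume : Measure ℝ))
  have hpre : e ⁻¹' (Ioi (0:ℝ) ×ˢ Ioc (0:ℝ) T) = Iio (0:ℝ) ×ˢ Ioc (0:ℝ) T := by
    ext z
    change (0 < -z.1 ∧ z.2 ∈ Ioc 0 T) ↔ (z.1 < 0 ∧ z.2 ∈ Ioc 0 T)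
    rw [neg_pos]
  rw [← hpre]
  exact ⟨(he.integrableOn_comp_preimage e.measurableEmbedding).2 hi,
    he.setIntegral_preimage_emb e.measurableEmbedding (fun z => W z.1 z.2 ^ 2) _⟩

lemma sqrt_mul_sqrt_le {ε A A' E : ℝ} (hε : 0 < ε) (hA' : 0 ≤ A')
    (h : 3 * ε / 8 * (A + A') ≤ E) : √ε * √A ≤ √(8 / 3 * |E|) := by
  rw [← Real.sqrt_mul hε.le]
  refine Real.sqrt_le_sqrt ?_
  have := le_abs_self E
  have := mul_nonneg hε.le hA'
  linarith

lemma tendsto_mul_sqrt {A : ℝ → ℝ} {C : ℝ} (h : ∀ ε ∈ Ioo (0:ℝ) 1, √ε * √(A ε) ≤ C) :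
    Tendsto (fun ε => ε * √(A ε)) (nhdsWithin 0 (Ioi 0)) (nhds 0) := by
  have l : Tendsto (fun ε : ℝ => √ε * C) (nhdsWithin 0 (Ioi 0)) (nhds 0) := by
    have : Continuous fun ε : ℝ => √ε * C := by fun_prop
    simpa using (this.tendsto 0).mono_left nhdsWithin_le_nhds
  refine tendsto_of_tendsto_of_tendsto_of_le_of_le' tendsto_const_nhds l ?_ ?_
  · filter_upwards [self_mem_nhdsWithin] with ε hε
    have : (0:ℝ) < ε := hε
    positivity
  · filter_upwards [Ioo_mem_nhdsGT (zero_lt_one (α := ℝ))] with ε hε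
    calc ε * √(A ε) = √ε * (√ε * √(A ε)) := by
          rw [← mul_assoc, Real.mul_self_sqrt hε.1.le]
      _ ≤ _ := mul_le_mul_of_nonneg_left (h ε hε) (Real.sqrt_nonneg _)

lemma nonneg_of_pos_Ioo {g : ℝ → ℝ} (hp : ∀ s ∈ Ioo (0:ℝ) 1, 0 < g s) (h0 : g 0 = 0)
    (h1 : g 1 = 0) : ∀ s ∈ Icc (0:ℝ) 1, 0 ≤ g s := by
  intro s hs
  rcases hs.1.eq_or_lt with h | h
  · rw [← h, h0]
  rcases hs.2.eq_or_lt with h' | h'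
  · rw [h', h1]
  · exact (hp s ⟨h, h'⟩).le

/-- Uniform `L²((0,T);H¹(Ωᵢ))`-type estimate (Proposition 2.4):
`√ε ‖∂ₓφᵢ(u^ε)‖_{L²(Ωᵢ×(0,T))} ≤ C` with `C` independent of `ε`, whence
`ε ‖∂ₓφᵢ(u^ε)‖_{L²(Ωᵢ×(0,T))} → 0` as `ε → 0`. -/
theorem stmt7
    (q Cc : ℝ) (hq : 0 ≤ q) (hC : 0 < Cc)
    (c₁ c₂ g₁ g₂ f₁ f₂ φ₁ φ₂ : ℝ → ℝ)
    (hc₁m : StrictMonoOn c₁ (Icc 0 1)) (hc₂m : StrictMonoOn c₂ (Icc 0 1))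
    (hc₁l : ∃ K : NNReal, LipschitzOnWith K c₁ (Icc 0 1))
    (hc₂l : ∃ K : NNReal, LipschitzOnWith K c₂ (Icc 0 1))
    (hc₁0 : c₁ 0 = 0) (hc₁1 : c₁ 1 = 1) (hc₂0 : c₂ 0 = 0) (hc₂1 : c₂ 1 = 1)
    (hg₁l : ∃ K : NNReal, LipschitzOnWith K g₁ (Icc 0 1))
    (hg₂l : ∃ K : NNReal, LipschitzOnWith K g₂ (Icc 0 1))
    (hg₁p : ∀ s ∈ Ioo (0:ℝ) 1, 0 < g₁ s) (hg₂p : ∀ s ∈ Ioo (0:ℝ) 1, 0 < g₂ s)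
    (hg₁0 : g₁ 0 = 0) (hg₁1 : g₁ 1 = 0) (hg₂0 : g₂ 0 = 0) (hg₂1 : g₂ 1 = 0)
    (hf₁ : ∀ s, f₁ s = q * c₁ s - g₁ s) (hf₂ : ∀ s, f₂ s = q * c₂ s - g₂ s)
    (hφ₁ : ∀ s, φ₁ s = Cc * ∫ r in (0:ℝ)..s, g₁ r)
    (hφ₂ : ∀ s, φ₂ s = Cc * ∫ r in (0:ℝ)..s, g₂ r)
    (u₀ : ℝ → ℝ) (hu₀m : AEMeasurable u₀)
    (hu₀b : ∀ᵐ x : ℝ, u₀ x ∈ Icc (0:ℝ) 1)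
    (uh duh : ℝ → ℝ)
    (huhb : ∀ᵐ x : ℝ, uh x ∈ Icc (0:ℝ) 1)
    (hduh : IsWeakDeriv uh duh)
    (hduhL1 : Integrable duh)
    (hduhLinfty : ∃ M : ℝ, ∀ᵐ x : ℝ, |duh x| ≤ M)
    (hu₀uh : Integrable (fun x => u₀ x - uh x))
    (d₁ d₂ : ℝ → ℝ)
    (hd₁ : IsWeakDerivOn (Iio 0) (fun x => φ₁ (u₀ x)) d₁)
    (hd₂ : IsWeakDerivOn (Ioi 0) (fun x => φ₂ (u₀ x)) d₂)
    (hd₁b : ∃ M : ℝ, ∀ᵐ x ∂ volume.restrict (Iio (0:ℝ)), |d₁ x| ≤ M)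
    (hd₂b : ∃ M : ℝ, ∀ᵐ x ∂ volume.restrict (Ioi (0:ℝ)), |d₂ x| ≤ M)
    (hconnect : Tendsto u₀ (nhdsWithin 0 (Iio 0)) (nhds 1) ∨
      Tendsto u₀ (nhdsWithin 0 (Ioi 0)) (nhds 0))
    -- the family of bounded flux solutions `u^ε` for `ε ∈ (0,1)`
    (u w₁ w₂ : ℝ → ℝ → ℝ → ℝ)
    (hfam : ∀ ε ∈ Ioo (0:ℝ) 1, IsBFS ε f₁ f₂ φ₁ φ₂ u₀ (u ε) (w₁ ε) (w₂ ε)) :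
    ∀ T : ℝ, 0 < T → ∃ C' : ℝ, 0 ≤ C' ∧
      (∀ ε ∈ Ioo (0:ℝ) 1,
        Real.sqrt ε * Real.sqrt
            (∫ p in (Iio (0:ℝ) ×ˢ Ioc (0:ℝ) T), (w₁ ε p.1 p.2) ^ 2) ≤ C' ∧
        Real.sqrt ε * Real.sqrt
            (∫ p in (Ioi (0:ℝ) ×ˢ Ioc (0:ℝ) T), (w₂ ε p.1 p.2) ^ 2) ≤ C') ∧
      Tendsto (fun ε => ε * Real.sqrt
          (∫ p in (Iio (0:ℝ) ×ˢ Ioc (0:ℝ) T), (w₁ ε p.1 p.2) ^ 2))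
        (nhdsWithin 0 (Ioi 0)) (nhds 0) ∧
      Tendsto (fun ε => ε * Real.sqrt
          (∫ p in (Ioi (0:ℝ) ×ˢ Ioc (0:ℝ) T), (w₂ ε p.1 p.2) ^ 2))
        (nhdsWithin 0 (Ioi 0)) (nhds 0) := by
  have hg₁c : ContinuousOn g₁ (Icc 0 1) := hg₁l.choose_spec.continuousOn
  have hg₂c : ContinuousOn g₂ (Icc 0 1) := hg₂l.choose_spec.continuousOn
  have hg₁n := nonneg_of_pos_Ioo hg₁p hg₁0 hg₁1
  have hg₂n := nonneg_of_pos_Ioo hg₂p hg₂0 hg₂1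
  have hf₁c : ContinuousOn f₁ (Icc 0 1) :=
    ((hc₁l.choose_spec.continuousOn.const_mul q).sub hg₁c).congr fun s _ => hf₁ s
  have hf₂c : ContinuousOn f₂ (Icc 0 1) :=
    ((hc₂l.choose_spec.continuousOn.const_mul q).sub hg₂c).congr fun s _ => hf₂ s
  obtain ⟨fh₁, B₁, cfh₁, hB₁, hfh₁⟩ := exists_flux_function (continuous_pressureFun hg₁c)
    (strictMonoOn_pressureFun hC hg₁c hg₁p) hf₁c
  obtain ⟨fh₂, B₂, cfh₂, hB₂, hfh₂⟩ := exists_flux_function (continuous_pressureFun hg₂c)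
    (strictMonoOn_pressureFun hC hg₂c hg₂p) hf₂c
  obtain ⟨U₀, mU₀, hU₀, hU₀e⟩ := exists_measurable_rep hu₀m (zero_le_one (α := ℝ))
  have hu₀U₀ : u₀ =ᵐ[volume] U₀ := by
    filter_upwards [hU₀e, hu₀b] with x h1 h2 using (h1 h2).symm
  have huhm : AEMeasurable uh := by
    refine (hu₀m.sub hu₀uh.aemeasurable).congr (Eventually.of_forall fun x => ?_)
    simp
  obtain ⟨v, dv, K, A, hvl, hv, mdv, hA, hdv, hder, huhv⟩ :=
    exists_lipschitz_rep huhm huhb hduh hduhL1 hduhLinfty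
  have hsub : Integrable fun x => U₀ x - v x := hu₀uh.congr (by
    filter_upwards [hu₀U₀, huhv] with x h1 h2
    rw [h1, h2])
  obtain ⟨κ₁, dk₁, D₁, -, hr₁⟩ := exists_refState_left (Cc := Cc) hg₁c hvl hv mdv hA hdv hder hsub
  obtain ⟨κ₂, dk₂, D₂, -, hr₂⟩ := exists_refState_right (Cc := Cc) hg₂c hvl hv mdv hA hdv hder hsub
  have hd₁ := halfData_left hC hg₁c hg₁0 hg₁n hc₁0 hf₁ cfh₁ hB₁ hfh₁
  have hd₂ := halfData_right hC hq hg₂c hg₂1 hg₂n hc₂1 hf₂ cfh₂ hB₂ hfh₂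
  intro T hT
  obtain ⟨E, hE⟩ : ∃ E : ℝ, ∀ ε ∈ Ioo (0:ℝ) 1, 3 * ε / 8 *
      ((∫ z in Iio (0:ℝ) ×ˢ Ioc (0:ℝ) T, w₁ ε z.1 z.2 ^ 2)
        + ∫ z in Ioi (0:ℝ) ×ˢ Ioc (0:ℝ) T, w₂ ε z.1 z.2 ^ 2) ≤ E := by
    refine ⟨energyBound (pressureFun Cc g₁) U₀ κ₁ dk₁ B₁ D₁ T
      + energyBound (fun s => pressureFun Cc g₂ 1 - pressureFun Cc g₂ (1 - s))
        (fun x => 1 - U₀ (-x)) κ₂ dk₂ B₂ D₂ T, fun ε hε => ?_⟩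
    obtain ⟨U, W₁, W₂, F, p, r, M, N, hs, hs', hp, e₁, e₂⟩ := exists_halfSol hC hg₁c hg₂c hg₁n hg₂n
      hφ₁ hφ₂ cfh₁ hB₁ hfh₁ cfh₂ hB₂ hfh₂ mU₀ hU₀ hu₀U₀ (hfam ε hε)
    obtain ⟨-, -, -, -, -, -, -, hi, -, -⟩ := hfam ε hε
    obtain ⟨i₁, k₁⟩ := setIntegral_sq_congr measurableSet_Iio e₁ (hi T hT).1
    obtain ⟨i₂, k₂⟩ := setIntegral_sq_congr measurableSet_Ioi e₂ (hi T hT).2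
    obtain ⟨i₃, k₃⟩ := setIntegral_sq_reflect i₂
    rw [k₁, k₂, ← k₃]
    exact dissipation_le hd₁ hs hr₁ hd₂ hs' hr₂ hε.1 hε.2 hp hs.U_mem hs.balance hT i₁ i₃
  have hb₁ : ∀ ε ∈ Ioo (0:ℝ) 1, √ε * √(∫ p in (Iio (0:ℝ) ×ˢ Ioc (0:ℝ) T), (w₁ ε p.1 p.2) ^ 2)
      ≤ √(8 / 3 * |E|) := fun ε hε =>
    sqrt_mul_sqrt_le hε.1 (integral_nonneg fun z => sq_nonneg _) (hE ε hε)
  have hb₂ : ∀ ε ∈ Ioo (0:ℝ) 1, √ε * √(∫ p in (Ioi (0:ℝ) ×ˢ Ioc (0:ℝ) T), (w₂ ε p.1 p.2) ^ 2)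
      ≤ √(8 / 3 * |E|) := fun ε hε =>
    sqrt_mul_sqrt_le hε.1 (integral_nonneg fun z => sq_nonneg _)
      ((congrArg _ (add_comm _ _)).trans_le (hE ε hε))
  exact ⟨_, Real.sqrt_nonneg _, fun ε hε => ⟨hb₁ ε hε, hb₂ ε hε⟩, tendsto_mul_sqrt hb₁,
    tendsto_mul_sqrt hb₂⟩
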